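/- There exists an absolute constant C > 0 such that for every prime p and every d that is a power of 2, there exists a totally real number field K of degree d over ℚ in which p splits completely and whose discriminant satisfies Δ_K ≤ C^d. -/

import Mathlib

open NumberField

/-- A number field is totally real if every embedding into `ℂ` takes real values. -/
def TotallyReal (K : Type*) [Field K] : Prop :=
  ∀ φ : K →+* ℂ, ∀ x : K, (φ x).im = 0

set_option linter.unusedSectionVars false

namespace Tower

open NumberField IsDedekindDomain

/-- The finite places of a number field. -/
abbrev Pl (k : Type) [Field k] [NumberField k] := HeightOneSpectrum (𝓞 k)

section Basic

variable {k : Type} [Field k] [NumberField k]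

/-- The normalized additive valuation at a finite place, with `ord v 0 = 0`. -/
noncomputable def ord (v : Pl k) (x : k) : ℤ := -(WithZero.log (v.valuation k x))

lemma ord_mul (v : Pl k) {x y : k} (hx : x ≠ 0) (hy : y ≠ 0) :
    ord v (x * y) = ord v x + ord v y := by
  have h1 : v.valuation k x ≠ 0 := by simpa using hx
  have h2 : v.valuation k y ≠ 0 := by simpa using hy
  simp only [ord, map_mul, WithZero.log_mul h1 h2]; ring

@[simp] lemma ord_zero (v : Pl k) : ord v 0 = 0 := by simp [ord]

@[simp] lemma ord_one (v : Pl k) : ord v 1 = 0 := by simp [ord]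

lemma ord_inv (v : Pl k) (x : k) : ord v x⁻¹ = - ord v x := by
  simp [ord, WithZero.log_inv]

lemma ord_pow (v : Pl k) (x : k) (n : ℕ) : ord v (x ^ n) = n * ord v x := by
  simp [ord, WithZero.log_pow]

lemma ord_zpow (v : Pl k) (x : k) (n : ℤ) : ord v (x ^ n) = n * ord v x := by
  simp [ord, WithZero.log_zpow]

lemma ord_div (v : Pl k) {x y : k} (hx : x ≠ 0) (hy : y ≠ 0) :
    ord v (x / y) = ord v x - ord v y := by
  rw [div_eq_mul_inv, ord_mul v hx (inv_ne_zero hy), ord_inv]; ring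

@[simp] lemma ord_neg (v : Pl k) (x : k) : ord v (-x) = ord v x := by
  simp [ord, Valuation.map_neg]

/-- `x` lies in the `n`-th power of the maximal ideal at `v`. -/
def Vge (v : Pl k) (n : ℤ) (x : k) : Prop := v.valuation k x ≤ WithZero.exp (-n)

lemma vge_iff {v : Pl k} {n : ℤ} {x : k} (hx : x ≠ 0) : Vge v n x ↔ n ≤ ord v x := by
  have h1 : v.valuation k x ≠ 0 := by simpa using hx
  rw [Vge, ord, ← WithZero.log_le_log h1 (by simp), WithZero.log_exp]
  omega

@[simp] lemma vge_zero (v : Pl k) (n : ℤ) : Vge v n 0 := by simp [Vge]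

lemma Vge.add {v : Pl k} {n : ℤ} {x y : k} (hx : Vge v n x) (hy : Vge v n y) :
    Vge v n (x + y) := (Valuation.map_add_le _ hx hy)

lemma Vge.neg {v : Pl k} {n : ℤ} {x : k} (hx : Vge v n x) : Vge v n (-x) := by
  simpa [Vge, Valuation.map_neg] using hx

lemma Vge.sub {v : Pl k} {n : ℤ} {x y : k} (hx : Vge v n x) (hy : Vge v n y) :
    Vge v n (x - y) := by
  rw [sub_eq_add_neg]; exact hx.add hy.neg

lemma Vge.mul {v : Pl k} {n m : ℤ} {x y : k} (hx : Vge v n x) (hy : Vge v m y) :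
    Vge v (n + m) (x * y) := by
  unfold Vge at *
  rw [map_mul, neg_add, WithZero.exp_add]
  exact mul_le_mul' hx hy

lemma Vge.mono {v : Pl k} {n m : ℤ} {x : k} (hx : Vge v n x) (h : m ≤ n) : Vge v m x := by
  by_cases h0 : x = 0
  · simp [h0]
  · rw [vge_iff h0] at *; omega

lemma vge_of_ord {v : Pl k} {x : k} : Vge v (ord v x) x := by
  by_cases h0 : x = 0
  · simp [h0]
  · rw [vge_iff h0]

lemma vge_int (v : Pl k) (a : 𝓞 k) : Vge v 0 (a : k) := by
  simpa [Vge] using v.valuation_le_one a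

lemma vge_int_iff (v : Pl k) (a : 𝓞 k) (n : ℕ) : Vge v n (a : k) ↔ a ∈ v.asIdeal ^ n := by
  rw [Vge]
  erw [v.valuation_of_algebraMap a]
  exact v.intValuation_le_pow_iff_mem a n

lemma vge_intCast (v : Pl k) (n : ℤ) : Vge v 0 (n : k) := by
  simpa using vge_int v (n : 𝓞 k)

lemma vge_natCast (v : Pl k) (n : ℕ) : Vge v 0 (n : k) := by
  simpa using vge_int v (n : 𝓞 k)

lemma vge_two (v : Pl k) : Vge v 0 (2 : k) := by simpa using vge_natCast v 2

lemma ord_int_nonneg (v : Pl k) (a : 𝓞 k) : 0 ≤ ord v (a : k) := by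
  by_cases h : (a : k) = 0
  · simp [h]
  · exact (vge_iff h).1 (vge_int v a)

lemma ord_add_eq {v : Pl k} {x y : k} (hx : x ≠ 0) (hy : Vge v (ord v x + 1) y) :
    x + y ≠ 0 ∧ ord v (x + y) = ord v x := by
  have h1 : ¬ Vge v (ord v x + 1) x := by rw [vge_iff hx]; omega
  have h2 : ¬ Vge v (ord v x + 1) (x + y) := fun h => h1 (by simpa using h.sub hy)
  have h0 : x + y ≠ 0 := fun h => h2 (by simp [h])
  refine ⟨h0, ?_⟩
  have h3 : Vge v (ord v x) (x + y) := vge_of_ord.add (hy.mono (by omega))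
  rw [vge_iff h0] at h2 h3
  omega

lemma exists_uniformizer (v : Pl k) : ∃ π : k, π ≠ 0 ∧ ord v π = 1 := by
  obtain ⟨π, hπ⟩ := v.valuation_exists_uniformizer k
  refine ⟨π, ?_, ?_⟩
  · rintro rfl; rw [map_zero] at hπ; exact WithZero.exp_ne_zero hπ.symm
  · simp only [ord]; rw [hπ]; simp

lemma exists_ord_eq (v : Pl k) (n : ℤ) : ∃ π : k, π ≠ 0 ∧ ord v π = n := by
  obtain ⟨π, h0, h⟩ := exists_uniformizer v
  exact ⟨π ^ n, zpow_ne_zero _ h0, by simp [ord_zpow, h]⟩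

lemma finite_ord_ne_zero (x : k) : {v : Pl k | ord v x ≠ 0}.Finite := by
  by_cases hx : x = 0
  · simp [hx]
  have key : ∀ a : 𝓞 k, a ≠ 0 → {v : Pl k | ord v (a : k) ≠ 0}.Finite := by
    intro a ha
    have hI : Ideal.span {a} ≠ 0 := by simpa using ha
    refine (Ideal.finite_factors hI).subset ?_
    intro v hv
    simp only [Set.mem_ofPred_eq, Ideal.dvd_span_singleton] at hv ⊢
    have h0 : (a : k) ≠ 0 := by simpa using ha
    have := ord_int_nonneg v a
    have h1 : Vge v (1 : ℕ) (a : k) := by rw [vge_iff h0]; simp; omega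
    simpa using (vge_int_iff v a 1).1 h1
  obtain ⟨a, b, hb, rfl⟩ := IsFractionRing.div_surjective (A := 𝓞 k) x
  have hb0 : b ≠ 0 := nonZeroDivisors.ne_zero hb
  have ha0 : a ≠ 0 := by rintro rfl; simp at hx
  refine ((key a ha0).union (key b hb0)).subset ?_
  intro v hv
  simp only [Set.mem_union, Set.mem_ofPred_eq] at hv ⊢
  rw [ord_div v (by simpa using ha0) (by simpa using hb0)] at hv
  by_contra h
  rw [not_or] at h
  have h1 : ord v (algebraMap (𝓞 k) k a) = 0 := not_not.1 h.1
  have h2 : ord v (algebraMap (𝓞 k) k b) = 0 := not_not.1 h.2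
  exact hv (by rw [h1, h2, sub_zero])

lemma mem_integers_of_vge {x : k} (h : ∀ v : Pl k, Vge v 0 x) : ∃ a : 𝓞 k, (a : k) = x := by
  obtain ⟨a, ha⟩ := HeightOneSpectrum.mem_integers_of_valuation_le_one (R := 𝓞 k) k x
    (fun v => by simpa [Vge] using h v)
  exact ⟨a, ha⟩

lemma exists_unit_of_ord {x : k} (hx : x ≠ 0) (h : ∀ v : Pl k, ord v x = 0) :
    ∃ u : (𝓞 k)ˣ, ((u : 𝓞 k) : k) = x := by
  obtain ⟨a, ha⟩ := mem_integers_of_vge (x := x) (fun v => by rw [vge_iff hx]; simp [h])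
  obtain ⟨b, hb⟩ := mem_integers_of_vge (x := x⁻¹)
    (fun v => by rw [vge_iff (inv_ne_zero hx)]; simp [ord_inv, h])
  have hab : a * b = 1 := by
    apply RingOfIntegers.ext
    simp [ha, hb, hx]
  exact ⟨⟨a, b, hab, by rw [mul_comm]; exact hab⟩, ha⟩

lemma ord_unit (u : (𝓞 k)ˣ) (v : Pl k) : ord v ((u : 𝓞 k) : k) = 0 := by
  have h1 := ord_int_nonneg v (u : 𝓞 k)
  have h2 := ord_int_nonneg v ((u⁻¹ : (𝓞 k)ˣ) : 𝓞 k)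
  have hu : ((u : 𝓞 k) : k) ≠ 0 := by simp
  have : (((u⁻¹ : (𝓞 k)ˣ) : 𝓞 k) : k) = ((u : 𝓞 k) : k)⁻¹ := by
    refine eq_inv_of_mul_eq_one_left ?_
    rw [← map_mul]; simp
  rw [this, ord_inv] at h2
  omega

lemma ord_count {x : k} (hx : x ≠ 0) (v : Pl k) :
    FractionalIdeal.count k v (FractionalIdeal.spanSingleton (nonZeroDivisors (𝓞 k)) x)
      = ord v x := by
  classical
  have key : ∀ a : 𝓞 k, a ≠ 0 → FractionalIdeal.count k v
      (FractionalIdeal.spanSingleton (nonZeroDivisors (𝓞 k)) (a : k)) = ord v (a : k) := by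
    intro a ha
    have : FractionalIdeal.spanSingleton (nonZeroDivisors (𝓞 k)) (a : k)
        = ((Ideal.span {a} : Ideal (𝓞 k)) : FractionalIdeal (nonZeroDivisors (𝓞 k)) k) := by
      rw [FractionalIdeal.coeIdeal_span_singleton]
    rw [this, FractionalIdeal.count_coe k v (by simpa using ha), ord]
    erw [v.valuation_of_algebraMap a]
    rw [v.intValuation_if_neg ha]
    simp
  obtain ⟨a, b, hb, rfl⟩ := IsFractionRing.div_surjective (A := 𝓞 k) x
  have hb0 : b ≠ 0 := nonZeroDivisors.ne_zero hb
  have ha0 : a ≠ 0 := by rintro rfl; simp at hx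
  rw [ord_div v (by simpa using ha0) (by simpa using hb0), ← key a ha0, ← key b hb0]
  rw [← FractionalIdeal.spanSingleton_div_spanSingleton, div_eq_mul_inv,
    FractionalIdeal.count_mul, FractionalIdeal.count_inv, sub_eq_add_neg]
  · simpa [FractionalIdeal.spanSingleton_ne_zero_iff] using ha0
  · simpa [FractionalIdeal.spanSingleton_ne_zero_iff] using hb0

/-- Outside the finite set `T`, every divisor is principal. -/
def ClassTrivial (T : Set (Pl k)) : Prop :=
  ∀ m : Pl k → ℤ, {v | m v ≠ 0}.Finite → ∃ c : k, c ≠ 0 ∧ ∀ v, v ∉ T → ord v c = m v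

lemma ClassTrivial.mono {T T' : Set (Pl k)} (h : ClassTrivial T) (hT : T ⊆ T') :
    ClassTrivial T' := fun m hm => by
  obtain ⟨c, h0, hc⟩ := h m hm
  exact ⟨c, h0, fun v hv => hc v (fun h => hv (hT h))⟩

/-- A fractional ideal with prescribed finite divisor. -/
lemma exists_fracIdeal (m : Pl k → ℤ) (hm : {v | m v ≠ 0}.Finite) :
    ∃ I : (FractionalIdeal (nonZeroDivisors (𝓞 k)) k)ˣ,
      ∀ v, FractionalIdeal.count k v (I : FractionalIdeal (nonZeroDivisors (𝓞 k)) k) = m v := by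
  let I := ∏ v ∈ hm.toFinset, (v.asIdeal : FractionalIdeal (nonZeroDivisors (𝓞 k)) k) ^ (m v)
  have h0 : ∀ v : Pl k, (v.asIdeal : FractionalIdeal (nonZeroDivisors (𝓞 k)) k) ^ (m v) ≠ 0 :=
    fun v => zpow_ne_zero _ (by simpa using v.ne_bot)
  have hI : I ≠ 0 := Finset.prod_ne_zero_iff.2 (fun v _ => h0 v)
  refine ⟨Units.mk0 I hI, fun v => ?_⟩
  classical
  rw [Units.val_mk0, FractionalIdeal.count_prod _ _ _ _ (fun v _ => h0 v)]
  have : ∀ w ∈ hm.toFinset, FractionalIdeal.count k v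
      ((w.asIdeal : FractionalIdeal (nonZeroDivisors (𝓞 k)) k) ^ (m w))
      = if w = v then m w else 0 := by
    intro w _
    rw [FractionalIdeal.count_zpow, FractionalIdeal.count_maximal]
    split_ifs <;> simp_all
  rw [Finset.sum_congr rfl this]
  simp +contextual

lemma exists_of_mk_eq {I J : (FractionalIdeal (nonZeroDivisors (𝓞 k)) k)ˣ}
    (h : ClassGroup.mk (K := k) I = ClassGroup.mk (K := k) J) : ∃ c : k, c ≠ 0 ∧
      ∀ v : Pl k, ord v c = FractionalIdeal.count k v (I : FractionalIdeal _ k)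
        - FractionalIdeal.count k v (J : FractionalIdeal _ k) := by
  have h1 : ClassGroup.mk (K := k) (I / J) = 1 := by rw [map_div, h, div_self']
  rw [ClassGroup.mk_eq_one_iff] at h1
  rw [FractionalIdeal.isPrincipal_iff] at h1
  obtain ⟨c, hc⟩ := h1
  have hne : ((I / J : (FractionalIdeal (nonZeroDivisors (𝓞 k)) k)ˣ) :
    FractionalIdeal (nonZeroDivisors (𝓞 k)) k) ≠ 0 := Units.ne_zero _
  have hc0 : c ≠ 0 := by
    rintro rfl
    rw [hc] at hne; simp at hne
  refine ⟨c, hc0, fun v => ?_⟩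
  rw [← ord_count hc0, ← hc, Units.val_div_eq_div_val, div_eq_mul_inv, FractionalIdeal.count_mul,
    FractionalIdeal.count_inv, sub_eq_add_neg]
  · exact Units.ne_zero _
  · exact inv_ne_zero (Units.ne_zero _)

lemma exists_classTrivial : ∃ T : Set (Pl k), T.Finite ∧ ClassTrivial T := by
  classical
  have hrep : ∀ c : ClassGroup (𝓞 k), ∃ I : (FractionalIdeal (nonZeroDivisors (𝓞 k)) k)ˣ,
      ClassGroup.mk (K := k) I = c := by
    intro c
    obtain ⟨I, hI⟩ := ClassGroup.mk0_surjective c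
    exact ⟨FractionalIdeal.mk0 k I, by rw [ClassGroup.mk_mk0, hI]⟩
  choose R hR using hrep
  refine ⟨⋃ c, {v | FractionalIdeal.count k v (R c : FractionalIdeal _ k) ≠ 0},
    Set.finite_iUnion fun c => by
      have := FractionalIdeal.finite_factors (K := k) (R := 𝓞 k) (R c)
      rwa [Filter.eventually_cofinite] at this, ?_⟩
  intro m hm
  obtain ⟨I, hI⟩ := exists_fracIdeal m hm
  obtain ⟨c, hc0, hc⟩ := exists_of_mk_eq (hR (ClassGroup.mk (K := k) I)).symm
  refine ⟨c, hc0, fun v hv => ?_⟩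
  simp only [Set.mem_iUnion, not_exists, Set.mem_ofPred_eq, not_not] at hv
  rw [hc, hI, hv, sub_zero]

end Basic

end Tower

namespace Tower

open NumberField IsDedekindDomain

section Crt

variable {k : Type} [Field k] [NumberField k]

lemma exists_crt (S : Set (Pl k)) (hS : S.Finite) (n : ℕ) (x : Pl k → 𝓞 k) :
    ∃ y : 𝓞 k, ∀ v ∈ S, y - x v ∈ v.asIdeal ^ n := by
  obtain ⟨y, hy⟩ := IsDedekindDomain.exists_forall_sub_mem_ideal (s := hS.toFinset)
    (fun v : Pl k => v.asIdeal) (fun _ => n) (fun v _ => v.prime)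
    (fun v _ w _ hvw h => hvw (HeightOneSpectrum.ext h)) (fun v => x v)
  exact ⟨y, fun v hv => hy v (by simpa using hv)⟩

lemma exists_int_ord_one (v : Pl k) : ∃ a : 𝓞 k, a ≠ 0 ∧ ord v (a : k) = 1 := by
  have h : ¬ (v.asIdeal ≤ v.asIdeal ^ 2) := by
    intro h
    have h2 : v.asIdeal ^ 2 < v.asIdeal ^ 1 :=
      Ideal.pow_right_strictAnti v.asIdeal v.ne_bot v.isPrime.ne_top (by norm_num)
    rw [pow_one] at h2
    exact absurd h h2.not_ge
  obtain ⟨a, ha, ha2⟩ := Set.not_subset.1 h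
  have ha0 : a ≠ 0 := by rintro rfl; exact ha2 (Ideal.zero_mem _)
  have ha0' : (a : k) ≠ 0 := by simpa using ha0
  have h1 : Vge v (1 : ℕ) (a : k) := (vge_int_iff v a 1).2 (by simpa using ha)
  have h2 : ¬ Vge v (2 : ℕ) (a : k) := fun h => ha2 ((vge_int_iff v a 2).1 h)
  rw [vge_iff ha0'] at h1 h2
  exact ⟨a, ha0, by push_cast at h1 h2; omega⟩

/-- Weak approximation: an integer with order `0` or `1` prescribed at finitely many places. -/
lemma exists_int_ord (S : Set (Pl k)) (hS : S.Finite) (hne : S.Nonempty) (m : Pl k → Prop) :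
    ∃ a : 𝓞 k, a ≠ 0 ∧ ∀ v ∈ S, (m v → ord v (a : k) = 1) ∧ (¬ m v → ord v (a : k) = 0) := by
  classical
  choose π hπ0 hπ using fun v : Pl k => exists_int_ord_one v
  obtain ⟨y, hy⟩ := exists_crt S hS 2 (fun v => if m v then π v else 1)
  have key : ∀ v ∈ S, (y : k) ≠ 0 ∧ (m v → ord v (y : k) = 1) ∧ (¬ m v → ord v (y : k) = 0) := by
    intro v hv
    have h := hy v hv
    have h' := (vge_int_iff v _ 2).2 h
    by_cases hm : m v
    · simp only [hm, if_true] at h'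
      have := ord_add_eq (v := v) (x := (π v : k)) (y := (y : k) - (π v : k))
        (by simpa using hπ0 v) (by rw [hπ v]; simpa using h')
      rw [add_sub_cancel, hπ v] at this
      exact ⟨this.1, fun _ => this.2, fun h => absurd hm h⟩
    · simp only [hm, if_false] at h'
      have := ord_add_eq (v := v) (x := (1 : k)) (y := (y : k) - 1) (by simp)
        (by rw [ord_one]; simpa using h'.mono (by norm_num))
      rw [add_sub_cancel, ord_one] at this
      exact ⟨this.1, fun h => absurd h hm, fun _ => this.2⟩
  refine ⟨y, ?_, fun v hv => (key v hv).2⟩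
  obtain ⟨v, hv⟩ := hne
  rintro rfl
  exact (key v hv).1 (by simp)

end Crt

section Ext

variable (k : Type) {K : Type} [Field k] [NumberField k] [Field K] [NumberField K] [Algebra k K]

/-- The place of the base field below a place. -/
noncomputable def below (P : Pl K) : Pl k := P.under (𝓞 k)

/-- The ramification index of a place over the base field. -/
noncomputable def eR (P : Pl K) : ℕ := (below k P).asIdeal.ramificationIdx' P.asIdeal

instance below_liesOver (P : Pl K) : P.asIdeal.LiesOver (below k P).asIdeal := ⟨rfl⟩

variable {k}

lemma ord_algebraMap (P : Pl K) (x : k) :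
    ord P (algebraMap k K x) = eR k P * ord (below k P) x := by
  rw [ord, ← HeightOneSpectrum.valuation_liesOver K (below k P) P x, ord, WithZero.log_pow, eR]
  simp

lemma eR_pos (P : Pl K) : 1 ≤ eR k P :=
  Nat.one_le_iff_ne_zero.2
    (Ideal.IsDedekindDomain.ramificationIdx'_ne_zero_of_liesOver P.asIdeal (below k P).ne_bot)

lemma vge_algebraMap {P : Pl K} {x : k} {n : ℤ} (hn : 0 ≤ n) (h : Vge (below k P) n x) :
    Vge P n (algebraMap k K x) := by
  by_cases h0 : x = 0
  · simp [h0]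
  rw [vge_iff h0] at h
  rw [vge_iff (by simpa using h0), ord_algebraMap]
  have := eR_pos (k := k) P
  nlinarith

lemma vge_of_algebraMap {P : Pl K} {x : k} (h : Vge P 0 (algebraMap k K x)) :
    Vge (below k P) 0 x := by
  by_cases h0 : x = 0
  · simp [h0]
  rw [vge_iff h0]
  rw [vge_iff (by simpa using h0), ord_algebraMap] at h
  have := eR_pos (k := k) P
  by_contra! h'
  nlinarith

lemma exists_above (v : Pl k) : ∃ P : Pl K, below k P = v := by
  obtain ⟨P, hPm, hP⟩ := Ideal.exists_maximal_ideal_liesOver_of_isIntegral (S := 𝓞 K) v.asIdeal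
  have : P ≠ ⊥ := Ideal.ne_bot_of_liesOver_of_ne_bot v.ne_bot P
  exact ⟨⟨P, hPm.isPrime, this⟩, HeightOneSpectrum.ext hP.over.symm⟩

lemma below_eq_of {P : Pl K} {v : Pl k}
    (h : ∀ a : 𝓞 k, a ≠ 0 → ord v (a : k) = 1 → ord P (algebraMap k K a) ≠ 0) :
    below k P = v := by
  by_contra hne
  obtain ⟨a, ha0, ha⟩ := exists_int_ord ({below k P, v} : Set (Pl k)) (by simp) (by simp)
    (fun w => w = v)
  have h1 := (ha v (by simp)).1 rfl
  have h2 := (ha (below k P) (by simp)).2 hne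
  refine h a ha0 h1 ?_
  rw [ord_algebraMap, h2, mul_zero]

lemma finite_fibre (v : Pl k) : {P : Pl K | below k P = v}.Finite := by
  obtain ⟨a, ha0, ha⟩ := exists_int_ord_one v
  refine (finite_ord_ne_zero (algebraMap k K a)).subset ?_
  rintro P rfl
  have := eR_pos (k := k) P
  simp only [Set.mem_ofPred_eq]
  rw [ord_algebraMap, ha]
  simp; omega

lemma finite_preimage {T : Set (Pl k)} (hT : T.Finite) : {P : Pl K | below k P ∈ T}.Finite := by
  have : {P : Pl K | below k P ∈ T} = ⋃ v ∈ T, {P : Pl K | below k P = v} := by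
    ext; simp
  rw [this]
  exact hT.biUnion fun v _ => finite_fibre v

section towers

variable {L : Type} [Field L] [NumberField L] [Algebra k L] [Algebra K L] [IsScalarTower k K L]

lemma below_below (P : Pl L) : below k (below K P) = below k P := by
  symm
  apply below_eq_of
  intro a ha0 ha
  rw [IsScalarTower.algebraMap_apply k K L, ord_algebraMap, ord_algebraMap, ha]
  have := eR_pos (k := K) P
  have := eR_pos (k := k) (below K P)
  positivity

lemma eR_tower (P : Pl L) : eR k P = eR K P * eR k (below K P) := by
  obtain ⟨a, ha0, ha⟩ := exists_int_ord_one (below k P)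
  have h1 := ord_algebraMap P (a : k)
  rw [IsScalarTower.algebraMap_apply k K L, ord_algebraMap, ord_algebraMap, below_below, ha] at h1
  simp only [mul_one] at h1
  exact_mod_cast h1.symm

end towers

end Ext

section Map

variable {K L : Type} [Field K] [NumberField K] [Field L] [NumberField L]

/-- Transport of places along an isomorphism of number fields. -/
noncomputable def mapPl (σ : K ≃+* L) (P : Pl K) : Pl L :=
  HeightOneSpectrum.equivOfRingEquiv (RingOfIntegers.mapRingEquiv σ) P

lemma mem_mapPl_pow (σ : K ≃+* L) (P : Pl K) (a : 𝓞 K) (n : ℕ) :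
    RingOfIntegers.mapRingEquiv σ a ∈ (mapPl σ P).asIdeal ^ n ↔ a ∈ P.asIdeal ^ n := by
  have h1 : (mapPl σ P).asIdeal = P.asIdeal.map (RingOfIntegers.mapRingEquiv σ) := by
    rw [← Ideal.comap_symm]
    rfl
  rw [h1, ← Ideal.map_pow]
  constructor
  · intro h
    rw [← Ideal.comap_symm, Ideal.mem_comap] at h
    simpa using h
  · exact fun h => Ideal.mem_map_of_mem _ h

lemma ord_mapPl (σ : K ≃+* L) (P : Pl K) (x : K) : ord (mapPl σ P) (σ x) = ord P x := by
  have key : ∀ a : 𝓞 K, a ≠ 0 → ord (mapPl σ P) (σ a) = ord P (a : K) := by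
    intro a ha
    have h0 : (a : K) ≠ 0 := by simpa using ha
    have h0' : σ (a : K) ≠ 0 := by simpa using h0
    have hn : ∀ n : ℕ, (n : ℤ) ≤ ord (mapPl σ P) (σ a) ↔ (n : ℤ) ≤ ord P (a : K) := by
      intro n
      rw [← vge_iff h0, ← vge_iff h0', vge_int_iff, ← mem_mapPl_pow σ P a n, ← vge_int_iff]
      rfl
    have h1 := ord_int_nonneg P a
    have h2 : 0 ≤ ord (mapPl σ P) (σ a) := by
      simpa using (hn 0).2 (by simpa using h1)
    have h3 := hn (ord P (a : K)).toNat
    have h4 := hn (ord (mapPl σ P) (σ a)).toNat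
    rw [Int.toNat_of_nonneg h1] at h3
    rw [Int.toNat_of_nonneg h2] at h4
    exact le_antisymm (h4.1 le_rfl) (h3.2 le_rfl)
  by_cases hx : x = 0
  · simp [hx]
  obtain ⟨a, b, hb, rfl⟩ := IsFractionRing.div_surjective (A := 𝓞 K) x
  have hb0 : b ≠ 0 := nonZeroDivisors.ne_zero hb
  have ha0 : a ≠ 0 := by rintro rfl; simp at hx
  rw [map_div₀, ord_div _ (by simpa using ha0) (by simpa using hb0), ord_div _ (by simpa using ha0)
    (by simpa using hb0)]
  erw [key a ha0, key b hb0]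

lemma pl_eq_of_ord {P Q : Pl K} (h : ∀ a : 𝓞 K, a ≠ 0 → ord Q (a : K) = 1 → ord P (a : K) ≠ 0) :
    P = Q := by
  by_contra hne
  obtain ⟨a, ha0, ha⟩ := exists_int_ord ({P, Q} : Set (Pl K)) (by simp) (by simp)
    (fun w => w = Q)
  exact h a ha0 ((ha Q (by simp)).1 rfl) ((ha P (by simp)).2 hne)

lemma ord_mapPl' (σ : K ≃+* L) (P : Pl K) (x : L) :
    ord (mapPl σ P) x = ord P (σ.symm x) := by
  rw [← ord_mapPl σ P, RingEquiv.apply_symm_apply]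

end Map

section Gal

variable {k K : Type} [Field k] [NumberField k] [Field K] [NumberField K] [Algebra k K]

/-- The Galois action on places. -/
noncomputable def gPl (σ : K ≃ₐ[k] K) (P : Pl K) : Pl K := mapPl σ.toRingEquiv P

lemma ord_gPl (σ : K ≃ₐ[k] K) (P : Pl K) (x : K) : ord (gPl σ P) (σ x) = ord P x :=
  ord_mapPl σ.toRingEquiv P x

lemma ord_gPl' (σ : K ≃ₐ[k] K) (P : Pl K) (x : K) : ord (gPl σ P) x = ord P (σ.symm x) :=
  ord_mapPl' σ.toRingEquiv P x

lemma vge_gPl (σ : K ≃ₐ[k] K) (P : Pl K) (x : K) (n : ℤ) : Vge (gPl σ P) n (σ x) ↔ Vge P n x := by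
  by_cases h : x = 0
  · simp [h]
  · rw [vge_iff h, vge_iff (by simpa using h), ord_gPl]

lemma below_gPl (σ : K ≃ₐ[k] K) (P : Pl K) : below k (gPl σ P) = below k P := by
  apply below_eq_of
  intro a ha0 ha
  rw [ord_gPl', AlgEquiv.commutes, ord_algebraMap, ha]
  have := eR_pos (k := k) P
  positivity

lemma eR_gPl (σ : K ≃ₐ[k] K) (P : Pl K) : eR k (gPl σ P) = eR k P := by
  obtain ⟨a, ha0, ha⟩ := exists_int_ord_one (below k P)
  have h1 := ord_algebraMap (gPl σ P) (a : k)
  rw [ord_gPl', AlgEquiv.commutes, ord_algebraMap, below_gPl, ha] at h1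
  simp only [mul_one] at h1
  exact_mod_cast h1.symm

lemma gPl_gPl (σ τ : K ≃ₐ[k] K) (P : Pl K) : gPl σ (gPl τ P) = gPl (σ * τ) P := by
  apply pl_eq_of_ord
  intro a _ h
  rw [ord_gPl', ord_gPl']
  rw [ord_gPl'] at h
  have : (σ * τ).symm (a : K) = τ.symm (σ.symm a) := rfl
  rw [this] at h
  omega

lemma gPl_transitive [IsGalois k K] {P Q : Pl K} (h : below k P = below k Q) :
    ∃ σ : K ≃ₐ[k] K, gPl σ P = Q := by
  classical
  by_contra! hne
  have hfin : (Set.range fun σ : K ≃ₐ[k] K => gPl σ P).Finite := Set.finite_range _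
  obtain ⟨a, ha0, ha⟩ := exists_int_ord (insert Q (Set.range fun σ : K ≃ₐ[k] K => gPl σ P))
    (hfin.insert Q) (by simp) (fun w => w = Q)
  have h1 : ∀ σ : K ≃ₐ[k] K, ord P (σ (a : K)) = 0 := by
    intro σ
    have := (ha (gPl σ.symm P) (by simp)).2 (hne _)
    rw [ord_gPl'] at this
    exact this
  have h2 := (ha Q (by simp)).1 rfl
  have ha0' : (a : K) ≠ 0 := by simpa using ha0
  have hprod : ∀ (R : Pl K) (s : Finset (K ≃ₐ[k] K)), ord R (∏ σ ∈ s, σ (a : K))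
      = ∑ σ ∈ s, ord R (σ (a : K)) := by
    intro R s
    induction s using Finset.induction_on with
    | empty => simp
    | insert σ s hs ih =>
      rw [Finset.prod_insert hs, Finset.sum_insert hs, ord_mul _ (by simpa using ha0')
        (Finset.prod_ne_zero_iff.2 fun τ _ => by simpa using ha0'), ih]
  have hN := Algebra.norm_eq_prod_automorphisms k (a : K)
  have hP := ord_algebraMap P (Algebra.norm k (a : K))
  have hQ := ord_algebraMap Q (Algebra.norm k (a : K))
  rw [hN, hprod] at hP hQ
  rw [Finset.sum_eq_zero (fun σ _ => h1 σ)] at hP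
  have hv : ord (below k P) (Algebra.norm k (a : K)) = 0 := by
    have := eR_pos (k := k) P
    rcases mul_eq_zero.1 hP.symm with h | h
    · exfalso; simp at h; omega
    · exact h
  rw [← h, hv, mul_zero] at hQ
  have hpos : ∀ σ ∈ (Finset.univ : Finset (K ≃ₐ[k] K)), 0 ≤ ord Q (σ (a : K)) := fun σ _ =>
    ord_int_nonneg Q (RingOfIntegers.mapRingEquiv σ.toRingEquiv a)
  have := (Finset.sum_eq_zero_iff_of_nonneg hpos).1 hQ 1 (Finset.mem_univ _)
  simp only [AlgEquiv.one_apply] at this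
  omega

end Gal

end Tower

namespace Tower

open NumberField IsDedekindDomain

variable {k K : Type} [Field k] [NumberField k] [Field K] [NumberField K] [Algebra k K]

/-- `σ` is the nontrivial automorphism of a quadratic extension. -/
structure IsConj (σ : K ≃ₐ[k] K) : Prop where
  invol : ∀ x, σ (σ x) = x
  fixed : ∀ x, σ x = x → ∃ y, algebraMap k K y = x
  ne : ∃ x, σ x ≠ x

namespace IsConj

variable {σ : K ≃ₐ[k] K} (hσ : IsConj σ)
include hσ

lemma symm_apply (x : K) : σ.symm x = σ x := by
  rw [AlgEquiv.symm_apply_eq, hσ.invol]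

lemma norm_mem (x : K) : ∃ y, algebraMap k K y = x * σ x :=
  hσ.fixed _ (by rw [map_mul, hσ.invol, mul_comm])

lemma exists_neg : ∃ s : K, s ≠ 0 ∧ σ s = -s := by
  obtain ⟨x, hx⟩ := hσ.ne
  exact ⟨x - σ x, sub_ne_zero.2 (Ne.symm hx), by rw [map_sub, hσ.invol]; ring⟩

lemma exists_sqrt : ∃ (b : k) (s : K), s ≠ 0 ∧ σ s = -s ∧ algebraMap k K b = s ^ 2 := by
  obtain ⟨s, hs0, hs⟩ := hσ.exists_neg
  obtain ⟨b, hb⟩ := hσ.fixed (s ^ 2) (by rw [map_pow, hs]; ring)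
  exact ⟨b, s, hs0, hs, hb⟩

/-- Decomposition of `K` along an element not fixed by `σ`. -/
lemma exists_decomp {π : K} (hπ : σ π ≠ π) (u : K) :
    ∃ y z : k, u = algebraMap k K y + algebraMap k K z * π := by
  have hd : π - σ π ≠ 0 := sub_ne_zero.2 (Ne.symm hπ)
  obtain ⟨z, hz⟩ := hσ.fixed ((u - σ u) / (π - σ π)) (by
    rw [map_div₀, map_sub, map_sub, hσ.invol, hσ.invol, ← neg_sub u, ← neg_sub π, neg_div_neg_eq])
  obtain ⟨y, hy⟩ := hσ.fixed (u - (u - σ u) / (π - σ π) * π) (by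
    have hd' : σ π - π ≠ 0 := sub_ne_zero.2 hπ
    rw [map_sub, map_mul, map_div₀, map_sub, map_sub, hσ.invol, hσ.invol]
    field_simp
    ring)
  exact ⟨y, z, by rw [hy, hz]; ring⟩

/-- Hilbert's theorem 90. -/
lemma hilbert90 {u : K} (hu : u * σ u = 1) : ∃ θ : K, θ ≠ 0 ∧ u * σ θ = θ := by
  by_cases h : 1 + u = 0
  · obtain ⟨s, hs0, hs⟩ := hσ.exists_neg
    refine ⟨s, hs0, ?_⟩
    rw [hs, eq_neg_of_add_eq_zero_right h]; ring
  · exact ⟨1 + u, h, by rw [map_add, map_one, mul_add, hu]; ring⟩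

lemma fibre {P Q : Pl K} (h : below k P = below k Q) : Q = P ∨ Q = gPl σ P := by
  by_contra! hne
  obtain ⟨a, ha0, ha⟩ := exists_int_ord ({Q, P, gPl σ P} : Set (Pl K)) (by simp) (by simp)
    (fun w => w = Q)
  have h1 := (ha Q (by simp)).1 rfl
  have h2 := (ha P (by simp)).2 (Ne.symm hne.1)
  have h3 := (ha (gPl σ P) (by simp)).2 (Ne.symm hne.2)
  rw [ord_gPl', hσ.symm_apply] at h3
  obtain ⟨y, hy⟩ := hσ.norm_mem (a : K)
  have ha0' : (a : K) ≠ 0 := by simpa using ha0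
  have hs0 : σ (a : K) ≠ 0 := by simpa using ha0'
  have hP := ord_algebraMap P y
  have hQ := ord_algebraMap Q y
  rw [hy, ord_mul _ ha0' hs0] at hP hQ
  rw [h2, h3] at hP
  have hv : ord (below k P) y = 0 := by
    have := eR_pos (k := k) P
    rcases mul_eq_zero.1 hP.symm with h | h
    · exfalso; simp at h; omega
    · exact h
  have hpos : 0 ≤ ord Q (σ (a : K)) :=
    ord_int_nonneg Q (RingOfIntegers.mapRingEquiv σ.toRingEquiv a)
  rw [← h, hv, h1] at hQ
  simp at hQ
  omega

lemma eR_eq_one_of_ne {P : Pl K} (h : gPl σ P ≠ P) : eR k P = 1 := by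
  obtain ⟨a, ha0, ha⟩ := exists_int_ord ({P, gPl σ P} : Set (Pl K)) (by simp) (by simp)
    (fun w => w = P)
  have h2 := (ha P (by simp)).1 rfl
  have h3 := (ha (gPl σ P) (by simp)).2 h
  rw [ord_gPl', hσ.symm_apply] at h3
  obtain ⟨y, hy⟩ := hσ.norm_mem (a : K)
  have ha0' : (a : K) ≠ 0 := by simpa using ha0
  have hs0 : σ (a : K) ≠ 0 := by simpa using ha0'
  have hP := ord_algebraMap P y
  rw [hy, ord_mul _ ha0' hs0, h2, h3] at hP
  have : (eR k P : ℤ) ∣ 1 := ⟨_, by simpa using hP⟩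
  exact_mod_cast Int.eq_one_of_dvd_one (by positivity) this

lemma ord_conj {P : Pl K} (h : gPl σ P = P) (x : K) : ord P (σ x) = ord P x := by
  conv_lhs => rw [← h]
  rw [ord_gPl]

lemma eR_le_two (P : Pl K) : eR k P ≤ 2 := by
  by_cases h : gPl σ P = P
  · obtain ⟨π, h0, hπ⟩ := exists_uniformizer P
    obtain ⟨y, hy⟩ := hσ.norm_mem π
    have hP := ord_algebraMap P y
    rw [hy, ord_mul _ h0 (by simpa using h0), hσ.ord_conj h, hπ] at hP
    have : (eR k P : ℤ) ∣ 2 := ⟨_, by simpa using hP⟩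
    exact_mod_cast Int.le_of_dvd (by norm_num) this
  · rw [hσ.eR_eq_one_of_ne h]; norm_num

lemma eR_eq_two {P : Pl K} (h : eR k P ≠ 1) : eR k P = 2 ∧ gPl σ P = P := by
  have h1 := hσ.eR_le_two P
  have h2 := eR_pos (k := k) P
  refine ⟨by omega, ?_⟩
  by_contra h3
  exact h (hσ.eR_eq_one_of_ne h3)

/-- At a ramified place the residue field does not grow. -/
lemma exists_residue {P : Pl K} (h : eR k P ≠ 1) {u : K} (hu : Vge P 0 u) :
    ∃ y : k, Vge (below k P) 0 y ∧ Vge P 1 (u - algebraMap k K y) := by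
  obtain ⟨he, hg⟩ := hσ.eR_eq_two h
  obtain ⟨π, h0, hπ⟩ := exists_uniformizer P
  have hev : ∀ y : k, ord P (algebraMap k K y) = 2 * ord (below k P) y := fun y => by
    rw [ord_algebraMap, he]; rfl
  have hne : σ π ≠ π := by
    intro h
    obtain ⟨y, hy⟩ := hσ.fixed π h
    have := hev y
    rw [hy, hπ] at this
    omega
  obtain ⟨y, z, rfl⟩ := hσ.exists_decomp hne u
  by_cases hz : z = 0
  · subst hz
    simp only [map_zero, zero_mul, add_zero] at hu ⊢
    exact ⟨y, vge_of_algebraMap hu, by simp⟩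
  have hz' : algebraMap k K z ≠ 0 := by simpa using hz
  have hzo : ord P (algebraMap k K z * π) = 2 * ord (below k P) z + 1 := by
    rw [ord_mul _ hz' h0, hev, hπ]
  have hz1 : Vge P 1 (algebraMap k K z * π) := by
    by_contra hc
    rw [vge_iff (mul_ne_zero hz' h0), hzo] at hc
    by_cases hy : y = 0
    · subst hy
      rw [map_zero, zero_add, vge_iff (mul_ne_zero hz' h0), hzo] at hu
      omega
    have hy' : algebraMap k K y ≠ 0 := by simpa using hy
    have hyo := hev y
    rcases lt_or_gt_of_ne (show ord P (algebraMap k K y) ≠ ord P (algebraMap k K z * π) by omega)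
      with hlt | hlt
    · have := ord_add_eq hy' (v := P) (y := algebraMap k K z * π)
        ((vge_iff (mul_ne_zero hz' h0)).2 (by omega))
      rw [vge_iff this.1, this.2] at hu
      omega
    · have := ord_add_eq (mul_ne_zero hz' h0) (v := P) (y := algebraMap k K y)
        ((vge_iff hy').2 (by omega))
      rw [add_comm, vge_iff this.1, this.2] at hu
      omega
  refine ⟨y, vge_of_algebraMap ?_, by simpa using hz1⟩
  have := hu.sub (hz1.mono (by norm_num : (0 : ℤ) ≤ 1))
  simpa using this

lemma conj_sub_vge {P : Pl K} (h : eR k P ≠ 1) {u : K} (hu : Vge P 0 u) :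
    Vge P 1 (σ u - u) := by
  obtain ⟨y, hy, h1⟩ := hσ.exists_residue h hu
  obtain ⟨he, hg⟩ := hσ.eR_eq_two h
  have h2 : Vge P 1 (σ (u - algebraMap k K y)) := by
    have := (vge_gPl σ P (u - algebraMap k K y) 1).2 h1
    rwa [hg] at this
  have := h2.sub h1
  rw [map_sub, AlgEquiv.commutes] at this
  simpa using this

/-- A square root of an element of even order generates an extension unramified at odd places. -/
lemma eR_eq_one_of_sqrt {P : Pl K} {x : k} {s : K} (hs0 : s ≠ 0) (hs : σ s = -s)
    (hx : algebraMap k K x = s ^ 2) (hev : Even (ord (below k P) x))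
    (h2 : ord (below k P) 2 = 0) : eR k P = 1 := by
  by_contra h
  obtain ⟨m, hm⟩ := hev
  obtain ⟨c, hc0, hc⟩ := exists_ord_eq (below k P) m
  have hc0' : algebraMap k K c ≠ 0 := by simpa using hc0
  have hso : ord P s = ord P (algebraMap k K c) := by
    have h1 := ord_algebraMap P x
    rw [hx, ord_pow, hm] at h1
    have := ord_algebraMap P c
    rw [hc] at this
    push_cast at h1
    linarith
  have hu0 : s / algebraMap k K c ≠ 0 := div_ne_zero hs0 hc0'
  have hu : ord P (s / algebraMap k K c) = 0 := by rw [ord_div _ hs0 hc0', hso, sub_self]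
  have := hσ.conj_sub_vge h (u := s / algebraMap k K c) (by rw [vge_iff hu0, hu])
  rw [map_div₀, hs, AlgEquiv.commutes] at this
  have h3 : -s / algebraMap k K c - s / algebraMap k K c
      = -(algebraMap k K 2 * (s / algebraMap k K c)) := by
    rw [map_ofNat]; ring
  have h20 : algebraMap k K 2 ≠ 0 := by simp
  rw [h3, vge_iff (neg_ne_zero.2 (mul_ne_zero h20 hu0)), ord_neg, ord_mul _ h20 hu0, hu,
    ord_algebraMap, h2] at this
  simp at this

/-- A square root of an element close to a square generates an extension split at the place. -/
lemma split_of_sqrt {P : Pl K} {x c : k} {s : K} (hs : σ s = -s)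
    (hx : algebraMap k K x = s ^ 2) (hc0 : c ≠ 0)
    (hc : Vge (below k P) (2 * ord (below k P) 2 + 1) (x / c ^ 2 - 1)) : gPl σ P ≠ P := by
  intro hg
  have hc0' : algebraMap k K c ≠ 0 := by simpa using hc0
  set θ : K := (s / algebraMap k K c - 1) / 2 with hθ
  have h1 : θ * (θ + 1) = algebraMap k K ((x / c ^ 2 - 1) * (2⁻¹ * 2⁻¹)) := by
    simp only [map_mul, map_sub, map_div₀, map_pow, hx, map_inv₀, map_ofNat, map_one, hθ]
    ring
  have h2 : σ θ = -(θ + 1) := by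
    simp only [hθ, map_div₀, map_sub, hs, AlgEquiv.commutes, map_one, map_ofNat]
    ring
  have h3 : Vge P 1 (θ * (θ + 1)) := by
    rw [h1]
    refine vge_algebraMap (by norm_num) ?_
    have hi : Vge (below k P) (- ord (below k P) 2) (2⁻¹ : k) := by
      rw [vge_iff (by simp), ord_inv]
    exact (hc.mul (hi.mul hi)).mono (by ring_nf; rfl)
  have hconj : ∀ y, Vge P 1 (σ y) ↔ Vge P 1 y := fun y => by
    have := vge_gPl σ P y 1
    rwa [hg] at this
  have h1' : ¬ Vge P 1 (1 : K) := by rw [vge_iff one_ne_zero]; simp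
  have hA : Vge P 1 θ → False := by
    intro h
    have := (hconj θ).2 h
    rw [h2] at this
    exact h1' (by simpa using this.neg.sub h)
  have hB : Vge P 1 (θ + 1) → False := by
    intro h
    have h' := h.neg
    rw [← h2, hconj] at h'
    exact hA h'
  have t0 : θ ≠ 0 := by intro h; exact hA (by simp [h])
  have t1 : θ + 1 ≠ 0 := by intro h; exact hB (by simp [h])
  rw [vge_iff (mul_ne_zero t0 t1), ord_mul _ t0 t1] at h3
  rw [vge_iff t0] at hA
  rw [vge_iff t1] at hB
  have := not_le.1 hA
  have := not_le.1 hB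
  omega

end IsConj

end Tower

namespace Tower

section Dbl

/-- Multiplication by two. -/
def dbl (M : Type*) [AddCommGroup M] : M →+ M := nsmulAddMonoidHom 2

@[simp] lemma dbl_apply {M : Type*} [AddCommGroup M] (x : M) : dbl M x = 2 • x := rfl

lemma dbl_range_equiv {M N : Type*} [AddCommGroup M] [AddCommGroup N] (e : M ≃+ N) :
    (dbl M).range.index = (dbl N).range.index := by
  have : (dbl M).range = (dbl N).range.comap e.toAddMonoidHom := by
    ext x
    simp only [AddMonoidHom.mem_range, AddSubgroup.mem_comap, dbl_apply]
    constructor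
    · rintro ⟨y, rfl⟩; exact ⟨e y, by simp⟩
    · rintro ⟨y, hy⟩
      exact ⟨e.symm y, e.injective (by simpa using hy)⟩
  rw [this, AddSubgroup.index_comap_of_surjective _ e.surjective]

lemma dbl_ker_equiv {M N : Type*} [AddCommGroup M] [AddCommGroup N] (e : M ≃+ N) :
    Nat.card (dbl M).ker = Nat.card (dbl N).ker := by
  refine Nat.card_congr (e.toEquiv.subtypeEquiv fun a => ?_)
  simp only [AddMonoidHom.mem_ker, dbl_apply, AddEquiv.toEquiv_eq_coe, EquivLike.coe_coe]
  rw [← map_nsmul, EmbeddingLike.map_eq_zero_iff]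

lemma dbl_finite (M : Type*) [AddCommGroup M] [Finite M] :
    (dbl M).range.index = Nat.card (dbl M).ker := by
  have h1 := (dbl M).range.index_mul_card
  have h2 := (dbl M).ker.card_mul_index
  rw [AddSubgroup.index_ker] at h2
  have : 0 < Nat.card (dbl M).range := Nat.card_pos
  exact Nat.eq_of_mul_eq_mul_right this (by rw [h1, ← h2])

lemma dbl_range_int (n : ℕ) : (dbl (Fin n → ℤ)).range.index = 2 ^ n := by
  have : (dbl (Fin n → ℤ)).range
      = AddSubgroup.pi Set.univ (fun _ => AddSubgroup.zmultiples (2 : ℤ)) := by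
    ext x
    simp only [AddMonoidHom.mem_range, dbl_apply, AddSubgroup.mem_pi, Set.mem_univ,
      AddSubgroup.mem_zmultiples_iff, forall_const]
    constructor
    · rintro ⟨y, rfl⟩ i; exact ⟨y i, by simp [mul_comm]⟩
    · intro h
      choose y hy using h
      exact ⟨y, funext fun i => by simp [← hy i, mul_comm]⟩
  rw [this, AddSubgroup.index_pi]
  simp [Int.index_zmultiples]

/-- The Herbrand-type formula `|M/2M| = 2 ^ rank * |M[2]|`. -/
lemma dbl_index (M : Type*) [AddCommGroup M] [Module.Finite ℤ M] :
    (dbl M).range.index = 2 ^ Module.finrank ℤ M * Nat.card (dbl M).ker := by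
  have hG : AddGroup.FG M := Module.Finite.iff_addGroup_fg.1 inferInstance
  obtain ⟨n, ι, _, p, hp, e, ⟨f⟩⟩ := AddCommGroup.equiv_free_prod_directSum_zmod M
  have hne : ∀ i, NeZero (p i ^ e i) := fun i => ⟨pow_ne_zero _ (hp i).ne_zero⟩
  let B := ∀ i : ι, ZMod (p i ^ e i)
  have hB : Finite B := inferInstance
  classical
  let g : M ≃+ (Fin n → ℤ) × B := f.trans (AddEquiv.prodCongr
    (Finsupp.linearEquivFunOnFinite ℤ ℤ (Fin n)).toAddEquiv (DirectSum.addEquivProd _))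
  have hr : (dbl ((Fin n → ℤ) × B)).range = (dbl (Fin n → ℤ)).range.prod (dbl B).range := by
    ext ⟨x, y⟩
    simp only [AddMonoidHom.mem_range, dbl_apply, AddSubgroup.mem_prod, Prod.exists, Prod.smul_mk,
      Prod.mk.injEq]
    constructor
    · rintro ⟨a, b, h1, h2⟩; exact ⟨⟨a, h1⟩, ⟨b, h2⟩⟩
    · rintro ⟨⟨a, h1⟩, ⟨b, h2⟩⟩; exact ⟨a, b, h1, h2⟩
  have hk : Nat.card (dbl ((Fin n → ℤ) × B)).ker = Nat.card (dbl B).ker := by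
    refine Nat.card_congr ⟨fun x => ⟨x.1.2, ?_⟩, fun y => ⟨(0, y.1), ?_⟩, ?_, ?_⟩
    · exact (Prod.ext_iff.1 (AddMonoidHom.mem_ker.1 x.2)).2
    · have := AddMonoidHom.mem_ker.1 y.2
      rw [dbl_apply] at this
      rw [AddMonoidHom.mem_ker, dbl_apply, Prod.smul_mk, this]; simp
    · rintro ⟨⟨a, b⟩, h⟩
      have := (Prod.ext_iff.1 (AddMonoidHom.mem_ker.1 h)).1
      simp only [dbl_apply] at this
      have h0 : a = 0 := (smul_eq_zero.1 this).resolve_left two_ne_zero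
      simp [h0]
    · intro y; rfl
  have hfr : Module.finrank ℤ M = n := by
    rw [g.toIntLinearEquiv.finrank_eq]
    have hB0 : Module.finrank ℤ B = 0 := by
      rw [Module.finrank_eq_zero_iff_isTorsion, ← isAddTorsion_iff_isTorsion_int]
      exact isAddTorsion_of_finite
    have := (LinearMap.ker (LinearMap.fst ℤ (Fin n → ℤ) B)).finrank_quotient_add_finrank
    rw [(LinearMap.quotKerEquivOfSurjective _ LinearMap.fst_surjective).finrank_eq] at this
    rw [← this, LinearMap.ker_fst, LinearMap.finrank_range_of_inj LinearMap.inr_injective, hB0]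
    simp
  rw [dbl_range_equiv g, dbl_ker_equiv g, hr, AddSubgroup.index_prod, dbl_range_int, dbl_finite B,
    hk, hfr]

end Dbl

section Mul

/-- The subgroup of squares. -/
def sqs (A : Type*) [CommGroup A] : Subgroup A := (powMonoidHom 2).range

lemma mem_sqs {A : Type*} [CommGroup A] {x : A} : x ∈ sqs A ↔ ∃ y, y ^ 2 = x := Iff.rfl

lemma sqs_index (A : Type*) [CommGroup A] [Module.Finite ℤ (Additive A)] :
    (sqs A).index = 2 ^ Module.finrank ℤ (Additive A) * Nat.card {a : A // a ^ 2 = 1} := by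
  have := dbl_index (Additive A)
  exact this

lemma sqs_index_finite (A : Type*) [CommGroup A] [Finite A] :
    (sqs A).index = Nat.card {a : A // a ^ 2 = 1} := dbl_finite (Additive A)

end Mul

section AbstractIndex

variable {R U : Type*} [CommGroup R] [CommGroup U]

/-- The abstract index formula for a group with involution. -/
lemma index_formula (i : R →* U) (hi : Function.Injective i) (σ : U →* U)
    (hfix : ∀ u, σ u = u ↔ u ∈ i.range) (N : U →* R)
    (hN : ∀ u, i (N u) = u * σ u)
    (δ : U →* N.ker) (hδ : ∀ u, (δ u : U) = u / σ u) :
    (sqs R).index * δ.range.index = N.range.index * (sqs N.ker).index := by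
  set W : Subgroup U := i.range ⊔ N.ker with hW
  have h1 : sqs R = W.map N := by
    ext x
    rw [Subgroup.mem_map]
    constructor
    · rintro ⟨y, rfl⟩
      refine ⟨i y, (le_sup_left : i.range ≤ W) ⟨y, rfl⟩, hi ?_⟩
      rw [hN, (hfix (i y)).2 ⟨y, rfl⟩, ← map_mul, ← sq]
      rfl
    · rintro ⟨w, hw, rfl⟩
      obtain ⟨a, ⟨y, rfl⟩, b, hb, rfl⟩ := Subgroup.mem_sup.1 hw
      refine ⟨y, hi ?_⟩
      rw [map_mul, MonoidHom.mem_ker.1 hb, mul_one, hN, (hfix (i y)).2 ⟨y, rfl⟩, ← map_mul, ← sq]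
      rfl
  have hσi : ∀ y, σ (i y) = i y := fun y => (hfix (i y)).2 ⟨y, rfl⟩
  have hker : ∀ b ∈ N.ker, b * σ b = 1 := fun b hb => by
    rw [← hN, MonoidHom.mem_ker.1 hb, map_one]
  have h2 : sqs N.ker = W.map δ := by
    ext x
    rw [Subgroup.mem_map]
    constructor
    · rintro ⟨y, rfl⟩
      refine ⟨y, (le_sup_right : N.ker ≤ W) y.2, Subtype.ext ?_⟩
      rw [hδ, div_eq_iff_eq_mul]
      have := hker y y.2
      simp only [powMonoidHom_apply, sq]
      change (y : U) = y * y * σ y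
      rw [mul_assoc, this, mul_one]
    · rintro ⟨w, hw, rfl⟩
      obtain ⟨a, ⟨y, rfl⟩, b, hb, rfl⟩ := Subgroup.mem_sup.1 hw
      refine ⟨⟨b, hb⟩, Subtype.ext ?_⟩
      rw [hδ, map_mul, hσi, mul_div_mul_left_eq_div, eq_div_iff_mul_eq']
      have := hker b hb
      simp only [powMonoidHom_apply, sq]
      change b * b * σ b = b
      rw [mul_assoc, this, mul_one]
  have hδker : δ.ker ≤ W := by
    intro u hu
    have : (δ u : U) = 1 := by rw [MonoidHom.mem_ker.1 hu]; rfl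
    rw [hδ, div_eq_one] at this
    exact (le_sup_left : i.range ≤ W) ((hfix u).1 this.symm)
  have e1 : (sqs R).index = W.index * N.range.index := by
    rw [h1, Subgroup.index_map, sup_eq_left.2 (le_sup_right : N.ker ≤ W)]
  have e2 : (sqs N.ker).index = W.index * δ.range.index := by
    rw [h2, Subgroup.index_map, sup_eq_left.2 hδker]
  rw [e1, e2]; ring

end AbstractIndex

end Tower

namespace Tower

open NumberField IsDedekindDomain

section TUnits

variable {k : Type} [Field k] [NumberField k]

/-- The group of `T`-units. -/
def TU (T : Set (Pl k)) : Subgroup kˣ where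
  carrier := {u | ∀ v, v ∉ T → ord v (u : k) = 0}
  one_mem' := by simp
  mul_mem' := by
    intro a b ha hb v hv
    rw [Units.val_mul, ord_mul v a.ne_zero b.ne_zero, ha v hv, hb v hv, add_zero]
  inv_mem' := by
    intro a ha v hv
    rw [Units.val_inv_eq_inv_val, ord_inv, ha v hv, neg_zero]

lemma TU_mono {T T' : Set (Pl k)} (h : T ⊆ T') : TU T ≤ TU T' :=
  fun _ hu v hv => hu v (fun hv' => hv (h hv'))

lemma exists_mul_principal : ∃ h : ℕ, 0 < h ∧ ∀ m : Pl k → ℤ, {v | m v ≠ 0}.Finite →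
    ∃ c : k, c ≠ 0 ∧ ∀ v, ord v c = h * m v := by
  refine ⟨Nat.card (ClassGroup (𝓞 k)), Nat.card_pos, fun m hm => ?_⟩
  obtain ⟨I, hI⟩ := exists_fracIdeal m hm
  obtain ⟨c, hc, h⟩ := exists_of_mk_eq (k := k) (I := I ^ Nat.card (ClassGroup (𝓞 k))) (J := 1)
    (by rw [map_pow, pow_card_eq_one', map_one])
  refine ⟨c, hc, fun v => ?_⟩
  rw [h, Units.val_pow_eq_pow_val, FractionalIdeal.count_pow, hI, Units.val_one,
    FractionalIdeal.count_one, sub_zero]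

/-- The valuations at the places of `T`. -/
noncomputable def ordMap (T : Set (Pl k)) : Additive (TU T) →ₗ[ℤ] (T → ℤ) :=
  AddMonoidHom.toIntLinearMap
    { toFun := fun u v => ord v.1 ((u.toMul : kˣ) : k)
      map_zero' := by ext; simp
      map_add' := fun a b => by
        ext v
        simp [ord_mul v.1 (Units.ne_zero _) (Units.ne_zero _)] }

lemma ordMap_apply (T : Set (Pl k)) (u : Additive (TU T)) (v : T) :
    ordMap T u v = ord v.1 ((u.toMul : kˣ) : k) := rfl

/-- Units of the ring of integers are `T`-units. -/
noncomputable def unitsToTU (T : Set (Pl k)) : (𝓞 k)ˣ →* TU T :=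
  (Units.map (algebraMap (𝓞 k) k).toMonoidHom).codRestrict _ (fun u v _ => ord_unit u v)

lemma unitsToTU_inj (T : Set (Pl k)) : Function.Injective (unitsToTU T) := by
  intro a b h
  have : ((a : 𝓞 k) : k) = ((b : 𝓞 k) : k) := congrArg (fun u : TU T => ((u : kˣ) : k)) h
  exact Units.ext (RingOfIntegers.ext this)

lemma ker_ordMap (T : Set (Pl k)) : LinearMap.ker (ordMap T)
    = LinearMap.range (unitsToTU T).toAdditive.toIntLinearMap := by
  ext u
  rw [LinearMap.mem_ker, LinearMap.mem_range]
  constructor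
  · intro h
    have h0 : ∀ v : Pl k, ord v ((u.toMul : kˣ) : k) = 0 := fun v => by
      by_cases hv : v ∈ T
      · exact congrFun h ⟨v, hv⟩
      · exact u.toMul.2 v hv
    obtain ⟨w, hw⟩ := exists_unit_of_ord (Units.ne_zero _) h0
    exact ⟨Additive.ofMul w, Additive.toMul.injective (Subtype.ext (Units.ext hw))⟩
  · rintro ⟨w, rfl⟩
    funext v
    exact ord_unit w.toMul v.1

lemma TU_finite_rank {T : Set (Pl k)} (hT : T.Finite) : Module.Finite ℤ (Additive (TU T)) ∧
    Module.finrank ℤ (Additive (TU T)) = Units.rank k + T.ncard := by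
  have : Finite T := hT
  have := Fintype.ofFinite T
  have hkfr : Module.finrank ℤ (LinearMap.ker (ordMap T)) = Units.rank k := by
    rw [ker_ordMap, LinearMap.finrank_range_of_inj, Units.finrank_eq]
    exact fun a b h => unitsToTU_inj T h
  have hkf : Module.Finite ℤ (LinearMap.ker (ordMap T)) := by
    rw [ker_ordMap]; infer_instance
  have hqf : Module.Finite ℤ (Additive (TU T) ⧸ LinearMap.ker (ordMap T)) :=
    Module.Finite.equiv (ordMap T).quotKerEquivRange.symm
  refine ⟨Module.Finite.of_submodule_quotient (LinearMap.ker (ordMap T)), ?_⟩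
  have hfin := Module.Finite.of_submodule_quotient (LinearMap.ker (ordMap T))
  rw [← Submodule.finrank_quotient_add_finrank (LinearMap.ker (ordMap T)), hkfr, add_comm,
    (ordMap T).quotKerEquivRange.finrank_eq]
  congr 1
  have hc : Module.finrank ℤ (T → ℤ) = T.ncard := by
    rw [Module.finrank_pi, ← Nat.card_eq_fintype_card, Nat.card_coe_set_eq]
  rw [← hc]
  apply le_antisymm (Submodule.finrank_le _)
  obtain ⟨h, hpos, H⟩ := exists_mul_principal (k := k)
  have hmem : ∀ x : T → ℤ, (h : ℤ) • x ∈ LinearMap.range (ordMap T) := by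
    intro x
    classical
    obtain ⟨c, hc0, hc⟩ := H (fun v => if hv : v ∈ T then x ⟨v, hv⟩ else 0)
      (hT.subset fun v hv => by by_contra h; simp [h] at hv)
    refine ⟨Additive.ofMul ⟨Units.mk0 c hc0, fun v hv => ?_⟩, funext fun v => ?_⟩
    · rw [Units.val_mk0, hc, dif_neg hv, mul_zero]
    · rw [ordMap_apply]
      simp [hc]
  refine LinearMap.finrank_le_finrank_of_injective
    (f := ((h : ℤ) • LinearMap.id (R := ℤ) (M := T → ℤ)).codRestrict _ hmem) ?_
  intro a b hab
  have : (h : ℤ) • a = (h : ℤ) • b := congrArg Subtype.val hab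
  exact smul_right_injective _ (by exact_mod_cast hpos.ne') this

lemma units_rank [IsTotallyReal k] : Units.rank k + 1 = Module.finrank ℚ k := by
  have h := InfinitePlace.card_eq_nrRealPlaces_add_nrComplexPlaces k
  rw [IsTotallyReal.nrComplexPlaces_eq_zero, add_zero] at h
  rw [IsTotallyReal.finrank, ← h, Units.rank]
  have : 0 < Fintype.card (InfinitePlace k) := Fintype.card_pos
  omega

lemma card_sq_one (H : Subgroup kˣ) (h : -1 ∈ H) : Nat.card {a : H // a ^ 2 = 1} = 2 := by
  have : ({a : H | a ^ 2 = 1} : Set H) = {1, ⟨-1, h⟩} := by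
    ext a
    simp only [Set.mem_ofPred_eq, Set.mem_insert_iff, Set.mem_singleton_iff]
    rw [Subtype.ext_iff, Subtype.ext_iff, Subtype.ext_iff, Units.ext_iff, Units.ext_iff,
      Units.ext_iff]
    simp
  change Nat.card ({a : H | a ^ 2 = 1} : Set H) = 2
  rw [this, Nat.card_coe_set_eq, Set.ncard_pair]
  intro h
  rw [Subtype.ext_iff, Units.ext_iff] at h
  simp only [Subgroup.coe_one, Units.val_one, Units.val_neg] at h
  norm_num [eq_neg_iff_add_eq_zero] at h

lemma neg_one_mem_TU (T : Set (Pl k)) : -1 ∈ TU T := fun v _ => by simp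

lemma TU_sqs_index [IsTotallyReal k] {T : Set (Pl k)} (hT : T.Finite) :
    (sqs (TU T)).index = 2 ^ (Module.finrank ℚ k + T.ncard) := by
  obtain ⟨h1, h2⟩ := TU_finite_rank hT
  rw [sqs_index, h2, card_sq_one _ (neg_one_mem_TU T), ← units_rank]
  ring

end TUnits

end Tower

namespace Tower

open NumberField IsDedekindDomain

lemma finrank_ker_add {A B : Type*} [CommGroup A] [CommGroup B] [Module.Finite ℤ (Additive A)]
    [Module.Finite ℤ (Additive B)] (f : A →* B) (hf : ∀ b, b ^ 2 ∈ f.range) :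
    Module.finrank ℤ (Additive f.ker) + Module.finrank ℤ (Additive B)
      = Module.finrank ℤ (Additive A) := by
  let F : Additive A →ₗ[ℤ] Additive B := f.toAdditive.toIntLinearMap
  have h1 : Module.finrank ℤ (Additive f.ker) = Module.finrank ℤ (LinearMap.ker F) := by
    let e : Additive f.ker ≃+ LinearMap.ker F :=
      { toFun := fun x => ⟨Additive.ofMul (x.toMul : A), x.toMul.2⟩
        invFun := fun x => Additive.ofMul ⟨x.1.toMul, x.2⟩
        left_inv := fun _ => rfl
        right_inv := fun _ => rfl
        map_add' := fun _ _ => rfl }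
    exact e.toIntLinearEquiv.finrank_eq
  have h2 : Module.finrank ℤ (LinearMap.range F) = Module.finrank ℤ (Additive B) := by
    have := (LinearMap.range F).finrank_quotient_add_finrank
    rw [← this, (Module.finrank_eq_zero_iff_isTorsion
      (M := Additive B ⧸ LinearMap.range F)).2, zero_add]
    intro x
    obtain ⟨b, rfl⟩ := Submodule.mkQ_surjective _ x
    refine ⟨⟨2, by simp⟩, ?_⟩
    obtain ⟨a, ha⟩ := hf b.toMul
    change (2 : ℤ) • (LinearMap.range F).mkQ b = 0
    rw [← map_smul]
    refine (Submodule.Quotient.mk_eq_zero _).2 ⟨Additive.ofMul a, ?_⟩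
    rw [ofNat_zsmul]
    exact ha
  have h3 := (LinearMap.ker F).finrank_quotient_add_finrank
  rw [F.quotKerEquivRange.finrank_eq] at h3
  omega

section Conj

variable {k K : Type} [Field k] [NumberField k] [Field K] [NumberField K] [Algebra k K]
variable {σ : K ≃ₐ[k] K} (hσ : IsConj σ)

/-- The place `v` has a unique extension, fixed by `σ`. -/
def Nonsplit (σ : K ≃ₐ[k] K) (v : Pl k) : Prop := ∃ P : Pl K, below k P = v ∧ gPl σ P = P

include hσ in
lemma IsConj.nonsplit_iff {P : Pl K} : Nonsplit σ (below k P) ↔ gPl σ P = P := by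
  refine ⟨?_, fun h => ⟨P, rfl, h⟩⟩
  rintro ⟨Q, hQ, h⟩
  rcases hσ.fibre hQ with rfl | h'
  · exact h
  · rw [h] at h'; rw [h']; exact h

include hσ in
lemma IsConj.finrank_eq_two : Module.finrank k K = 2 := by
  obtain ⟨s, hs0, hs⟩ := hσ.exists_neg
  have hne : σ s ≠ s := fun h => by
    rw [hs] at h
    exact hs0 (by linear_combination (-1 / 2 : K) * h)
  have hli : LinearIndependent k ![1, s] := by
    rw [LinearIndependent.pair_iff]
    intro x y h
    rw [Algebra.smul_def, Algebra.smul_def, mul_one] at h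
    have h2 := congrArg σ h
    rw [map_add, map_mul, AlgEquiv.commutes, AlgEquiv.commutes, hs, map_zero] at h2
    have hx : algebraMap k K x = 0 := by linear_combination (1 / 2 : K) * h + (1 / 2 : K) * h2
    have hx0 : x = 0 := by simpa using hx
    subst hx0
    simpa [hs0] using h
  have hsp : ⊤ ≤ Submodule.span k (Set.range ![1, s]) := by
    intro u _
    obtain ⟨y, z, rfl⟩ := hσ.exists_decomp hne u
    simp only [Matrix.range_cons, Matrix.range_empty, Set.union_empty, Set.singleton_union]
    rw [Submodule.mem_span_pair]
    exact ⟨y, z, by rw [Algebra.smul_def, Algebra.smul_def, mul_one]⟩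
  simpa using Module.finrank_eq_card_basis (Module.Basis.mk hli hsp)

/-- The relative norm of a quadratic extension. -/
noncomputable def IsConj.nrm : Kˣ →* kˣ where
  toFun u := Units.mk0 (hσ.norm_mem u).choose (by
    intro h
    have := (hσ.norm_mem (u : K)).choose_spec
    rw [h, map_zero] at this
    have h2 : (u : K) * σ u ≠ 0 := mul_ne_zero u.ne_zero (by simp)
    exact h2 this.symm)
  map_one' := by
    refine Units.ext ((algebraMap k K).injective ?_)
    rw [Units.val_mk0, (hσ.norm_mem _).choose_spec]; simp
  map_mul' u w := by
    refine Units.ext ((algebraMap k K).injective ?_)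
    have h := fun x : Kˣ => (hσ.norm_mem (x : K)).choose_spec
    change algebraMap k K (hσ.norm_mem ((u * w : Kˣ) : K)).choose
      = algebraMap k K ((hσ.norm_mem (u : K)).choose * (hσ.norm_mem (w : K)).choose)
    rw [map_mul, h, h, h, Units.val_mul, map_mul]
    ring

lemma IsConj.nrm_spec (u : Kˣ) : algebraMap k K (hσ.nrm u) = u * σ u :=
  (hσ.norm_mem (u : K)).choose_spec

/-- The places above `T`. -/
def Tup (K : Type) [Field K] [NumberField K] [Algebra k K] (T : Set (Pl k)) : Set (Pl K) :=
  {P | below k P ∈ T}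

include hσ in
lemma IsConj.ncard_Tup {T : Set (Pl k)} (hT : T.Finite) :
    (Tup K T).ncard + {v ∈ T | Nonsplit σ v}.ncard = 2 * T.ncard := by
  classical
  have hTM : (Tup K T).Finite := finite_preimage hT
  have e1 : (Tup K T).ncard = ∑ v ∈ hT.toFinset, {P ∈ hTM.toFinset | below k P = v}.card := by
    rw [Set.ncard_eq_toFinset_card _ hTM]
    apply Finset.card_eq_sum_card_fiberwise
    intro P hP
    simpa [Tup] using hP
  have e2 : {v ∈ T | Nonsplit σ v}.ncard = ∑ v ∈ hT.toFinset, if Nonsplit σ v then 1 else 0 := by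
    rw [Finset.sum_ite, Finset.sum_const_zero, add_zero, Finset.sum_const, smul_eq_mul, mul_one,
      ← Set.ncard_coe_finset]
    congr 1; ext; simp
  rw [e1, e2, ← Finset.sum_add_distrib, Set.ncard_eq_toFinset_card _ hT, mul_comm,
    ← smul_eq_mul, ← Finset.sum_const]
  refine Finset.sum_congr rfl fun v hv => ?_
  obtain ⟨P, rfl⟩ := exists_above (K := K) v
  have : ({Q ∈ hTM.toFinset | below k Q = below k P} : Finset (Pl K)) = {P, gPl σ P} := by
    ext Q
    simp only [Finset.mem_filter, Set.Finite.mem_toFinset, Finset.mem_insert,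
      Finset.mem_singleton]
    constructor
    · rintro ⟨_, h⟩
      exact hσ.fibre h.symm
    · rintro (rfl | rfl)
      · exact ⟨by simpa [Tup] using hv, rfl⟩
      · exact ⟨by simpa [Tup, below_gPl] using hv, below_gPl _ _⟩
  rw [this]
  split_ifs with h
  · rw [hσ.nonsplit_iff] at h
    simp [h]
  · rw [hσ.nonsplit_iff] at h
    rw [Finset.card_pair (Ne.symm h)]

lemma IsConj.nrm_mem {T : Set (Pl k)} {u : Kˣ} (hu : u ∈ TU (Tup K T)) : hσ.nrm u ∈ TU T := by
  intro v hv
  obtain ⟨P, rfl⟩ := exists_above (K := K) v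
  have h := ord_algebraMap P ((hσ.nrm u : kˣ) : k)
  rw [hσ.nrm_spec, ord_mul P u.ne_zero (by simp), ← hσ.symm_apply, ← ord_gPl', hu P hv,
    hu (gPl σ P) (by simpa [Tup, below_gPl] using hv)] at h
  have := eR_pos (k := k) P
  rcases mul_eq_zero.1 h.symm with h | h
  · omega
  · exact h

/-- The norm on `T`-units. -/
noncomputable def IsConj.nrmT (T : Set (Pl k)) : TU (Tup K T) →* TU T :=
  (hσ.nrm.comp (TU (Tup K T)).subtype).codRestrict _ (fun u => hσ.nrm_mem u.2)

lemma IsConj.nrmT_spec (T : Set (Pl k)) (u : TU (Tup K T)) :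
    algebraMap k K ((hσ.nrmT T u : kˣ) : k) = (u : Kˣ) * σ (u : Kˣ) := hσ.nrm_spec u

/-- The conjugation on `T`-units. -/
def IsConj.conjT (T : Set (Pl k)) : TU (Tup K T) →* TU (Tup K T) :=
  ((Units.map (σ : K →* K)).comp (TU (Tup K T)).subtype).codRestrict _ (fun u P hP => by
    have := u.2 (gPl σ P) (by simpa [Tup, below_gPl] using hP)
    rw [ord_gPl', hσ.symm_apply] at this
    exact this)

/-- The inclusion on `T`-units. -/
def inclT (T : Set (Pl k)) : TU T →* TU (Tup K T) :=
  ((Units.map (algebraMap k K : k →* K)).comp (TU T).subtype).codRestrict _ (fun u P hP => by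
    have := ord_algebraMap P ((u : kˣ) : k)
    rw [u.2 _ hP, mul_zero] at this
    exact this)

/-- The map `u ↦ u / σ u`. -/
noncomputable def IsConj.delT (T : Set (Pl k)) : TU (Tup K T) →* (hσ.nrmT T).ker where
  toFun u := ⟨u / hσ.conjT T u, by
    rw [MonoidHom.mem_ker]
    refine Subtype.ext (Units.ext ((algebraMap k K).injective ?_))
    rw [hσ.nrmT_spec]
    have h1 : ((u / hσ.conjT T u : TU (Tup K T)) : Kˣ)
        = ((u : Kˣ) : K) / σ ((u : Kˣ) : K) := by
      rw [Subgroup.coe_div, Units.val_div_eq_div_val]; rfl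
    have h0 : ((u : Kˣ) : K) ≠ 0 := by simp
    have h0' : σ ((u : Kˣ) : K) ≠ 0 := by simp
    rw [h1, map_div₀, hσ.invol]
    simp⟩
  map_one' := Subtype.ext (by simp)
  map_mul' a b := Subtype.ext (by
    simp only [map_mul, Subgroup.coe_mul]
    exact mul_div_mul_comm _ _ _ _)

lemma IsConj.delT_spec (T : Set (Pl k)) (u : TU (Tup K T)) :
    ((hσ.delT T u : TU (Tup K T)) : Kˣ) = ((u : Kˣ) : K) / σ ((u : Kˣ) : K) := by
  change (((u / hσ.conjT T u : TU (Tup K T)) : Kˣ) : K) = _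
  rw [Subgroup.coe_div, Units.val_div_eq_div_val]; rfl

include hσ in
/-- If parities at the ramified places agree, an element of `K` differs from an element
of `k` by a `T`-unit. -/
lemma IsConj.exists_unit_mul {T V : Set (Pl k)} (hCT : ClassTrivial T)
    (hram : ∀ P : Pl K, below k P ∉ T → eR k P ≠ 1 → below k P ∈ V) {η : K} (hη : η ≠ 0)
    (hord : ∀ P : Pl K, below k P ∉ T → ord P (σ η) = ord P η)
    (hpar : ∀ v ∈ V, ∃ P : Pl K, below k P = v ∧ Even (ord P η)) :
    ∃ c : k, c ≠ 0 ∧ ∀ P : Pl K, below k P ∉ T → ord P (η / algebraMap k K c) = 0 := by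
  choose A hA using fun v : Pl k => exists_above (K := K) v
  have hconst : ∀ P : Pl K, below k P ∉ T → ∀ Q : Pl K, below k Q = below k P →
      ord Q η = ord P η ∧ eR k Q = eR k P := by
    intro P hP Q hQ
    rcases hσ.fibre hQ.symm with rfl | rfl
    · exact ⟨rfl, rfl⟩
    · rw [ord_gPl', hσ.symm_apply, hord P hP, eR_gPl]
      exact ⟨rfl, rfl⟩
  classical
  obtain ⟨c, hc0, hc⟩ := hCT (fun v => ord (A v) η / eR k (A v)) (by
    refine ((finite_ord_ne_zero η).image (below k)).subset fun v hv => ?_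
    refine ⟨A v, fun h => hv ?_, hA v⟩
    simp [h])
  refine ⟨c, hc0, fun P hP => ?_⟩
  rw [ord_div P hη (by simpa using hc0), ord_algebraMap, hc _ hP]
  obtain ⟨h1, h2⟩ := hconst P hP (A (below k P)) (hA _)
  rw [h1, h2]
  by_cases he : eR k P = 1
  · simp [he]
  · obtain ⟨Q, hQ, hev⟩ := hpar _ (hram P hP he)
    rw [(hσ.eR_eq_two he).1]
    rw [(hconst P hP Q hQ).1] at hev
    obtain ⟨m, hm⟩ := hev
    push_cast
    omega

lemma IsConj.delT_index_le {T V : Set (Pl k)} (hV : V.Finite) (hCT : ClassTrivial T)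
    (hram : ∀ P : Pl K, below k P ∉ T → eR k P ≠ 1 → below k P ∈ V) :
    (hσ.delT T).range.index ≤ 2 ^ V.ncard ∧ (hσ.delT T).range.index ≠ 0 := by
  classical
  choose A hA using fun v : Pl k => exists_above (K := K) v
  have hH : ∀ u : (hσ.nrmT T).ker, ∃ θ : K, θ ≠ 0 ∧ (((u : TU (Tup K T)) : Kˣ) : K) * σ θ = θ := by
    intro u
    apply hσ.hilbert90
    rw [← hσ.nrmT_spec, MonoidHom.mem_ker.1 u.2]; simp
  choose θ hθ0 hθ using hH
  have key : ∀ u u' : (hσ.nrmT T).ker, (∀ v ∈ V, (Even (ord (A v) (θ u)) ↔ Even (ord (A v) (θ u')))) →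
      u⁻¹ * u' ∈ (hσ.delT T).range := by
    intro u u' h
    set η := θ u' / θ u with hη
    have hη0 : η ≠ 0 := div_ne_zero (hθ0 _) (hθ0 _)
    have hu0 : (((u : TU (Tup K T)) : Kˣ) : K) ≠ 0 := Units.ne_zero _
    have hu0' : (((u' : TU (Tup K T)) : Kˣ) : K) ≠ 0 := Units.ne_zero _
    have hσ0 : ∀ u, σ (θ u) ≠ 0 := fun u => by simpa using hθ0 u
    have hrel : (((u⁻¹ * u' : (hσ.nrmT T).ker) : TU (Tup K T)) : Kˣ) * σ η = η := by
      have e1 := hθ u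
      have e2 := hθ u'
      rw [hη, map_div₀]
      simp only [Subgroup.coe_mul, Subgroup.coe_inv, Units.val_mul, Units.val_inv_eq_inv_val]
      have a1 := hσ0 u
      have a2 := hθ0 u
      field_simp
      linear_combination (θ u) * e2 - (θ u') * e1
    obtain ⟨c, hc0, hc⟩ := hσ.exists_unit_mul hCT hram hη0 (fun P hP => by
      conv_rhs => rw [← hrel]
      rw [ord_mul P (Units.ne_zero _) (by simpa using hη0),
        ((u⁻¹ * u' : (hσ.nrmT T).ker) : TU (Tup K T)).2 P hP, zero_add])
      (fun v hv => ⟨A v, hA v, by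
        rw [hη, ord_div _ (hθ0 _) (hθ0 _), Int.even_sub]
        exact (h v hv).symm⟩)
    have hc0' : algebraMap k K c ≠ 0 := by simpa using hc0
    refine ⟨⟨Units.mk0 (η / algebraMap k K c) (div_ne_zero hη0 hc0'), hc⟩, ?_⟩
    refine Subtype.ext (Subtype.ext (Units.ext ?_))
    rw [hσ.delT_spec, Units.val_mk0, map_div₀, AlgEquiv.commutes, div_div_div_cancel_right₀ hc0',
      div_eq_iff (by simpa using hη0), hrel]
  have hVf : Finite V := hV
  let f : ((hσ.nrmT T).ker ⧸ (hσ.delT T).range) → (V → Prop) :=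
    fun q v => Even (ord (A v) (θ q.out))
  have hf : Function.Injective f := by
    intro q q' hq
    rw [← q.out_eq, ← q'.out_eq]
    exact Quotient.sound (QuotientGroup.leftRel_apply.2
      (key _ _ fun v hv => iff_of_eq (congrFun hq ⟨v, hv⟩)))
  have hfin : Finite ((hσ.nrmT T).ker ⧸ (hσ.delT T).range) := Finite.of_injective f hf
  constructor
  · rw [Subgroup.index]
    refine (Nat.card_le_card_of_injective f hf).trans ?_
    rw [Nat.card_fun]
    simp
  · rw [Subgroup.index]; exact Nat.card_pos.ne'

/-- The first inequality for a quadratic extension of totally real fields. -/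
theorem IsConj.first_ineq [IsTotallyReal k] [IsTotallyReal K] {T V : Set (Pl k)} (hT : T.Finite)
    (hV : V.Finite) (hCT : ClassTrivial T)
    (hram : ∀ P : Pl K, below k P ∉ T → eR k P ≠ 1 → below k P ∈ V) :
    (hσ.nrmT T).range.index * 2 ≤ 2 ^ ({v ∈ T | Nonsplit σ v}.ncard + V.ncard)
      ∧ (hσ.nrmT T).range.index ≠ 0 := by
  have hTM : (Tup K T).Finite := finite_preimage hT
  obtain ⟨f1, r1⟩ := TU_finite_rank hT
  obtain ⟨f2, r2⟩ := TU_finite_rank hTM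
  have hinj : Function.Injective (inclT (K := K) T) := by
    intro a b h
    exact Subtype.ext (Units.ext ((algebraMap k K).injective
      (congrArg (fun x : TU (Tup K T) => ((x : Kˣ) : K)) h)))
  have hform := index_formula (inclT (K := K) T) hinj (hσ.conjT T) (fun u => by
    constructor
    · intro h
      have h' : σ ((u : Kˣ) : K) = (u : Kˣ) := congrArg (fun x : TU (Tup K T) => ((x : Kˣ) : K)) h
      obtain ⟨y, hy⟩ := hσ.fixed _ h'
      have hy0 : y ≠ 0 := by
        rintro rfl
        rw [map_zero] at hy
        exact (Units.ne_zero _) hy.symm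
      refine ⟨⟨Units.mk0 y hy0, fun v hv => ?_⟩, Subtype.ext (Units.ext hy)⟩
      obtain ⟨P, rfl⟩ := exists_above (K := K) v
      have := ord_algebraMap P y
      rw [hy, u.2 P hv] at this
      have h1 := eR_pos (k := k) P
      rcases mul_eq_zero.1 this.symm with h | h
      · omega
      · exact h
    · rintro ⟨y, rfl⟩
      exact Subtype.ext (Units.ext (σ.commutes _))) (hσ.nrmT T) (fun u =>
        Subtype.ext (Units.ext (hσ.nrmT_spec T u))) (hσ.delT T) (fun u => rfl)
  have hrk := finrank_ker_add (hσ.nrmT T) (fun b => ⟨inclT T b, by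
    refine Subtype.ext (Units.ext ((algebraMap k K).injective ?_))
    rw [hσ.nrmT_spec]
    change algebraMap k K ((b : kˣ) : k) * σ (algebraMap k K ((b : kˣ) : k)) = _
    rw [AlgEquiv.commutes]
    simp [sq]⟩)
  have hkfin : Module.Finite ℤ (Additive (hσ.nrmT T).ker) :=
    Module.Finite.of_injective ((hσ.nrmT T).ker.subtype.toAdditive.toIntLinearMap)
      (fun a b h => Subtype.ext h)
  have hk2 : Nat.card {a : (hσ.nrmT T).ker // a ^ 2 = 1} = 2 := by
    have hle := card_sq_one ((hσ.nrmT T).ker.map (TU (Tup K T)).subtype)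
      ⟨⟨-1, neg_one_mem_TU _⟩, by
        change _ ∈ (hσ.nrmT T).ker
        rw [MonoidHom.mem_ker]
        refine Subtype.ext (Units.ext ((algebraMap k K).injective ?_))
        rw [hσ.nrmT_spec]; simp, rfl⟩
    let e := (hσ.nrmT T).ker.equivMapOfInjective (TU (Tup K T)).subtype
      (Subgroup.subtype_injective _)
    refine (Nat.card_congr (e.toEquiv.subtypeEquiv fun a => ?_)).trans hle
    change _ ↔ (e a) ^ 2 = 1
    rw [← map_pow, EmbeddingLike.map_eq_one_iff]
  rw [TU_sqs_index hT, sqs_index (hσ.nrmT T).ker, hk2] at hform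
  obtain ⟨hle, hne⟩ := hσ.delT_index_le hV hCT hram
  have hN : Module.finrank ℚ K = 2 * Module.finrank ℚ k := by
    rw [← Module.finrank_mul_finrank ℚ k K, hσ.finrank_eq_two, mul_comm]
  have u1 := units_rank (k := k)
  have u2 := units_rank (k := K)
  have hc := hσ.ncard_Tup hT
  set n := {v ∈ T | Nonsplit σ v}.ncard
  set r := Module.finrank ℤ (Additive (hσ.nrmT T).ker)
  have hr : Module.finrank ℚ k + T.ncard = r + n := by omega
  rw [hr, pow_add] at hform
  have h3 : (hσ.nrmT T).range.index * 2 = 2 ^ n * (hσ.delT T).range.index := by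
    have : 0 < 2 ^ r := by positivity
    apply Nat.eq_of_mul_eq_mul_left this
    linarith
  constructor
  · rw [h3, pow_add]
    exact Nat.mul_le_mul_left _ hle
  · intro h
    rw [h, zero_mul] at h3
    have : 0 < 2 ^ n := by positivity
    simp_all

end Conj

end Tower

namespace Tower

open NumberField IsDedekindDomain

lemma relIndex_le_card {G : Type*} [Group G] {H L : Subgroup G} {X : Type*} [Finite X]
    (φ : L → X) (h : ∀ x y : L, φ x = φ y → (x : G)⁻¹ * y ∈ H) :
    H.relIndex L ≤ Nat.card X ∧ H.relIndex L ≠ 0 := by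
  let f : (L ⧸ H.subgroupOf L) → X := fun q => φ q.out
  have hf : Function.Injective f := by
    intro q q' hq
    rw [← q.out_eq, ← q'.out_eq]
    exact Quotient.sound (QuotientGroup.leftRel_apply.2 (h _ _ hq))
  have hfin : Finite (L ⧸ H.subgroupOf L) := Finite.of_injective f hf
  exact ⟨Nat.card_le_card_of_injective f hf, Nat.card_pos.ne'⟩

section Loc

variable {k : Type} [Field k] [NumberField k]

lemma exists_inv_mod {v : Pl k} {t : 𝓞 k} (ht : ord v (t : k) = 0) (ht0 : t ≠ 0) (n : ℕ) :
    ∃ s : 𝓞 k, Vge v n ((t * s - 1 : 𝓞 k) : k) := by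
  have hmem : t ∉ v.asIdeal := by
    rw [← pow_one v.asIdeal, ← vge_int_iff, vge_iff (by simpa using ht0), ht]
    norm_num
  have hmax : v.asIdeal.IsMaximal := v.isMaximal
  have hcop : IsCoprime (Ideal.span {t}) (v.asIdeal ^ n) := by
    apply IsCoprime.pow_right
    rw [Ideal.isCoprime_iff_sup_eq, sup_comm]
    exact hmax.1.2 _ (left_lt_sup.2 fun h => hmem (h (Ideal.mem_span_singleton_self t)))
  obtain ⟨i, hi, j, hj, hij⟩ := Ideal.isCoprime_iff_exists.1 hcop
  obtain ⟨s, rfl⟩ := Ideal.mem_span_singleton'.1 hi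
  refine ⟨s, (vge_int_iff v _ n).2 ?_⟩
  have : t * s - 1 = -j := by rw [← hij]; ring
  rw [this]; exact neg_mem hj

lemma exists_int_approx {v : Pl k} {x : k} (hx : Vge v 0 x) (n : ℕ) :
    ∃ y : 𝓞 k, Vge v n (x - (y : k)) := by
  obtain ⟨h, hpos, H⟩ := exists_mul_principal (k := k)
  obtain ⟨c, hc0, hc⟩ := H (fun w => max 0 (-ord w x)) (by
    refine (finite_ord_ne_zero x).subset fun w hw h0 => hw ?_
    rw [h0]; simp)
  by_cases hx0 : x = 0
  · exact ⟨0, by simp [hx0]⟩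
  have hv : ord v c = 0 := by
    rw [vge_iff hx0] at hx
    rw [hc, max_eq_left (by omega), mul_zero]
  obtain ⟨t, rfl⟩ := mem_integers_of_vge (x := c) (fun w => by
    rw [vge_iff hc0, hc]
    positivity)
  obtain ⟨z, hz⟩ := mem_integers_of_vge (x := (t : k) * x) (fun w => by
    rw [vge_iff (mul_ne_zero hc0 hx0), ord_mul w hc0 hx0, hc]
    have h1 : (1 : ℤ) ≤ h := by exact_mod_cast hpos
    have h2 := le_max_left 0 (-ord w x)
    have h3 := le_max_right 0 (-ord w x)
    nlinarith)
  obtain ⟨s, hs⟩ := exists_inv_mod hv (by rintro rfl; simp at hc0) n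
  refine ⟨s * z, ?_⟩
  have : x - ((s * z : 𝓞 k) : k) = (-((t * s - 1 : 𝓞 k) : k)) * x := by
    simp only [map_mul, map_sub, map_one, hz]
    ring
  rw [this]
  simpa using hs.neg.mul hx

/-- The ramification exponent of `2` at `v`. -/
noncomputable def e2 (v : Pl k) : ℕ := (ord v 2).toNat

lemma e2_eq (v : Pl k) : (e2 v : ℤ) = ord v 2 :=
  Int.toNat_of_nonneg ((vge_iff two_ne_zero).1 (vge_two v))

lemma Vge.inv_of_one {v : Pl k} {n : ℤ} (hn : 1 ≤ n) {x : k} (hx : Vge v n (x - 1)) :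
    x ≠ 0 ∧ ord v x = 0 := by
  have := ord_add_eq (v := v) (x := 1) (y := x - 1) one_ne_zero (by
    rw [ord_one]; exact hx.mono (by omega))
  rw [add_sub_cancel, ord_one] at this
  exact this

/-- Elements that are local squares at `v`. -/
noncomputable def Loc (v : Pl k) : Subgroup kˣ where
  carrier := {x | ∃ c : k, c ≠ 0 ∧ Vge v (2 * ord v 2 + 1) ((x : k) / c ^ 2 - 1)}
  one_mem' := ⟨1, one_ne_zero, by simp⟩
  mul_mem' := by
    rintro a b ⟨c, hc0, hc⟩ ⟨d, hd0, hd⟩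
    have h2 : 0 ≤ ord v 2 := (vge_iff two_ne_zero).1 (vge_two v)
    refine ⟨c * d, mul_ne_zero hc0 hd0, ?_⟩
    have : ((a * b : kˣ) : k) / (c * d) ^ 2 - 1
        = ((a : k) / c ^ 2 - 1) * ((b : k) / d ^ 2 - 1) + (((a : k) / c ^ 2 - 1)
          + ((b : k) / d ^ 2 - 1)) := by
      rw [Units.val_mul]; field_simp; ring
    rw [this]
    exact ((hc.mul hd).mono (by omega)).add (hc.add hd)
  inv_mem' := by
    rintro a ⟨c, hc0, hc⟩
    have h2 : 0 ≤ ord v 2 := (vge_iff two_ne_zero).1 (vge_two v)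
    refine ⟨c⁻¹, inv_ne_zero hc0, ?_⟩
    obtain ⟨h0, h1⟩ := hc.inv_of_one (by omega)
    have ha : (a : k) ≠ 0 := a.ne_zero
    have : ((a⁻¹ : kˣ) : k) / c⁻¹ ^ 2 - 1 = (-((a : k) / c ^ 2 - 1)) * ((a : k) / c ^ 2)⁻¹ := by
      rw [Units.val_inv_eq_inv_val]; field_simp; ring
    rw [this]
    have h3 : Vge v 0 ((a : k) / c ^ 2)⁻¹ := by
      rw [vge_iff (inv_ne_zero h0), ord_inv, h1, neg_zero]
    simpa using hc.neg.mul h3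

lemma mem_Loc {v : Pl k} {x : kˣ} : x ∈ Loc v ↔
    ∃ c : k, c ≠ 0 ∧ Vge v (2 * ord v 2 + 1) ((x : k) / c ^ 2 - 1) := Iff.rfl

/-- Elements of even valuation at `v`. -/
noncomputable def Ev (v : Pl k) : Subgroup kˣ where
  carrier := {x | Even (ord v (x : k))}
  one_mem' := by simp
  mul_mem' := by
    intro a b ha hb
    change Even (ord v ((a * b : kˣ) : k))
    rw [Units.val_mul, ord_mul v a.ne_zero b.ne_zero]
    exact Even.add ha hb
  inv_mem' := by
    intro a ha
    change Even (ord v ((a⁻¹ : kˣ) : k))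
    rw [Units.val_inv_eq_inv_val, ord_inv]
    exact Even.neg ha

lemma mem_Ev {v : Pl k} {x : kˣ} : x ∈ Ev v ↔ Even (ord v (x : k)) := Iff.rfl

lemma Ev_index (v : Pl k) : (Ev v).relIndex ⊤ ≤ 2 ∧ (Ev v).relIndex ⊤ ≠ 0 := by
  have := relIndex_le_card (H := Ev v) (L := ⊤) (X := Prop)
    (fun x => Even (ord v ((x : kˣ) : k))) (fun x y hxy => by
      rw [mem_Ev, Units.val_mul, ord_mul v (Units.ne_zero _) (Units.ne_zero _),
        Units.val_inv_eq_inv_val, ord_inv, Int.even_add, even_neg]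
      exact iff_of_eq hxy)
  simpa using this

lemma Loc_le_Ev (v : Pl k) : Loc v ≤ Ev v := by
  rintro x ⟨c, hc0, hc⟩
  have h2 : 0 ≤ ord v 2 := (vge_iff two_ne_zero).1 (vge_two v)
  obtain ⟨h0, h1⟩ := hc.inv_of_one (by omega)
  rw [ord_div v x.ne_zero (pow_ne_zero _ hc0), ord_pow] at h1
  exact ⟨ord v c, by push_cast at h1; linarith⟩

/-- The norm of a place. -/
noncomputable def Nm (v : Pl k) : ℕ := Ideal.absNorm v.asIdeal

lemma Nm_pos (v : Pl k) : 0 < Nm v :=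
  Nat.pos_of_ne_zero (Ideal.absNorm_eq_zero_iff.not.2 v.ne_bot)

lemma card_sq_one_le (v : Pl k) :
    Nat.card {a : (𝓞 k ⧸ v.asIdeal ^ (2 * e2 v + 1))ˣ // a ^ 2 = 1} ≤ 2 * Nm v ^ e2 v := by
  classical
  set e := e2 v with he
  set I := v.asIdeal ^ (2 * e + 1) with hI
  set J := v.asIdeal ^ (e + 1) with hJ
  have hIJ : I ≤ J := Ideal.pow_le_pow_right (by omega)
  have hI0 : I ≠ ⊥ := pow_ne_zero _ v.ne_bot
  have hJ0 : J ≠ ⊥ := pow_ne_zero _ v.ne_bot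
  have : Finite (𝓞 k ⧸ I) := Ideal.finiteQuotientOfFreeOfNeBot I hI0
  have : Finite (𝓞 k ⧸ J) := Ideal.finiteQuotientOfFreeOfNeBot J hJ0
  set S : Ideal (𝓞 k ⧸ I) := J.map (Ideal.Quotient.mk I) with hS
  have hcard : Nat.card S = Nm v ^ e := by
    have h1 := Submodule.card_eq_card_quotient_mul_card S
    rw [Nat.card_congr (DoubleQuot.quotQuotEquivQuotOfLE hIJ).toEquiv] at h1
    have h2 : Nat.card (𝓞 k ⧸ I) = Nm v ^ (2 * e + 1) := by
      rw [← Submodule.cardQuot_apply, ← Ideal.absNorm_apply, hI, map_pow]; rfl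
    have h3 : Nat.card (𝓞 k ⧸ J) = Nm v ^ (e + 1) := by
      rw [← Submodule.cardQuot_apply, ← Ideal.absNorm_apply, hJ, map_pow]; rfl
    rw [h2, h3] at h1
    have h4 : Nm v ^ (2 * e + 1) = Nm v ^ e * Nm v ^ (e + 1) := by rw [← pow_add]; congr 1; omega
    rw [h4] at h1
    exact (Nat.eq_of_mul_eq_mul_right (pow_pos (Nm_pos v) _) h1).symm
  have key : ∀ a : (𝓞 k ⧸ I)ˣ, a ^ 2 = 1 → (a : 𝓞 k ⧸ I) - 1 ∈ S ∨ (a : 𝓞 k ⧸ I) + 1 ∈ S := by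
    intro a ha
    obtain ⟨y, hy⟩ := Ideal.Quotient.mk_surjective (a : 𝓞 k ⧸ I)
    have h1 : (y - 1) * (y + 1) ∈ I := by
      rw [← Ideal.Quotient.eq_zero_iff_mem]
      have : (a : 𝓞 k ⧸ I) ^ 2 = 1 := by
        rw [← Units.val_pow_eq_pow_val, ha, Units.val_one]
      rw [map_mul, map_sub, map_add, map_one, hy]
      linear_combination this
    have h2 : (y - 1) ∈ J ∨ (y + 1) ∈ J := by
      rw [hI, ← vge_int_iff] at h1
      rw [hJ, ← vge_int_iff, ← vge_int_iff]
      by_contra! hne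
      have e1 : ((y - 1 : 𝓞 k) : k) ≠ 0 := fun h => hne.1 (by rw [h]; simp)
      have e2' : ((y + 1 : 𝓞 k) : k) ≠ 0 := fun h => hne.2 (by rw [h]; simp)
      rw [vge_iff e1, vge_iff e2'] at hne
      have hmul : (((y - 1) * (y + 1) : 𝓞 k) : k) = ((y - 1 : 𝓞 k) : k) * ((y + 1 : 𝓞 k) : k) :=
        map_mul (algebraMap (𝓞 k) k) _ _
      rw [hmul, vge_iff (mul_ne_zero e1 e2'), ord_mul v e1 e2'] at h1
      push_cast at hne h1
      have h22 := e2_eq v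
      rw [← he] at h22
      have hmin : ∀ n : ℤ, n ≤ ord v ((y - 1 : 𝓞 k) : k) → n ≤ ord v ((y + 1 : 𝓞 k) : k) →
          n ≤ e := by
        intro n h1 h2
        rw [h22, ← vge_iff two_ne_zero]
        have := ((vge_iff e2').2 h2).sub ((vge_iff e1).2 h1)
        have h3 : ((y + 1 : 𝓞 k) : k) - ((y - 1 : 𝓞 k) : k) = 2 := by
          simp only [map_add, map_sub, map_one]; ring
        rwa [h3] at this
      have a1 := hne.1
      have a2 := hne.2
      omega
    rw [← hy]
    rcases h2 with h | h
    · left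
      have := Ideal.mem_map_of_mem (Ideal.Quotient.mk I) h
      rwa [map_sub, map_one] at this
    · right
      have := Ideal.mem_map_of_mem (Ideal.Quotient.mk I) h
      rwa [map_add, map_one] at this
  let f : {a : (𝓞 k ⧸ I)ˣ // a ^ 2 = 1} → Bool × S := fun a =>
    if h : (a.1 : 𝓞 k ⧸ I) - 1 ∈ S then (true, ⟨_, h⟩)
    else (false, ⟨_, (key a.1 a.2).resolve_left h⟩)
  have hf : Function.Injective f := by
    intro a b hab
    apply Subtype.ext
    apply Units.ext
    simp only [f] at hab
    split_ifs at hab with h1 h2 h2 <;> simp_all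
  refine (Nat.card_le_card_of_injective f hf).trans ?_
  rw [Nat.card_prod, hcard]; simp

lemma Loc_relIndex_Ev (v : Pl k) :
    (Loc v).relIndex (Ev v) ≤ 2 * Nm v ^ e2 v ∧ (Loc v).relIndex (Ev v) ≠ 0 := by
  set m := 2 * e2 v + 1 with hm
  set A := (𝓞 k ⧸ v.asIdeal ^ m)ˣ with hA
  have : Finite (𝓞 k ⧸ v.asIdeal ^ m) :=
    Ideal.finiteQuotientOfFreeOfNeBot _ (pow_ne_zero _ v.ne_bot)
  have hfA : Finite A := inferInstance
  have hmz : (m : ℤ) = 2 * ord v 2 + 1 := by rw [hm, ← e2_eq]; push_cast; ring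
  have hch : ∀ x : Ev v, ∃ (c : k) (a : A) (y : 𝓞 k), c ≠ 0 ∧
      Ideal.Quotient.mk _ y = (a : 𝓞 k ⧸ v.asIdeal ^ m) ∧
      Vge v m (((x : kˣ) : k) / c ^ 2 - (y : k)) ∧ ord v (((x : kˣ) : k) / c ^ 2) = 0 := by
    rintro ⟨x, hx⟩
    obtain ⟨r, hr⟩ := hx
    obtain ⟨c, hc0, hc⟩ := exists_ord_eq v r
    have h0 : (x : k) / c ^ 2 ≠ 0 := div_ne_zero x.ne_zero (pow_ne_zero _ hc0)
    have h1 : ord v ((x : k) / c ^ 2) = 0 := by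
      rw [ord_div v x.ne_zero (pow_ne_zero _ hc0), ord_pow, hr, hc]; push_cast; ring
    obtain ⟨y, hy⟩ := exists_int_approx (v := v) (x := (x : k) / c ^ 2)
      (by rw [vge_iff h0, h1]) m
    have h2 := ord_add_eq (v := v) (x := (x : k) / c ^ 2) (y := -((x : k) / c ^ 2 - (y : k))) h0
      (by rw [h1]; exact hy.neg.mono (by omega))
    rw [show (x : k) / c ^ 2 + -((x : k) / c ^ 2 - (y : k)) = y by ring, h1] at h2
    obtain ⟨s, hs⟩ := exists_inv_mod h2.2 (by rintro rfl; simp at h2) m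
    rw [vge_int_iff, ← Ideal.Quotient.eq_zero_iff_mem, map_sub, map_mul, map_one, sub_eq_zero] at hs
    exact ⟨c, Units.mkOfMulEqOne _ _ hs, y, hc0, rfl, hy, h1⟩
  choose c a y hc0 ha hy h0 using hch
  have := relIndex_le_card (H := Loc v) (L := Ev v) (X := A ⧸ sqs A)
    (fun x => QuotientGroup.mk (a x)) (fun x x' hxx => by
      rw [QuotientGroup.eq] at hxx
      obtain ⟨b, hb⟩ := hxx
      obtain ⟨z, hz⟩ := Ideal.Quotient.mk_surjective (b : 𝓞 k ⧸ v.asIdeal ^ m)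
      have h1 : (b : 𝓞 k ⧸ v.asIdeal ^ m) ^ 2 * a x = a x' := by
        rw [← Units.val_pow_eq_pow_val, ← Units.val_mul]
        congr 1
        have hb' : b ^ 2 = (a x)⁻¹ * a x' := hb
        rw [hb', mul_comm, mul_inv_cancel_left]
      rw [← hz, ← ha, ← ha, ← map_pow, ← map_mul, Ideal.Quotient.eq, ← vge_int_iff] at h1
      simp only [map_sub, map_mul, map_pow] at h1
      have hx0 : ((x : kˣ) : k) ≠ 0 := Units.ne_zero _
      have hx0' : ((x' : kˣ) : k) ≠ 0 := Units.ne_zero _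
      set u := ((x : kˣ) : k) / c x ^ 2 with hu
      set u' := ((x' : kˣ) : k) / c x' ^ 2 with hu'
      have hzv : Vge v 0 ((z : k) ^ 2) := by rw [← map_pow]; exact vge_int v _
      have hune : u ≠ 0 := div_ne_zero hx0 (pow_ne_zero _ (hc0 _))
      have hune' : u' ≠ 0 := div_ne_zero hx0' (pow_ne_zero _ (hc0 _))
      have h2 : Vge v m ((z : k) ^ 2 * u - u') := by
        have := ((hzv.mul (hy x)).mono (by omega : (m : ℤ) ≤ 0 + m)).add (h1.sub (hy x'))
        convert this using 1
        ring
      have hz0 : (z : k) ≠ 0 := by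
        intro hz0
        rw [hz0] at h2
        have : Vge v m u' := by simpa using h2.neg
        rw [vge_iff hune', h0 x'] at this
        omega
      refine ⟨c x' * z / c x, div_ne_zero (mul_ne_zero (hc0 _) hz0) (hc0 _), ?_⟩
      rw [← hmz]
      have e1 : ord v ((z : k) ^ 2 * u) = 0 := by
        have := ord_add_eq (v := v) (x := u') (y := (z : k) ^ 2 * u - u') hune'
          (by rw [h0 x']; exact h2.mono (by omega))
        rw [add_sub_cancel, h0 x'] at this
        exact this.2
      have e3 : (z : k) ^ 2 * u ≠ 0 := mul_ne_zero (pow_ne_zero _ hz0) hune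
      have e2 : (((x : kˣ)⁻¹ * (x' : kˣ) : kˣ) : k) / (c x' * z / c x) ^ 2 - 1
          = (-((z : k) ^ 2 * u - u')) * ((z : k) ^ 2 * u)⁻¹ := by
        have := hc0 x
        have := hc0 x'
        rw [Units.val_mul, Units.val_inv_eq_inv_val, hu, hu']
        field_simp
        ring
      rw [e2]
      have := h2.neg.mul (m := 0) (y := ((z : k) ^ 2 * u)⁻¹) (by
        rw [vge_iff (inv_ne_zero e3), ord_inv, e1, neg_zero])
      simpa using this)
  refine ⟨this.1.trans ?_, this.2⟩
  change (sqs A).index ≤ _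
  rw [sqs_index_finite]
  exact card_sq_one_le v

lemma prod_Nm_le {T : Set (Pl k)} (hT : T.Finite) :
    ∏ v ∈ hT.toFinset, Nm v ^ e2 v ≤ 2 ^ Module.finrank ℚ k := by
  have h1 : ∏ v ∈ hT.toFinset, v.asIdeal ^ e2 v ∣ Ideal.span {(2 : 𝓞 k)} := by
    apply Finset.prod_dvd_of_coprime
    · intro v _ w _ hvw
      refine IsCoprime.pow ?_
      rw [Ideal.isCoprime_iff_sup_eq]
      have : v.asIdeal.IsMaximal := v.isMaximal
      have : w.asIdeal.IsMaximal := w.isMaximal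
      exact Ideal.IsMaximal.coprime_of_ne v.isMaximal w.isMaximal
        (fun h => hvw (HeightOneSpectrum.ext h))
    · intro v _
      rw [Ideal.dvd_span_singleton, ← vge_int_iff]
      have : ((2 : 𝓞 k) : k) = 2 := map_ofNat _ 2
      rw [this, vge_iff two_ne_zero, e2_eq]
  have h2 := map_dvd Ideal.absNorm h1
  rw [map_prod, Ideal.absNorm_span_singleton] at h2
  have h3 : (Algebra.norm ℤ (2 : 𝓞 k)).natAbs = 2 ^ Module.finrank ℚ k := by
    have : (2 : 𝓞 k) = algebraMap ℤ (𝓞 k) 2 := by simp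
    rw [this, Algebra.norm_algebraMap, RingOfIntegers.rank]
    simp [Int.natAbs_pow]
  rw [h3] at h2
  have h4 := Nat.le_of_dvd (by positivity) h2
  simpa [map_pow, Nm] using h4

end Loc

end Tower

namespace Tower

open NumberField IsDedekindDomain

section NormQuad
variable {k K : Type} [Field k] [NumberField k] [Field K] [NumberField K] [Algebra k K]
variable {σ : K ≃ₐ[k] K}

lemma Nm_eq_pow (P : Pl K) :
    Nm P = Nm (below k P) ^ ((below k P).asIdeal.inertiaDeg' P.asIdeal) :=
  Ideal.absNorm_eq_pow_inertiaDeg'_of_liesOver _ _ (below k P).isPrime (below k P).ne_bot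

lemma mem_primesOver_iff (v : Pl k) (I : Ideal (𝓞 K)) :
    I ∈ IsDedekindDomain.primesOverFinset v.asIdeal (𝓞 K) ↔ ∃ P : Pl K, P.asIdeal = I ∧ below k P = v := by
  have := v.isMaximal
  rw [IsDedekindDomain.mem_primesOverFinset_iff v.ne_bot]
  constructor
  · rintro ⟨h1, h2⟩
    exact ⟨⟨I, h1, Ideal.ne_bot_of_liesOver_of_ne_bot v.ne_bot I⟩, rfl,
      HeightOneSpectrum.ext h2.over.symm⟩
  · rintro ⟨P, rfl, rfl⟩
    exact ⟨P.isPrime, inferInstance⟩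

lemma sum_eR_mul (v : Pl k) : ∑ I ∈ IsDedekindDomain.primesOverFinset v.asIdeal (𝓞 K),
    v.asIdeal.ramificationIdx' I * v.asIdeal.inertiaDeg' I = Module.finrank k K := by
  have := v.isMaximal
  exact Ideal.sum_ramification_inertia (𝓞 K) k K v.ne_bot

lemma inertia_pos (P : Pl K) : 0 < (below k P).asIdeal.inertiaDeg' P.asIdeal := by
  have := (below k P).isMaximal
  exact Ideal.inertiaDeg'_pos _ _

namespace IsConj
variable (hσ : IsConj σ)
include hσ

lemma Nm_of_ne {P : Pl K} (h : gPl σ P ≠ P) : Nm P = Nm (below k P) := by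
  classical
  have h1 := sum_eR_mul (K := K) (below k P)
  rw [hσ.finrank_eq_two] at h1
  have h2 : ({P.asIdeal, (gPl σ P).asIdeal} : Finset (Ideal (𝓞 K))) ⊆
      IsDedekindDomain.primesOverFinset (below k P).asIdeal (𝓞 K) := by
    intro I hI
    rw [mem_primesOver_iff]
    simp only [Finset.mem_insert, Finset.mem_singleton] at hI
    rcases hI with rfl | rfl
    · exact ⟨P, rfl, rfl⟩
    · exact ⟨gPl σ P, rfl, below_gPl σ P⟩
  have h3 := Finset.sum_le_sum_of_subset (f := fun I =>
    (below k P).asIdeal.ramificationIdx' I * (below k P).asIdeal.inertiaDeg' I) h2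
  rw [h1, Finset.sum_pair (fun h' => h (HeightOneSpectrum.ext h'.symm))] at h3
  have e1 := eR_pos (k := k) P
  have e2 := eR_pos (k := k) (gPl σ P)
  have f1 := inertia_pos (k := k) P
  have f2 := inertia_pos (k := k) (gPl σ P)
  rw [below_gPl] at f2
  unfold eR at e1 e2
  rw [below_gPl] at e2
  have : (below k P).asIdeal.inertiaDeg' P.asIdeal = 1 := by nlinarith
  rw [Nm_eq_pow (k := k), this, pow_one]

lemma Nm_of_eq {P : Pl K} (h : gPl σ P = P) (he : eR k P = 1) : Nm P = Nm (below k P) ^ 2 := by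
  classical
  have h1 := sum_eR_mul (K := K) (below k P)
  rw [hσ.finrank_eq_two] at h1
  have h2 : IsDedekindDomain.primesOverFinset (below k P).asIdeal (𝓞 K) = {P.asIdeal} := by
    ext I
    rw [mem_primesOver_iff, Finset.mem_singleton]
    constructor
    · rintro ⟨Q, rfl, hQ⟩
      rcases hσ.fibre hQ.symm with rfl | rfl
      · rfl
      · rw [h]
    · rintro rfl
      exact ⟨P, rfl, rfl⟩
  rw [h2, Finset.sum_singleton] at h1
  unfold eR at he
  rw [he, one_mul] at h1
  rw [Nm_eq_pow (k := k), h1]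

end IsConj
end NormQuad
end Tower

namespace Tower

open NumberField IsDedekindDomain

section Zeta
open scoped ENNReal Topology
open Filter
variable (k : Type) [Field k] [NumberField k]

/-- Effective divisors. -/
abbrev Dv := Pl k →₀ ℕ

variable {k}

/-- The norm of an effective divisor. -/
noncomputable def nD (f : Dv k) : ℕ := f.prod fun P n => Nm P ^ n

/-- The ideal of an effective divisor. -/
noncomputable def idD (f : Dv k) : Ideal (𝓞 k) := f.prod fun P n => P.asIdeal ^ n

lemma absNorm_idD (f : Dv k) : Ideal.absNorm (idD f) = nD f := by
  simp only [idD, nD, Finsupp.prod, map_prod, map_pow, Nm]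

lemma nD_pos (f : Dv k) : 0 < nD f :=
  Finset.prod_pos fun P _ => pow_pos (Nm_pos P) _

lemma nD_add (f g : Dv k) : nD (f + g) = nD f * nD g :=
  Finsupp.prod_add_index' (fun _ => pow_zero _) (fun _ _ _ => pow_add _ _ _)

lemma idD_add (f g : Dv k) : idD (f + g) = idD f * idD g :=
  Finsupp.prod_add_index' (fun _ => pow_zero _) (fun _ _ _ => pow_add _ _ _)

lemma idD_ne (f : Dv k) : idD f ≠ 0 := by
  intro h
  have := absNorm_idD f
  have := nD_pos f
  rw [h] at *
  simp at *
  omega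

lemma nD_single (P : Pl k) (n : ℕ) : nD (Finsupp.single P n) = Nm P ^ n :=
  Finsupp.prod_single_index (pow_zero _)

lemma count_idD (f : Dv k) (v : Pl k) :
    FractionalIdeal.count k v ((idD f : Ideal (𝓞 k)) : FractionalIdeal (nonZeroDivisors (𝓞 k)) k)
      = f v := by
  classical
  induction f using Finsupp.induction with
  | zero => simp [idD, FractionalIdeal.count_one]
  | single_add w n f hw hn ih =>
    have h1 : idD (Finsupp.single w n) = w.asIdeal ^ n := Finsupp.prod_single_index (pow_zero _)
    have hz : ∀ I : Ideal (𝓞 k), I ≠ 0 → (I : FractionalIdeal (nonZeroDivisors (𝓞 k)) k) ≠ 0 :=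
      fun I hI => by simpa using hI
    rw [idD_add, FractionalIdeal.coeIdeal_mul, FractionalIdeal.count_mul _ _ (hz _ (idD_ne _))
      (hz _ (idD_ne _)), ih, h1, FractionalIdeal.coeIdeal_pow, FractionalIdeal.count_pow,
      FractionalIdeal.count_maximal]
    simp only [Finsupp.coe_add, Pi.add_apply, Finsupp.single_apply, eq_comm]
    split_ifs <;> simp_all

lemma idD_injective : Function.Injective (idD : Dv k → Ideal (𝓞 k)) := by
  intro f g h
  ext v
  have h1 := count_idD f v
  rw [h, count_idD] at h1
  exact_mod_cast h1.symm

lemma idD_surj (I : Ideal (𝓞 k)) : I ≠ 0 → ∃ f : Dv k, idD f = I := by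
  induction I using UniqueFactorizationMonoid.induction_on_prime with
  | h₁ => exact fun h => absurd rfl h
  | h₂ x hx =>
    intro _
    refine ⟨0, ?_⟩
    rw [Ideal.isUnit_iff] at hx
    simp [idD, hx, Ideal.one_eq_top]
  | h₃ a p ha hp ih =>
    intro _
    obtain ⟨f, hf⟩ := ih ha
    refine ⟨Finsupp.single ⟨p, Ideal.isPrime_of_prime hp, hp.ne_zero⟩ 1 + f, ?_⟩
    rw [idD_add, hf]
    have h1 : idD (Finsupp.single (⟨p, Ideal.isPrime_of_prime hp, hp.ne_zero⟩ : Pl k) 1) = p ^ 1 :=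
      Finsupp.prod_single_index (pow_zero _)
    rw [h1, pow_one]

/-- The zeta function with the Euler factors at a set of places removed. -/
noncomputable def Zs (S : Set (Pl k)) (s : ℝ) : ℝ≥0∞ :=
  ∑' f : {f : Dv k // ∀ P ∈ S, f P = 0}, (nD f.1 : ℝ≥0∞) ^ (-s)

lemma card_nD (n : ℕ) (hn : n ≠ 0) :
    ENat.card {f : Dv k // nD f = n} = (Nat.card {I : Ideal (𝓞 k) // Ideal.absNorm I = n} : ℕ∞) := by
  have hfin : Finite {I : Ideal (𝓞 k) // Ideal.absNorm I = n} :=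
    (Ideal.finite_setOfPred_absNorm_eq n).to_subtype
  rw [← ENat.card_eq_coe_natCard]
  refine ENat.card_congr (Equiv.ofBijective
    (fun f => ⟨idD f.1, (absNorm_idD f.1).trans f.2⟩) ⟨?_, ?_⟩)
  · intro f g h
    exact Subtype.ext (idD_injective (congrArg Subtype.val h))
  · rintro ⟨I, hI⟩
    obtain ⟨f, hf⟩ := idD_surj I (by rintro rfl; simp at hI; exact hn hI.symm)
    exact ⟨⟨f, by rw [← absNorm_idD, hf, hI]⟩, Subtype.ext hf⟩

lemma Zs_empty (s : ℝ) : Zs (∅ : Set (Pl k)) s = ∑' n : ℕ, ENNReal.ofReal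
    (if n = 0 then 0 else (Nat.card {I : Ideal (𝓞 k) // Ideal.absNorm I = n} : ℝ) * (n : ℝ) ^ (-s)) := by
  have h1 : Zs (∅ : Set (Pl k)) s = ∑' f : Dv k, (nD f : ℝ≥0∞) ^ (-s) :=
    (Equiv.subtypeUnivEquiv (p := fun f : Dv k => ∀ P ∈ (∅ : Set (Pl k)), f P = 0)
      (by simp)).tsum_eq (fun f : Dv k => (nD f : ℝ≥0∞) ^ (-s))
  rw [h1, ← (Equiv.sigmaFiberEquiv (nD (k := k))).tsum_eq, ENNReal.tsum_sigma']
  refine tsum_congr fun n => ?_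
  have : ∀ f : {f : Dv k // nD f = n},
      (nD (Equiv.sigmaFiberEquiv (nD (k := k)) ⟨n, f⟩) : ℝ≥0∞) ^ (-s) = (n : ℝ≥0∞) ^ (-s) := by
    rintro ⟨f, hf⟩
    simp [Equiv.sigmaFiberEquiv, hf]
  rw [tsum_congr this, ENNReal.tsum_const]
  split_ifs with hn
  · subst hn
    have : IsEmpty {f : Dv k // nD f = 0} := ⟨fun f => (nD_pos f.1).ne' f.2⟩
    rw [ENat.card_eq_zero_iff_empty _ |>.2 this]
    simp
  · rw [card_nD n hn, ENNReal.ofReal_mul (by positivity), ENNReal.ofReal_natCast,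
      ← ENNReal.ofReal_rpow_of_pos (by positivity), ENNReal.ofReal_natCast]
    simp

lemma exists_Zs_empty : ∃ (z : ℝ → ℝ) (κ : ℝ), 0 < κ ∧
    Tendsto (fun s => (s - 1) * z s) (𝓝[>] 1) (𝓝 κ) ∧
    ∀ᶠ s in 𝓝[>] (1 : ℝ), 0 ≤ z s ∧ Zs (∅ : Set (Pl k)) s = ENNReal.ofReal (z s) := by
  set a : ℝ → ℕ → ℝ := fun s n => if n = 0 then 0 else
    (Nat.card {I : Ideal (𝓞 k) // Ideal.absNorm I = n} : ℝ) * (n : ℝ) ^ (-s) with ha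
  have ha0 : ∀ s n, 0 ≤ a s n := fun s n => by simp only [ha]; split_ifs <;> positivity
  have hz : ∀ s : ℝ, dedekindZeta k s = ((∑' n, a s n : ℝ) : ℂ) := by
    intro s
    rw [dedekindZeta, LSeries, Complex.ofReal_tsum]
    refine tsum_congr fun n => ?_
    rw [LSeries.term_def]
    simp only [ha]
    split_ifs with hn
    · simp
    · rw [Complex.ofReal_mul, Complex.ofReal_cpow (by positivity), div_eq_mul_inv]
      push_cast
      rw [Complex.cpow_neg]
  have ht := tendsto_sub_one_mul_dedekindZeta_nhdsGT k
  have ht' : Tendsto (fun s => (s - 1) * ∑' n, a s n) (𝓝[>] 1) (𝓝 (dedekindZeta_residue k)) := by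
    have := (Complex.continuous_re.tendsto _).comp ht
    refine this.congr fun s => ?_
    simp only [Function.comp_apply, hz]
    rw [← Complex.ofReal_one, ← Complex.ofReal_sub, ← Complex.ofReal_mul, Complex.ofReal_re]
  refine ⟨fun s => ∑' n, a s n, dedekindZeta_residue k, dedekindZeta_residue_pos k, ht', ?_⟩
  have hev := ht'.eventually (lt_mem_nhds (dedekindZeta_residue_pos k))
  filter_upwards [hev] with s hs
  have hsum : Summable (a s) := by
    by_contra h
    simp [tsum_eq_zero_of_not_summable h] at hs
  refine ⟨tsum_nonneg (ha0 s), ?_⟩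
  rw [Zs_empty, ENNReal.ofReal_tsum_of_nonneg (ha0 s) hsum]

lemma one_lt_Nm (P : Pl k) : 2 ≤ Nm P := by
  have h0 := Nm_pos P
  have h1 : Nm P ≠ 1 := fun h => P.isPrime.ne_top (Ideal.absNorm_eq_one_iff.1 h)
  omega

lemma Zs_insert (S : Set (Pl k)) (P : Pl k) {s : ℝ} (hs : 1 ≤ s) :
    Zs S s ≤ 2 * Zs (insert P S) s := by
  classical
  let φ : {f : Dv k // ∀ Q ∈ S, f Q = 0} → ℕ × {f : Dv k // ∀ Q ∈ insert P S, f Q = 0} := fun f =>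
    (f.1 P, ⟨f.1.erase P, fun Q hQ => by
      by_cases hQP : Q = P
      · subst hQP; simp
      · rw [Finsupp.erase_ne hQP]
        exact f.2 Q (hQ.resolve_left hQP)⟩)
  have hφ : Function.Injective φ := by
    intro f g h
    have h1 : f.1 P = g.1 P := congrArg Prod.fst h
    have h2 : f.1.erase P = g.1.erase P := congrArg (fun x => x.2.1) h
    refine Subtype.ext ?_
    rw [← Finsupp.single_add_erase P f.1, ← Finsupp.single_add_erase P g.1, h1, h2]
  let F : ℕ × {f : Dv k // ∀ Q ∈ insert P S, f Q = 0} → ℝ≥0∞ := fun x =>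
    (2⁻¹ : ℝ≥0∞) ^ x.1 * (nD x.2.1 : ℝ≥0∞) ^ (-s)
  calc Zs S s ≤ ∑' f, F (φ f) := by
        refine ENNReal.tsum_le_tsum fun f => ?_
        simp only [F, φ]
        conv_lhs => rw [← Finsupp.single_add_erase P f.1, nD_add, nD_single]
        push_cast
        rw [ENNReal.mul_rpow_of_ne_top (by simp) (by simp)]
        gcongr
        have h2 : (2 : ℝ≥0∞) ≤ (Nm P : ℝ≥0∞) := by exact_mod_cast one_lt_Nm P
        rw [ENNReal.rpow_neg, ENNReal.inv_pow.symm]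
        refine ENNReal.inv_le_inv.2 ?_
        calc (2 : ℝ≥0∞) ^ (f.1 P) ≤ (Nm P : ℝ≥0∞) ^ (f.1 P) := by gcongr
          _ = ((Nm P : ℝ≥0∞) ^ (f.1 P)) ^ (1 : ℝ) := by simp
          _ ≤ _ := ENNReal.rpow_le_rpow_of_exponent_le (one_le_pow₀ (le_trans (by norm_num) h2)) hs
    _ ≤ ∑' x, F x := ENNReal.tsum_comp_le_tsum_of_injective hφ F
    _ = 2 * Zs (insert P S) s := by
        rw [ENNReal.tsum_prod (f := fun n (g : {f : Dv k // ∀ Q ∈ insert P S, f Q = 0}) =>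
          (2⁻¹ : ℝ≥0∞) ^ n * (nD g.1 : ℝ≥0∞) ^ (-s))]
        simp only [ENNReal.tsum_mul_left]
        rw [ENNReal.tsum_mul_right, ENNReal.tsum_geometric]
        simp [Zs]

lemma Zs_finite {S : Set (Pl k)} (hS : S.Finite) {s : ℝ} (hs : 1 ≤ s) :
    Zs (∅ : Set (Pl k)) s ≤ 2 ^ S.ncard * Zs S s := by
  induction S, hS using Set.Finite.induction_on with
  | empty => simp
  | @insert P S hP hS ih =>
    rw [Set.ncard_insert_of_notMem hP hS, pow_succ, mul_assoc]
    exact ih.trans (mul_le_mul_right (Zs_insert S P hs) _)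

end Zeta
end Tower

namespace Tower

open NumberField IsDedekindDomain

section Dens
open scoped ENNReal Topology
open Filter
variable {k K : Type} [Field k] [NumberField k] [Field K] [NumberField K] [Algebra k K]
variable {σ : K ≃ₐ[k] K}

lemma nD_mapDomain {q : Pl k → Pl K} {f : Dv k} (hq : ∀ P, f P ≠ 0 → Nm (q P) = Nm P) :
    nD (f.mapDomain q) = nD f := by
  rw [nD, Finsupp.prod_mapDomain_index (fun _ => pow_zero _) (fun _ _ _ => pow_add _ _ _), nD]
  exact Finset.prod_congr rfl fun P hP => by
    simp only [hq P (Finsupp.mem_support_iff.1 hP)]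

lemma IsConj.Zs_mul_le (hσ : IsConj σ) {S : Set (Pl k)} (hS : ∀ v ∉ S, ¬ Nonsplit σ v) (s : ℝ) :
    Zs S s * Zs S s ≤ Zs (∅ : Set (Pl K)) s := by
  choose q hq using exists_above (k := k) (K := K)
  have hqi : Function.Injective q := fun a b h => by rw [← hq a, ← hq b, h]
  have hq' : ∀ v, below k (gPl σ (q v)) = v := fun v => by rw [below_gPl, hq]
  have hqi' : Function.Injective (fun v => gPl σ (q v)) := fun a b h => by
    have := hq' a; simp only at h; rw [h, hq'] at this; exact this.symm
  have hne : ∀ v ∉ S, gPl σ (q v) ≠ q v := fun v hv h => hS v hv ⟨q v, hq v, h⟩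
  have hN : ∀ v ∉ S, Nm (q v) = Nm v := fun v hv => by rw [hσ.Nm_of_ne (hne v hv), hq]
  have hN' : ∀ v ∉ S, Nm (gPl σ (q v)) = Nm v := fun v hv => by
    rw [hσ.Nm_of_ne, hq']
    intro h
    exact hS v hv ⟨gPl σ (q v), hq' v, h⟩
  let X := {f : Dv k // ∀ P ∈ S, f P = 0}
  let φ : X × X → {f : Dv K // ∀ P ∈ (∅ : Set (Pl K)), f P = 0} := fun x =>
    ⟨x.1.1.mapDomain q + x.2.1.mapDomain (fun v => gPl σ (q v)), by simp⟩
  have hnD : ∀ x, nD (φ x).1 = nD x.1.1 * nD x.2.1 := fun x => by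
    simp only [φ, nD_add]
    congr 1
    · exact nD_mapDomain fun P hP => hN P fun h => hP (x.1.2 P h)
    · exact nD_mapDomain fun P hP => hN' P fun h => hP (x.2.2 P h)
  have hval : ∀ x : X × X, ∀ v ∉ S, (φ x).1 (q v) = x.1.1 v ∧ (φ x).1 (gPl σ (q v)) = x.2.1 v := by
    intro x v hv
    simp only [φ, Finsupp.add_apply]
    constructor
    · rw [Finsupp.mapDomain_apply hqi, Finsupp.mapDomain_of_notMem_range, add_zero]
      rintro ⟨w, hw⟩
      simp only at hw
      have : w = v := by rw [← hq' w, hw, hq]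
      subst this
      exact hne _ hv hw
    · rw [Finsupp.mapDomain_apply hqi' , Finsupp.mapDomain_of_notMem_range, zero_add]
      rintro ⟨w, hw⟩
      have : w = v := by rw [← hq w, hw, hq']
      subst this
      exact hne _ hv hw.symm
  have hφ : Function.Injective φ := by
    intro x y h
    refine Prod.ext (Subtype.ext (Finsupp.ext fun v => ?_)) (Subtype.ext (Finsupp.ext fun v => ?_))
    · by_cases hv : v ∈ S
      · rw [x.1.2 v hv, y.1.2 v hv]
      · rw [← (hval x v hv).1, ← (hval y v hv).1, h]
    · by_cases hv : v ∈ S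
      · rw [x.2.2 v hv, y.2.2 v hv]
      · rw [← (hval x v hv).2, ← (hval y v hv).2, h]
  calc Zs S s * Zs S s = ∑' x : X × X, (nD (φ x).1 : ℝ≥0∞) ^ (-s) := by
        rw [ENNReal.tsum_prod (f := fun f g : X => (nD (φ (f, g)).1 : ℝ≥0∞) ^ (-s))]
        simp only [hnD, Nat.cast_mul]
        rw [Zs, ← ENNReal.tsum_mul_right]
        refine tsum_congr fun f => ?_
        rw [← ENNReal.tsum_mul_left]
        refine tsum_congr fun g => ?_
        rw [ENNReal.mul_rpow_of_ne_top (by simp) (by simp)]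
    _ ≤ _ := ENNReal.tsum_comp_le_tsum_of_injective hφ (fun f => (nD f.1 : ℝ≥0∞) ^ (-s))

lemma IsConj.exists_nonsplit (hσ : IsConj σ) {S : Set (Pl k)} (hS : S.Finite) :
    ∃ v ∉ S, Nonsplit σ v := by
  by_contra! hcon
  obtain ⟨z, κ, hκ, hz, hzev⟩ := exists_Zs_empty (k := k)
  obtain ⟨z', κ', hκ', hz', hzev'⟩ := exists_Zs_empty (k := K)
  have hle : ∀ᶠ s in 𝓝[>] (1 : ℝ),
      ((s - 1) * z s) ^ 2 ≤ ((2 ^ S.ncard) ^ 2 * (s - 1)) * ((s - 1) * z' s) := by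
    filter_upwards [hzev, hzev', self_mem_nhdsWithin] with s h1 h2 hs
    have hs1 : (1 : ℝ) < s := hs
    have h3 : ENNReal.ofReal (z s ^ 2) ≤ ENNReal.ofReal ((2 ^ S.ncard) ^ 2 * z' s) := by
      rw [ENNReal.ofReal_pow h1.1, ENNReal.ofReal_mul (by positivity), ← h1.2, ← h2.2,
        ENNReal.ofReal_pow (by positivity), ENNReal.ofReal_pow (by positivity)]
      calc Zs (∅ : Set (Pl k)) s ^ 2 ≤ (2 ^ S.ncard * Zs S s) ^ 2 := by
            gcongr; exact Zs_finite hS hs1.le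
        _ = (2 ^ S.ncard) ^ 2 * (Zs S s * Zs S s) := by ring
        _ ≤ (2 ^ S.ncard) ^ 2 * Zs (∅ : Set (Pl K)) s := by
            gcongr; exact hσ.Zs_mul_le hcon s
        _ = _ := by simp
    rw [ENNReal.ofReal_le_ofReal_iff (by have := h2.1; positivity)] at h3
    calc ((s - 1) * z s) ^ 2 = (s - 1) ^ 2 * z s ^ 2 := by ring
      _ ≤ (s - 1) ^ 2 * ((2 ^ S.ncard) ^ 2 * z' s) := by gcongr
      _ = _ := by ring
  have hid : Tendsto (fun s : ℝ => (2 ^ S.ncard : ℝ) ^ 2 * (s - 1)) (𝓝[>] 1) (𝓝 0) := by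
    have : Tendsto (fun s : ℝ => (2 ^ S.ncard : ℝ) ^ 2 * (s - 1)) (𝓝 1) (𝓝 ((2 ^ S.ncard : ℝ) ^ 2 * (1 - 1))) :=
      (Continuous.tendsto (by fun_prop) _)
    rw [sub_self, mul_zero] at this
    exact this.mono_left nhdsWithin_le_nhds
  have := le_of_tendsto_of_tendsto (hz.pow 2) (hid.mul hz') hle
  rw [zero_mul] at this
  have : 0 < κ ^ 2 := by positivity
  linarith

end Dens

section Quadratic
variable {K : Type} [Field K] [NumberField K]

lemma exists_quad {a : K} (ha : ¬ IsSquare a) : ∃ (M : Type) (_ : Field M) (_ : NumberField M)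
    (_ : Algebra K M) (τ : M ≃ₐ[K] M) (s : M), IsConj τ ∧ s ^ 2 = algebraMap K M a ∧ τ s = -s := by
  open Polynomial in
  have hirr : Irreducible (X ^ 2 - C a : K[X]) := by
    refine X_pow_sub_C_irreducible_of_prime Nat.prime_two fun b hb => ha ⟨b, by rw [← hb, sq]⟩
  have : Fact (Irreducible (Polynomial.X ^ 2 - Polynomial.C a : Polynomial K)) := ⟨hirr⟩
  let M := AdjoinRoot (Polynomial.X ^ 2 - Polynomial.C a : Polynomial K)
  let s : M := AdjoinRoot.root _
  have hs : s ^ 2 = algebraMap K M a := by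
    have := AdjoinRoot.eval₂_root (Polynomial.X ^ 2 - Polynomial.C a : Polynomial K)
    simp only [Polynomial.eval₂_sub, Polynomial.eval₂_pow, Polynomial.eval₂_X,
      Polynomial.eval₂_C, sub_eq_zero] at this
    exact this
  have hmonic : (Polynomial.X ^ 2 - Polynomial.C a : Polynomial K).Monic :=
    Polynomial.monic_X_pow_sub_C a two_ne_zero
  have hfin : Module.Finite K M := hmonic.finite_adjoinRoot
  have hcz : CharZero M := charZero_of_injective_algebraMap (algebraMap K M).injective
  have hnf : NumberField M := { to_finiteDimensional := FiniteDimensional.trans ℚ K M }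
  let f : M →ₐ[K] M := AdjoinRoot.liftAlgHom _ (Algebra.ofId K M) (-s) (by
    simp [hs])
  have hf : f s = -s := AdjoinRoot.liftAlgHom_root ..
  have hff : f.comp f = AlgHom.id K M := by
    refine AdjoinRoot.algHom_ext ?_
    change f (f s) = s
    rw [hf, map_neg, hf, neg_neg]
  have hs0 : s ≠ 0 := by
    intro h
    rw [h, zero_pow two_ne_zero] at hs
    have : a = 0 := by simpa using hs.symm
    exact ha (this ▸ ⟨0, by simp⟩)
  refine ⟨M, inferInstance, hnf, inferInstance, AlgEquiv.ofAlgHom f f hff hff, s, ?_, hs, hf⟩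
  have hdec : ∀ x : M, ∃ u v : K, x = algebraMap K M u + algebraMap K M v * s := by
    intro x
    obtain ⟨p, rfl⟩ := AdjoinRoot.mk_surjective x
    induction p using Polynomial.induction_on with
    | C c => exact ⟨c, 0, by simp [AdjoinRoot.mk_C]; rfl⟩
    | add p q hp hq =>
      obtain ⟨u, v, h⟩ := hp
      obtain ⟨u', v', h'⟩ := hq
      exact ⟨u + u', v + v', by rw [map_add, h, h']; simp only [map_add]; ring⟩
    | monomial n c h =>
      obtain ⟨u, v, h⟩ := h
      refine ⟨v * a, u, ?_⟩
      have h1 : AdjoinRoot.mk (Polynomial.X ^ 2 - Polynomial.C a)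
          (Polynomial.C c * Polynomial.X ^ (n + 1)) = AdjoinRoot.mk _
          (Polynomial.C c * Polynomial.X ^ n) * s := by
        have hp : (Polynomial.C c * Polynomial.X ^ (n + 1) : Polynomial K)
          = (Polynomial.C c * Polynomial.X ^ n) * Polynomial.X := by ring
        exact (congrArg _ hp).trans (map_mul _ _ _)
      refine h1.trans ?_
      rw [h, map_mul, ← hs]
      ring
  refine ⟨fun x => congrArg (fun g => g x) hff, fun x hx => ?_, s, ?_⟩
  · obtain ⟨u, v, rfl⟩ := hdec x
    have hx : f (algebraMap K M u + algebraMap K M v * s) = algebraMap K M u + algebraMap K M v * s := hx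
    rw [map_add, map_mul, hf, AlgHom.commutes, AlgHom.commutes] at hx
    have h2 : 2 * (algebraMap K M v * s) = 0 := by linear_combination -hx
    have h3 : algebraMap K M v * s = 0 := by simpa using h2
    exact ⟨u, by rw [h3, add_zero]⟩
  · change f s ≠ s
    rw [hf]
    intro h
    apply hs0
    have : 2 * s = 0 := by linear_combination -h
    simpa using this

lemma exists_sq_mod {P : Pl K} {y : 𝓞 K} (h2 : ord P 2 = 0) {q : ℕ}
    (hq : Nm P = q ^ 2) (hfrob : y ^ (q - 1) - 1 ∈ P.asIdeal) (hy : y ∉ P.asIdeal) :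
    ∃ c : 𝓞 K, c ∉ P.asIdeal ∧ y - c ^ 2 ∈ P.asIdeal := by
  have hmax := P.isMaximal
  let _ : Field (𝓞 K ⧸ P.asIdeal) := Ideal.Quotient.field _
  have hfin : Finite (𝓞 K ⧸ P.asIdeal) := Ideal.finiteQuotientOfFreeOfNeBot _ P.ne_bot
  let _ : Fintype (𝓞 K ⧸ P.asIdeal) := Fintype.ofFinite _
  have hcard : Fintype.card (𝓞 K ⧸ P.asIdeal) = q ^ 2 := by
    rw [← hq, Nm, Ideal.absNorm_apply, Submodule.cardQuot_apply, Nat.card_eq_fintype_card]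
  have hchar : ringChar (𝓞 K ⧸ P.asIdeal) ≠ 2 := by
    intro h
    have h3 : ((2 : ℕ) : 𝓞 K ⧸ P.asIdeal) = 0 := by
      rw [← h]; exact ringChar.Nat.cast_ringChar
    have h4 : Ideal.Quotient.mk P.asIdeal 2 = 0 := by rw [map_ofNat]; exact_mod_cast h3
    rw [Ideal.Quotient.eq_zero_iff_mem, ← pow_one P.asIdeal, ← vge_int_iff] at h4
    have h5 : Vge P 1 (2 : K) := by exact_mod_cast h4
    rw [vge_iff two_ne_zero, h2] at h5
    norm_num at h5
  have hy0 : Ideal.Quotient.mk P.asIdeal y ≠ 0 := by rwa [Ne, Ideal.Quotient.eq_zero_iff_mem]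
  have hf : Ideal.Quotient.mk P.asIdeal y ^ (q - 1) = 1 := by
    rw [← sub_eq_zero, ← map_pow, ← map_one (Ideal.Quotient.mk P.asIdeal), ← map_sub,
      Ideal.Quotient.eq_zero_iff_mem]
    exact hfrob
  have hodd := FiniteField.odd_card_of_char_ne_two hchar
  rw [← Nat.odd_iff, hcard, Nat.odd_pow_iff two_ne_zero] at hodd
  obtain ⟨m, hm⟩ := hodd
  have hsq := (FiniteField.isSquare_iff hchar hy0).2 (by
    rw [hcard]
    have : q ^ 2 / 2 = (q - 1) * (m + 1) := by
      rw [hm]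
      have : (2 * m + 1) ^ 2 = 2 * (2 * m * (m + 1)) + 1 := by ring
      rw [this, Nat.add_sub_cancel]
      omega
    rw [this, pow_mul, hf, one_pow])
  obtain ⟨r, hr⟩ := hsq
  obtain ⟨c, rfl⟩ := Ideal.Quotient.mk_surjective r
  refine ⟨c, fun h => hy0 ?_, ?_⟩
  · rw [hr, Ideal.Quotient.eq_zero_iff_mem.2 h, zero_mul]
  · rw [← Ideal.Quotient.eq_zero_iff_mem, map_sub, map_pow, hr, sq, sub_self]

lemma fermat_mod {k : Type} [Field k] [NumberField k] {v : Pl k} {y : 𝓞 k} (hy : y ∉ v.asIdeal) :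
    y ^ (Nm v - 1) - 1 ∈ v.asIdeal := by
  have hmax := v.isMaximal
  let _ : Field (𝓞 k ⧸ v.asIdeal) := Ideal.Quotient.field _
  have hfin : Finite (𝓞 k ⧸ v.asIdeal) := Ideal.finiteQuotientOfFreeOfNeBot _ v.ne_bot
  let _ : Fintype (𝓞 k ⧸ v.asIdeal) := Fintype.ofFinite _
  have hcard : Fintype.card (𝓞 k ⧸ v.asIdeal) = Nm v := by
    rw [Nm, Ideal.absNorm_apply, Submodule.cardQuot_apply, Nat.card_eq_fintype_card]
  have hy0 : Ideal.Quotient.mk v.asIdeal y ≠ 0 := by rwa [Ne, Ideal.Quotient.eq_zero_iff_mem]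
  rw [← Ideal.Quotient.eq_zero_iff_mem, map_sub, map_pow, map_one, ← hcard,
    FiniteField.pow_card_sub_one_eq_one _ hy0, sub_self]

end Quadratic

section AuxPrimes
variable {k K : Type} [Field k] [NumberField k] [Field K] [NumberField K] [Algebra k K]
variable {σ : K ≃ₐ[k] K}

lemma vge_one_iff {v : Pl k} (y : 𝓞 k) : Vge v 1 (y : k) ↔ y ∈ v.asIdeal := by
  have := vge_int_iff v y 1
  rwa [pow_one] at this

lemma ord_eq_zero_iff {v : Pl k} {y : 𝓞 k} (hy : (y : k) ≠ 0) : ord v (y : k) = 0 ↔ y ∉ v.asIdeal := by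
  rw [← vge_one_iff, vge_iff hy]
  have := ord_int_nonneg v y
  omega

/-- At an inert place, units of the base field are local squares. -/
lemma IsConj.exists_approx_sq (hσ : IsConj σ) {P : Pl K} (hP : gPl σ P = P) (he : eR k P = 1)
    {a : k} (ha : a ≠ 0) (h2 : ord (below k P) 2 = 0) (h0 : ord (below k P) a = 0) :
    ∃ c : K, c ≠ 0 ∧ Vge P 1 (algebraMap k K a / c ^ 2 - 1) := by
  have hval : Vge (below k P) (ord (below k P) a) a := by rw [vge_iff ha]
  obtain ⟨y, hy⟩ := exists_int_approx (v := below k P) (x := a) (by rwa [h0] at hval) 1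
  have hya := ord_add_eq (v := below k P) ha (y := -(a - y)) (by
    rw [h0, zero_add]; exact_mod_cast hy.neg)
  rw [h0, show a + -(a - (y : k)) = (y : k) by ring] at hya
  have hyv : y ∉ (below k P).asIdeal := (ord_eq_zero_iff hya.1).1 hya.2
  set Y : 𝓞 K := algebraMap (𝓞 k) (𝓞 K) y with hY
  have hmem : ∀ z : 𝓞 k, algebraMap (𝓞 k) (𝓞 K) z ∈ P.asIdeal ↔ z ∈ (below k P).asIdeal :=
    fun z => Iff.rfl
  have h2P : ord P (2 : K) = 0 := by
    have := ord_algebraMap (k := k) P 2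
    rw [h2, mul_zero, map_ofNat] at this
    exact this
  obtain ⟨c, hc, hyc⟩ := exists_sq_mod (y := Y) h2P (hσ.Nm_of_eq hP he) (by
    have := (hmem _).2 (fermat_mod hyv)
    rwa [map_sub, map_pow, map_one] at this) (fun h => hyv ((hmem _).1 h))
  have hc0 : (c : K) ≠ 0 := by
    intro h
    have : c = 0 := by simpa using h
    exact hc (this ▸ zero_mem _)
  have hoc := (ord_eq_zero_iff hc0).2 hc
  refine ⟨c, hc0, ?_⟩
  have h3 : Vge P 1 (algebraMap k K a - (c : K) ^ 2) := by
    have e1 := vge_algebraMap (P := P) (n := 1) (by norm_num) (x := a - y) (by exact_mod_cast hy)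
    have e2 := (vge_one_iff _).2 hyc
    have e3 : ((Y - c ^ 2 : 𝓞 K) : K) = algebraMap k K y - (c : K) ^ 2 := by
      rw [show ((Y - c ^ 2 : 𝓞 K) : K) = (Y : K) - (c : K) ^ 2 by simp]
      congr 1
    rw [e3] at e2
    have := e1.add e2
    rw [map_sub] at this
    simpa using this
  have h4 : Vge P 0 (((c : K) ^ 2)⁻¹) := by
    rw [vge_iff (by simpa using hc0), ord_inv, ord_pow, hoc]; simp
  have := h3.mul h4
  rwa [add_zero, sub_mul, mul_inv_cancel₀ (pow_ne_zero 2 hc0), ← div_eq_mul_inv] at this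

/-- Split places at which a nonsquare is not a local square. -/
theorem IsConj.exists_split_nonsquare (hσ : IsConj σ) {a : kˣ} (ha : ¬ IsSquare (algebraMap k K a))
    {S : Set (Pl k)} (hS : S.Finite) : ∃ v ∉ S, ¬ Nonsplit σ v ∧ a ∉ Loc v := by
  by_contra! hcon
  obtain ⟨M, _, _, _, τ, s, hτ, hs, hτs⟩ := exists_quad ha
  obtain ⟨b, t, ht0, ht, hb⟩ := hσ.exists_sqrt
  have hS' : (S ∪ {v | ord v (a : k) ≠ 0} ∪ {v | ord v (2 : k) ≠ 0} ∪ {v | ord v b ≠ 0}).Finite :=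
    ((hS.union (finite_ord_ne_zero _)).union (finite_ord_ne_zero _)).union (finite_ord_ne_zero _)
  obtain ⟨P, hP, Q, hQ, hQQ⟩ := hτ.exists_nonsplit (finite_preimage (K := K) hS')
  subst hQ
  simp only [Set.mem_ofPred_eq, Set.mem_union, not_or, not_not] at hP
  obtain ⟨⟨⟨hPS, hPa⟩, hP2⟩, hPb⟩ := hP
  set P := below K Q
  have h2P : ord P (2 : K) = 0 := by
    have := ord_algebraMap (k := k) P 2
    rw [hP2, mul_zero, map_ofNat] at this
    exact this
  have key : ∃ c : K, c ≠ 0 ∧ Vge P 1 (algebraMap k K a / c ^ 2 - 1) := by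
    by_cases hsp : gPl σ P = P
    · refine hσ.exists_approx_sq hsp ?_ a.ne_zero hP2 hPa
      have hb0 : b ≠ 0 := by
        rintro rfl
        rw [map_zero] at hb
        exact ht0 (by simpa using hb.symm)
      exact hσ.eR_eq_one_of_sqrt ht0 ht hb (by simp only [P] at hPb; rw [hPb]; simp) hP2
    · have := hcon (below k P) hPS (fun h => hsp (hσ.nonsplit_iff.1 h))
      obtain ⟨c, hc0, hc⟩ := mem_Loc.1 this
      rw [hP2, mul_zero, zero_add] at hc
      refine ⟨algebraMap k K c, by simpa using hc0, ?_⟩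
      have := vge_algebraMap (P := P) (by norm_num) hc
      simpa using this
  obtain ⟨c, hc0, hc⟩ := key
  refine hτ.split_of_sqrt hτs hs.symm hc0 ?_ hQQ
  rw [h2P]
  exact hc

end AuxPrimes
end Tower

namespace Tower

open NumberField IsDedekindDomain

section Local
variable {k K : Type} [Field k] [NumberField k] [Field K] [NumberField K] [Algebra k K]
variable {σ : K ≃ₐ[k] K}

lemma vge_one_of_algebraMap {P : Pl K} {x : k} (h : Vge P 1 (algebraMap k K x)) :
    Vge (below k P) 1 x := by
  by_cases h0 : x = 0
  · simp [h0]
  rw [vge_iff h0]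
  rw [vge_iff (by simpa using h0), ord_algebraMap] at h
  have := eR_pos (k := k) P
  by_contra! h'
  have : ord (below k P) x ≤ 0 := by omega
  nlinarith

lemma mem_Loc_of_sub {v : Pl k} (h2 : ord v 2 = 0) {x : kˣ} (hx : ord v (x : k) = 0) {c : k}
    (hc : Vge v 1 ((x : k) - c ^ 2)) : x ∈ Loc v := by
  have h := ord_add_eq (v := v) x.ne_zero (y := -((x : k) - c ^ 2)) (by
    rw [hx, zero_add]; exact hc.neg)
  rw [hx, show (x : k) + -((x : k) - c ^ 2) = c ^ 2 by ring] at h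
  refine mem_Loc.2 ⟨c, fun h0 => h.1 (by simp [h0]), ?_⟩
  have h4 : Vge v 0 ((c ^ 2)⁻¹) := by
    rw [vge_iff (inv_ne_zero h.1), ord_inv, h.2, neg_zero]
  have := hc.mul h4
  rw [sub_mul, mul_inv_cancel₀ h.1, ← div_eq_mul_inv] at this
  rw [h2]
  exact this

lemma IsConj.nrm_mem_Loc (hσ : IsConj σ) {P : Pl K} (hP : eR k P ≠ 1)
    (h2 : ord (below k P) 2 = 0) {u : Kˣ} (hu : ord P (u : K) = 0) :
    hσ.nrm u ∈ Loc (below k P) := by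
  have huv : Vge P 0 (u : K) := by rw [vge_iff u.ne_zero, hu]
  obtain ⟨y, hy0, hy⟩ := hσ.exists_residue hP huv
  have hg := (hσ.eR_eq_two hP).2
  have hσv : ∀ n x, Vge P n (σ x) ↔ Vge P n x := fun n x => by
    have := vge_gPl σ P x n
    rwa [hg] at this
  have h0 : ord (below k P) (hσ.nrm u : k) = 0 := by
    have h := ord_algebraMap P (hσ.nrm u : k)
    have h0 : σ (u : K) ≠ 0 := by simp
    rw [hσ.nrm_spec, ord_mul _ u.ne_zero h0, hσ.ord_conj hg, hu] at h
    have := eR_pos (k := k) P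
    rcases mul_eq_zero.1 h.symm with h' | h'
    · simp at h'; omega
    · exact h'
  refine mem_Loc_of_sub h2 h0 (c := y) (vge_one_of_algebraMap ?_)
  rw [map_sub, map_pow, hσ.nrm_spec]
  have e : (u : K) * σ u - algebraMap k K y ^ 2
      = ((u : K) - algebraMap k K y) * σ u + algebraMap k K y * σ ((u : K) - algebraMap k K y) := by
    rw [map_sub, AlgEquiv.commutes]; ring
  rw [e]
  refine Vge.add ?_ ?_
  · simpa using hy.mul ((hσv 0 _).2 huv)
  · simpa using (vge_algebraMap le_rfl hy0).mul ((hσv 1 _).2 hy)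

/-- Elements positive at a complex embedding. -/
def Pos (φ : k →+* ℂ) : Subgroup kˣ where
  carrier := {x | ∃ r : ℝ, 0 < r ∧ φ x = r}
  one_mem' := ⟨1, one_pos, by simp⟩
  mul_mem' := by
    rintro a b ⟨r, hr, ha⟩ ⟨s, hs, hb⟩
    exact ⟨r * s, mul_pos hr hs, by simp [ha, hb]⟩
  inv_mem' := by
    rintro a ⟨r, hr, ha⟩
    exact ⟨r⁻¹, inv_pos.2 hr, by simp [ha]⟩

lemma mem_Pos {φ : k →+* ℂ} {x : kˣ} : x ∈ Pos φ ↔ ∃ r : ℝ, 0 < r ∧ φ x = r := Iff.rfl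

lemma exists_real [IsTotallyReal k] (φ : k →+* ℂ) (x : k) : ∃ r : ℝ, φ x = r := by
  have h := IsTotallyReal.complexEmbedding_isReal φ
  have := congrArg (fun f => f x) (ComplexEmbedding.isReal_iff.1 h)
  exact ⟨(φ x).re, (Complex.conj_eq_iff_re.1 this).symm⟩

lemma Pos_relIndex [IsTotallyReal k] (φ : k →+* ℂ) (L : Subgroup kˣ) :
    (Pos φ).relIndex L ≤ 2 ∧ (Pos φ).relIndex L ≠ 0 := by
  have := relIndex_le_card (H := Pos φ) (L := L) (X := Prop)
    (fun x => 0 < (φ (x : kˣ)).re) (fun x y hxy => by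
      obtain ⟨r, hr⟩ := exists_real φ (x : kˣ)
      obtain ⟨s, hs⟩ := exists_real φ (y : kˣ)
      have hr0 : r ≠ 0 := by
        rintro rfl
        simp at hr
      have hs0 : s ≠ 0 := by
        rintro rfl
        simp at hs
      simp only [hr, hs, Complex.ofReal_re, eq_iff_iff] at hxy
      refine ⟨r⁻¹ * s, ?_, by simp [hr, hs]⟩
      rcases lt_or_gt_of_ne hr0 with h | h
      · have : s < 0 := lt_of_le_of_ne (not_lt.1 fun h' => absurd (hxy.2 h') h.not_gt) hs0
        exact mul_pos_of_neg_of_neg (inv_lt_zero.2 h) this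
      · exact mul_pos (inv_pos.2 h) (hxy.1 h))
  simpa using this

lemma IsConj.isTotallyReal [IsTotallyReal k] (hσ : IsConj σ) {z : kˣ} {s : K} (hs0 : s ≠ 0)
    (hs : s ^ 2 = algebraMap k K z) (hσs : σ s = -s) (hz : ∀ φ : k →+* ℂ, z ∈ Pos φ) :
    IsTotallyReal K := by
  have key : ∀ φ : K →+* ℂ, ComplexEmbedding.IsReal φ := by
    intro φ
    rw [ComplexEmbedding.isReal_iff]
    ext x
    obtain ⟨u, v, rfl⟩ := hσ.exists_decomp (π := s) (by
      rw [hσs]; intro h; apply hs0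
      have : 2 * s = 0 := by linear_combination -h
      simpa using this) x
    obtain ⟨a, ha⟩ := exists_real (φ.comp (algebraMap k K)) u
    obtain ⟨b, hb⟩ := exists_real (φ.comp (algebraMap k K)) v
    obtain ⟨r, hr, hr'⟩ := hz (φ.comp (algebraMap k K))
    have hφs : ∃ c : ℝ, φ s = c := by
      have h1 : φ s ^ 2 = ((Real.sqrt r : ℝ) : ℂ) ^ 2 := by
        rw [← map_pow, hs, ← Complex.ofReal_pow, Real.sq_sqrt hr.le]
        exact hr'
      rcases sq_eq_sq_iff_eq_or_eq_neg.1 h1 with h | h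
      · exact ⟨_, h⟩
      · exact ⟨-Real.sqrt r, by rw [h]; simp⟩
    obtain ⟨c, hc⟩ := hφs
    simp only [RingHom.comp_apply] at ha hb
    rw [ComplexEmbedding.conjugate_coe_eq, map_add, map_mul, ha, hb, hc]
    simp
  refine ⟨fun w => ?_⟩
  rw [← InfinitePlace.mk_embedding w]
  exact InfinitePlace.isReal_iff.2 (by
    have := key (InfinitePlace.mk w.embedding).embedding
    exact this)

end Local
end Tower

namespace Tower

open NumberField IsDedekindDomain

section A
variable {k K : Type} [Field k] [NumberField k] [Field K] [NumberField K] [Algebra k K]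
variable {σ : K ≃ₐ[k] K}

lemma sqs_relIndex_TU [IsTotallyReal k] {T : Set (Pl k)} (hT : T.Finite) :
    (sqs kˣ).relIndex (TU T) = 2 ^ (Module.finrank ℚ k + T.ncard) := by
  rw [← TU_sqs_index hT, Subgroup.relIndex]
  congr 1
  ext x
  rw [Subgroup.mem_subgroupOf, mem_sqs, mem_sqs]
  constructor
  · rintro ⟨y, hy⟩
    refine ⟨⟨y, fun v hv => ?_⟩, Subtype.ext hy⟩
    have h := x.2 v hv
    rw [← hy, Units.val_pow_eq_pow_val, ord_pow] at h
    simpa using h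
  · rintro ⟨y, hy⟩
    exact ⟨y, congrArg Subtype.val hy⟩

/-- Elements of `k` becoming squares in `K`. -/
def SqK (k K : Type) [Field k] [Field K] [Algebra k K] : Subgroup kˣ :=
  (sqs Kˣ).comap (Units.map (algebraMap k K : k →* K))

lemma mem_SqK {x : kˣ} : x ∈ SqK k K ↔ IsSquare (algebraMap k K x) := by
  rw [SqK, Subgroup.mem_comap, mem_sqs]
  constructor
  · rintro ⟨y, hy⟩
    refine ⟨y, ?_⟩
    have := congrArg Units.val hy
    simpa [pow_two] using this.symm
  · rintro ⟨y, hy⟩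
    have hy0 : y ≠ 0 := by
      rintro rfl
      simp at hy
    refine ⟨Units.mk0 y hy0, Units.ext ?_⟩
    simp [pow_two, hy]

lemma IsConj.sqs_relIndex_SqK (hσ : IsConj σ) (L : Subgroup kˣ) :
    (sqs kˣ).relIndex (SqK k K ⊓ L) ≤ 2 := by
  have := (relIndex_le_card (H := sqs kˣ) (L := SqK k K ⊓ L) (X := Prop)
    (fun x => (x : kˣ) ∈ sqs kˣ) (fun x y hxy => by
      simp only [eq_iff_iff] at hxy
      by_cases hx : (x : kˣ) ∈ sqs kˣ
      · exact mul_mem (inv_mem hx) (hxy.1 hx)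
      · have hy : (y : kˣ) ∉ sqs kˣ := fun h => hx (hxy.2 h)
        have key : ∀ z : (SqK k K ⊓ L : Subgroup kˣ), (z : kˣ) ∉ sqs kˣ →
            ∃ w : K, algebraMap k K (z : kˣ) = w ^ 2 ∧ σ w = -w := by
          intro z hz
          obtain ⟨w, hw⟩ := mem_SqK.1 z.2.1
          refine ⟨w, by rw [hw, pow_two], ?_⟩
          have h1 : σ w ^ 2 = w ^ 2 := by
            rw [← map_pow, pow_two w, ← hw, AlgEquiv.commutes]
          rcases sq_eq_sq_iff_eq_or_eq_neg.1 h1 with h | h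
          · exfalso
            obtain ⟨c, rfl⟩ := hσ.fixed w h
            rw [← map_mul] at hw
            have hw := (algebraMap k K).injective hw
            have hc0 : c ≠ 0 := by
              rintro rfl
              simp at hw
            exact hz ⟨Units.mk0 c hc0, Units.ext (by simp [pow_two, hw])⟩
          · exact h
        obtain ⟨w, hw, hw'⟩ := key x hx
        obtain ⟨u, hu, hu'⟩ := key y hy
        have hw0 : w ≠ 0 := by
          rintro rfl
          simp at hw
        have hu0 : u ≠ 0 := by
          rintro rfl
          simp at hu
        obtain ⟨c, hc⟩ := hσ.fixed (u / w) (by rw [map_div₀, hw', hu', neg_div_neg_eq])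
        have hc0 : c ≠ 0 := by
          rintro rfl
          rw [map_zero, eq_comm, div_eq_zero_iff] at hc
          tauto
        refine ⟨Units.mk0 c hc0, Units.ext ((algebraMap k K).injective ?_)⟩
        simp [hc, hw, hu, div_eq_inv_mul, mul_pow])).1
  simpa using this

lemma Loc_relIndex_TU {T : Set (Pl k)} {v : Pl k} (hv : v ∉ T) (h2 : ord v 2 = 0) :
    (Loc v).relIndex (TU T) ≤ 2 ∧ (Loc v).relIndex (TU T) ≠ 0 := by
  have h := Loc_relIndex_Ev v
  have he : e2 v = 0 := by have := e2_eq v; omega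
  rw [he, pow_zero, mul_one] at h
  have hle : TU T ≤ Ev v := fun x hx => by rw [mem_Ev, hx v hv]; exact ⟨0, rfl⟩
  exact ⟨(Subgroup.relIndex_le_of_le_right hle h.2).trans h.1,
    fun h0 => h.2 (Subgroup.relIndex_eq_zero_of_le_right hle h0)⟩

lemma inf_relIndex_le {G ι : Type*} [Group G] (L : Subgroup G) (s : Finset ι) (f : ι → Subgroup G)
    (c : ι → ℕ) (h : ∀ i ∈ s, (f i).relIndex L ≤ c i ∧ (f i).relIndex L ≠ 0) :
    (s.inf f).relIndex L ≤ ∏ i ∈ s, c i ∧ (s.inf f).relIndex L ≠ 0 := by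
  classical
  induction s using Finset.induction_on with
  | empty => simp
  | insert i s hi ih =>
    have h1 := h i (by simp)
    have h2 := ih (fun j hj => h j (by simp [hj]))
    rw [Finset.inf_insert, Finset.prod_insert hi]
    exact ⟨Subgroup.relIndex_inf_le.trans (Nat.mul_le_mul h1.1 h2.1),
      Subgroup.relIndex_inf_ne_zero h1.2 h2.2⟩

lemma mem_finset_inf {G ι : Type*} [Group G] {s : Finset ι} {f : ι → Subgroup G} {x : G} :
    x ∈ s.inf f ↔ ∀ i ∈ s, x ∈ f i := by
  rw [Finset.inf_eq_iInf]
  simp [Subgroup.mem_iInf]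

lemma IsConj.exists_indep [IsTotallyReal k] (hσ : IsConj σ) {T : Set (Pl k)} (hT : T.Finite)
    (h2 : ∀ v, v ∉ T → ord v (2 : k) = 0) (j : ℕ) (hj : j + 1 ≤ Module.finrank ℚ k + T.ncard) :
    ∃ V : Finset (Pl k), V.card = j ∧ (∀ v ∈ V, v ∉ T ∧ ¬ Nonsplit σ v) ∧
      2 ^ j ≤ (V.inf Loc).relIndex (TU T) := by
  classical
  induction j with
  | zero =>
    refine ⟨∅, rfl, by simp, ?_⟩
    simp
  | succ j ih =>
    obtain ⟨V, hV, hVT, hVi⟩ := ih (by omega)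
    have hup := inf_relIndex_le (TU T) V Loc (fun _ => 2)
      (fun v hv => Loc_relIndex_TU (hVT v hv).1 (h2 v (hVT v hv).1))
    rw [Finset.prod_const, hV] at hup
    have hex : ∃ a ∈ V.inf Loc ⊓ TU T, a ∉ SqK k K := by
      by_contra! hcon
      have e1 := Subgroup.relIndex_inf_mul_relIndex (V.inf Loc) (SqK k K) (TU T)
      have e2 : (V.inf Loc ⊓ SqK k K).relIndex (TU T) = (V.inf Loc).relIndex (TU T) := by
        rw [← Subgroup.inf_relIndex_right, ← Subgroup.inf_relIndex_right (V.inf Loc)]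
        congr 1
        rw [inf_right_comm]
        exact inf_eq_left.2 hcon
      have e3 := Subgroup.relIndex_inf_mul_relIndex (sqs kˣ) (SqK k K) (TU T)
      have e4 : sqs kˣ ⊓ SqK k K = sqs kˣ := by
        refine inf_eq_left.2 ?_
        rintro x ⟨y, rfl⟩
        exact mem_SqK.2 ⟨algebraMap k K y, by simp [pow_two]⟩
      rw [e4, sqs_relIndex_TU hT] at e3
      have e5 := hσ.sqs_relIndex_SqK (TU T)
      have e6 : 0 < (V.inf Loc).relIndex (SqK k K ⊓ TU T) := by
        rcases Nat.eq_zero_or_pos ((V.inf Loc).relIndex (SqK k K ⊓ TU T)) with h | h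
        · rw [h, zero_mul, e2] at e1
          exact absurd e1.symm hup.2
        · exact h
      have e7 : (SqK k K).relIndex (TU T) ≤ 2 ^ j := by
        rw [e2] at e1
        exact (Nat.le_mul_of_pos_left _ e6).trans (e1.le.trans hup.1)
      have e8 : 2 ^ (Module.finrank ℚ k + T.ncard) ≤ 2 ^ (j + 1) := by
        rw [← e3, pow_succ', ]
        exact Nat.mul_le_mul e5 e7
      have := (Nat.pow_le_pow_iff_right (by norm_num)).1 e8
      omega
    obtain ⟨a, ⟨haV, haT⟩, ha⟩ := hex
    rw [mem_SqK] at ha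
    obtain ⟨v, hvS, hvn, hav⟩ := hσ.exists_split_nonsquare ha (S := T ∪ V)
      (hT.union V.finite_toSet)
    simp only [Set.mem_union, not_or, Finset.mem_coe] at hvS
    refine ⟨insert v V, by rw [Finset.card_insert_of_notMem hvS.2, hV], ?_, ?_⟩
    · intro w hw
      rcases Finset.mem_insert.1 hw with rfl | hw
      · exact ⟨hvS.1, hvn⟩
      · exact hVT w hw
    · rw [Finset.inf_insert, ← Subgroup.relIndex_inf_mul_relIndex, pow_succ']
      refine Nat.mul_le_mul ?_ hVi
      have h0 := Loc_relIndex_TU hvS.1 (h2 v hvS.1)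
      have h1 : (Loc v).relIndex (V.inf Loc ⊓ TU T) ≠ 0 := fun h =>
        h0.2 (by
          have := Subgroup.relIndex_inf_mul_relIndex (Loc v) (V.inf Loc) (TU T)
          rw [h, zero_mul] at this
          exact absurd this.symm (Subgroup.relIndex_inf_ne_zero h0.2 hup.2))
      have h2 : (Loc v).relIndex (V.inf Loc ⊓ TU T) ≠ 1 := fun h =>
        hav (Subgroup.relIndex_eq_one.1 h ⟨haV, haT⟩)
      omega

lemma indep_subset {T : Set (Pl k)} (h2 : ∀ v, v ∉ T → ord v (2 : k) = 0) {V W : Finset (Pl k)}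
    (hV : ∀ v ∈ V, v ∉ T) (hVi : 2 ^ V.card ≤ (V.inf Loc).relIndex (TU T)) (hW : W ⊆ V) :
    2 ^ W.card ≤ (W.inf Loc).relIndex (TU T) := by
  classical
  have hup := inf_relIndex_le (TU T) (V \ W) Loc (fun _ => 2)
    (fun v hv => Loc_relIndex_TU (hV v (Finset.mem_sdiff.1 hv).1) (h2 v (hV v (Finset.mem_sdiff.1 hv).1)))
  rw [Finset.prod_const] at hup
  rw [← Finset.sdiff_union_of_subset hW, Finset.inf_union,
    Finset.card_union_of_disjoint Finset.sdiff_disjoint, pow_add] at hVi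
  have := hVi.trans (Subgroup.relIndex_inf_le.trans (Nat.mul_le_mul_right _ hup.1))
  exact Nat.le_of_mul_le_mul_left this (by positivity)

lemma isSquare_of_local [IsTotallyReal k] {T : Set (Pl k)} (hT : T.Finite) (hCT : ClassTrivial T)
    (h2 : ∀ v, v ∉ T → ord v (2 : k) = 0) {V : Finset (Pl k)}
    (hV : ∀ v ∈ V, v ∉ T) (hVi : 2 ^ V.card ≤ (V.inf Loc).relIndex (TU T)) {z : kˣ}
    (hz : z ∈ TU (T ∪ V)) (hpos : ∀ φ, z ∈ Pos φ) (hloc : ∀ v ∈ T, z ∈ Loc v) : z ∈ sqs kˣ := by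
  classical
  by_contra hcon
  have hnsq : ¬ IsSquare (z : k) := by
    rintro ⟨y, hy⟩
    have hy0 : y ≠ 0 := by
      rintro rfl
      simp at hy
    exact hcon ⟨Units.mk0 y hy0, Units.ext (by simp [pow_two, hy])⟩
  obtain ⟨M, _, _, _, τ, s, hτ, hs, hτs⟩ := exists_quad hnsq
  have hs0 : s ≠ 0 := by
    rintro rfl
    rw [zero_pow two_ne_zero] at hs
    exact z.ne_zero (by simpa using hs.symm)
  have hM : IsTotallyReal M := hτ.isTotallyReal hs0 hs hτs hpos
  set W := V.filter (fun v => ∃ P : Pl M, below k P = v ∧ eR k P ≠ 1) with hW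
  have hWV : W ⊆ V := Finset.filter_subset _ _
  have hf := hτ.first_ineq hT W.finite_toSet hCT (by
    intro P hPT hP
    simp only [hW, Finset.coe_filter, Set.mem_ofPred_eq]
    refine ⟨?_, P, rfl, hP⟩
    by_contra hPV
    refine hP (hτ.eR_eq_one_of_sqrt hs0 hτs hs.symm ?_ (h2 _ hPT))
    rw [hz (below k P) (by simp [hPT, hPV])]
    exact ⟨0, rfl⟩)
  have hns : {v ∈ T | Nonsplit τ v} = ∅ := by
    ext v
    simp only [Set.mem_ofPred_eq, Set.mem_empty_iff_false, iff_false, not_and]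
    rintro hv ⟨P, rfl, hP⟩
    obtain ⟨c, hc0, hc⟩ := mem_Loc.1 (hloc _ hv)
    exact hτ.split_of_sqrt hτs hs.symm hc0 hc hP
  rw [hns, Set.ncard_empty, zero_add, Set.ncard_coe_finset] at hf
  have h1 := indep_subset h2 hV hVi hWV
  have h3 : (hτ.nrmT T).range ≤ (W.inf Loc).subgroupOf (TU T) := by
    rintro _ ⟨u, rfl⟩
    rw [Subgroup.mem_subgroupOf, mem_finset_inf]
    intro v hv
    obtain ⟨hvV, P, rfl, hP⟩ := Finset.mem_filter.1 hv
    exact hτ.nrm_mem_Loc hP (h2 _ (hV _ hvV)) (u.2 P (hV _ hvV))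
  have h4 : (W.inf Loc).relIndex (TU T) ≤ (hτ.nrmT T).range.index :=
    Nat.le_of_dvd (Nat.pos_of_ne_zero hf.2) (Subgroup.index_dvd_of_le h3)
  have : 0 < 2 ^ W.card := by positivity
  omega

end A
end Tower

namespace Tower

open NumberField IsDedekindDomain

section A
variable {k K : Type} [Field k] [NumberField k] [Field K] [NumberField K] [Algebra k K]
variable {σ : K ≃ₐ[k] K}

lemma IsConj.nrm_mem_Ev (hσ : IsConj σ) {v : Pl k} (hv : Nonsplit σ v)
    (hunr : ∀ P : Pl K, eR k P = 1) (u : Kˣ) : hσ.nrm u ∈ Ev v := by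
  obtain ⟨P, rfl, hP⟩ := hv
  rw [mem_Ev]
  have h := ord_algebraMap P ((hσ.nrm u : kˣ) : k)
  rw [hσ.nrm_spec, ord_mul P u.ne_zero (by simp), hσ.ord_conj hP, hunr] at h
  exact ⟨ord P (u : K), by simpa using h.symm⟩

/-- The Hasse norm principle for an everywhere unramified quadratic extension of totally real
fields. -/
theorem IsConj.hasse [IsTotallyReal K] (hσ : IsConj σ) (hunr : ∀ P : Pl K, eR k P = 1) {a : kˣ}
    (ha : ∀ v, Nonsplit σ v → Even (ord v (a : k))) : ∃ κ : Kˣ, hσ.nrm κ = a := by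
  classical
  have : IsTotallyReal k := IsTotallyReal.of_algebra k K
  obtain ⟨T0, hT0, hCT0⟩ := exists_classTrivial (k := k)
  set T : Set (Pl k) := T0 ∪ {v | ord v (2 : k) ≠ 0} ∪ {v | ord v (a : k) ≠ 0} with hTdef
  have hT : T.Finite := (hT0.union (finite_ord_ne_zero _)).union (finite_ord_ne_zero _)
  have hCT : ClassTrivial T := hCT0.mono (fun v hv => Or.inl (Or.inl hv))
  have h2 : ∀ v, v ∉ T → ord v (2 : k) = 0 := fun v hv => by
    by_contra h
    exact hv (Or.inl (Or.inr h))
  have haT : a ∈ TU T := fun v hv => by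
    by_contra h
    exact hv (Or.inr h)
  set N := Module.finrank ℚ k with hN
  have hN0 : 0 < N := Module.finrank_pos
  obtain ⟨V, hVc, hVp, hVi⟩ := hσ.exists_indep hT h2 (N + T.ncard - 1) (by omega)
  set T1 : Set (Pl k) := T ∪ V with hT1def
  have hT1 : T1.Finite := hT.union V.finite_toSet
  have hVT : ∀ v ∈ V, v ∉ T := fun v hv => (hVp v hv).1
  have hT1c : T1.ncard = T.ncard + V.card := by
    rw [hT1def, Set.ncard_union_eq (Set.disjoint_right.2 fun v hv => hVT v hv) hT V.finite_toSet,
      Set.ncard_coe_finset]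
  set Tf := hT.toFinset with hTf
  have hTfc : T.ncard = Tf.card := Set.ncard_eq_toFinset_card T hT
  set Tn := Tf.filter (Nonsplit σ) with hTn
  set Ts := Tf.filter (fun v => ¬ Nonsplit σ v) with hTs
  have hns : {v ∈ T1 | Nonsplit σ v} = (Tn : Set (Pl k)) := by
    ext v
    simp only [hTn, hT1def, Set.mem_ofPred_eq, Finset.coe_filter, hTf, Set.Finite.mem_toFinset,
      Set.mem_union, Finset.mem_coe]
    constructor
    · rintro ⟨h | h, h'⟩
      · exact ⟨h, h'⟩
      · exact absurd h' (hVp v h).2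
    · rintro ⟨h, h'⟩
      exact ⟨Or.inl h, h'⟩
  have hf := hσ.first_ineq hT1 Set.finite_empty (hCT.mono Set.subset_union_left)
    (fun P _ hP => absurd (hunr P) hP)
  rw [hns, Set.ncard_coe_finset, Set.ncard_empty, add_zero] at hf
  set Y := Tn.inf Ev with hY
  set L := Y ⊓ TU T1 with hL
  set Z : Subgroup kˣ := Finset.univ.inf (Pos (k := k)) ⊓ (Ts.inf Loc ⊓ Tn.inf Loc) with hZ
  have hZY : Z ≤ Y := by
    refine inf_le_right.trans (inf_le_right.trans ?_)
    exact Finset.inf_mono_fun fun v _ => Loc_le_Ev v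
  have hpos := inf_relIndex_le L Finset.univ (Pos (k := k)) (fun _ => 2)
    (fun φ _ => Pos_relIndex φ L)
  have hcard : Fintype.card (k →+* ℂ) = N := NumberField.Embeddings.card k ℂ
  rw [Finset.prod_const, Finset.card_univ, hcard] at hpos
  have hs := inf_relIndex_le L Ts Loc (fun v => 4 * Nm v ^ e2 v) (fun v _ => by
    have h1 := Loc_relIndex_Ev v
    have h2 := Ev_index v
    have h3 := Subgroup.relIndex_mul_relIndex (Loc v) (Ev v) ⊤ (Loc_le_Ev v) le_top
    have h4 : (Loc v).relIndex ⊤ ≠ 0 := by rw [← h3]; exact mul_ne_zero h1.2 h2.2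
    refine ⟨(Subgroup.relIndex_le_of_le_right le_top h4).trans ?_,
      fun h => h4 (Subgroup.relIndex_eq_zero_of_le_right le_top h)⟩
    rw [← h3]
    calc _ ≤ 2 * Nm v ^ e2 v * 2 := Nat.mul_le_mul h1.1 h2.1
      _ = _ := by ring)
  have hn := inf_relIndex_le L Tn Loc (fun v => 2 * Nm v ^ e2 v) (fun v hv => by
    have h1 := Loc_relIndex_Ev v
    have hle : L ≤ Ev v := inf_le_left.trans (Finset.inf_le hv)
    exact ⟨(Subgroup.relIndex_le_of_le_right hle h1.2).trans h1.1,
      fun h => h1.2 (Subgroup.relIndex_eq_zero_of_le_right hle h)⟩)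
  have hZL : Z.relIndex L ≤ 2 ^ (2 * N + 2 * Ts.card + Tn.card) ∧ Z.relIndex L ≠ 0 := by
    refine ⟨?_, Subgroup.relIndex_inf_ne_zero hpos.2 (Subgroup.relIndex_inf_ne_zero hs.2 hn.2)⟩
    have hp := prod_Nm_le hT
    rw [← Finset.prod_filter_mul_prod_filter_not _ (Nonsplit σ)] at hp
    rw [Finset.prod_mul_distrib, Finset.prod_const] at hs hn
    calc Z.relIndex L ≤ _ := Subgroup.relIndex_inf_le.trans (Nat.mul_le_mul hpos.1
          (Subgroup.relIndex_inf_le.trans (Nat.mul_le_mul hs.1 hn.1)))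
      _ = 2 ^ N * 4 ^ Ts.card * 2 ^ Tn.card *
          ((∏ v ∈ Tn, Nm v ^ e2 v) * (∏ v ∈ Ts, Nm v ^ e2 v)) := by ring
      _ ≤ 2 ^ N * 4 ^ Ts.card * 2 ^ Tn.card * 2 ^ N := Nat.mul_le_mul_left _ hp
      _ = _ := by
        rw [show (4 : ℕ) = 2 ^ 2 by norm_num, ← pow_mul]
        ring
  have hsplit : Tn.card + Ts.card = Tf.card := Finset.card_filter_add_card_filter_not _
  have hZR : Z.relIndex (TU T1) = Z.relIndex L * Y.relIndex (TU T1) := by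
    rw [hL, Subgroup.relIndex_inf_mul_relIndex, inf_eq_left.2 hZY]
  have hsq : Z ⊓ TU T1 ≤ sqs kˣ := by
    rintro z ⟨⟨hz1, hz2, hz3⟩, hz⟩
    refine isSquare_of_local hT hCT h2 hVT (hVc ▸ hVi) hz
      (fun φ => mem_finset_inf.1 hz1 φ (Finset.mem_univ _)) (fun v hv => ?_)
    by_cases h : Nonsplit σ v
    · exact mem_finset_inf.1 hz3 v (by simp [hTn, hTf, hv, h])
    · exact mem_finset_inf.1 hz2 v (by simp [hTs, hTf, hv, h])
  have hNY : (hσ.nrmT T1).range ≤ Y.subgroupOf (TU T1) := by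
    rintro _ ⟨u, rfl⟩
    rw [Subgroup.mem_subgroupOf, hY, mem_finset_inf]
    intro v hv
    exact hσ.nrm_mem_Ev (Finset.mem_filter.1 hv).2 hunr u
  have hrel := Subgroup.relIndex_mul_index hNY
  have hYne : Y.relIndex (TU T1) ≠ 0 := fun h => hf.2 (by
    rw [← hrel]; exact mul_eq_zero_of_right _ h)
  have hdvd : (sqs kˣ).relIndex (TU T1) ≤ Z.relIndex (TU T1) := by
    have : Z.relIndex (TU T1) ≠ 0 := by rw [hZR]; exact mul_ne_zero hZL.2 hYne
    rw [← Subgroup.inf_relIndex_right] at this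
    rw [← Subgroup.inf_relIndex_right (sqs kˣ), ← Subgroup.inf_relIndex_right Z]
    exact Subgroup.relIndex_le_of_le_left (le_inf hsq inf_le_right) this
  rw [sqs_relIndex_TU hT1, hZR, hT1c, hVc, hTfc] at hdvd
  have hbig : 2 ^ Tn.card ≤ 2 * Y.relIndex (TU T1) := by
    have h := hdvd.trans (Nat.mul_le_mul_right _ hZL.1)
    have e : 2 ^ (2 * N + 2 * Ts.card + Tn.card) * 2 ^ Tn.card
        = 2 * 2 ^ (Module.finrank ℚ k + (Tf.card + (N + Tf.card - 1))) := by
      rw [← pow_add, ← pow_succ']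
      congr 1
      omega
    refine le_of_mul_le_mul_left (a := 2 ^ (2 * N + 2 * Ts.card + Tn.card)) ?_ (by positivity)
    rw [e]
    nlinarith
  have hYi : (Y.subgroupOf (TU T1)).index = Y.relIndex (TU T1) := rfl
  have hone : (hσ.nrmT T1).range.relIndex (Y.subgroupOf (TU T1)) = 1 := by
    have h1 : (hσ.nrmT T1).range.index ≤ Y.relIndex (TU T1) := by omega
    rw [← hrel, hYi] at h1
    have h3 : (hσ.nrmT T1).range.relIndex (Y.subgroupOf (TU T1)) ≠ 0 := fun h => by
      rw [h, zero_mul] at hrel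
      exact hf.2 hrel.symm
    have : (hσ.nrmT T1).range.relIndex (Y.subgroupOf (TU T1)) ≤ 1 := by
      by_contra! h4
      have := Nat.pos_of_ne_zero hYne
      nlinarith
    omega
  have haY : (⟨a, TU_mono Set.subset_union_left haT⟩ : TU T1) ∈ Y.subgroupOf (TU T1) := by
    rw [Subgroup.mem_subgroupOf, hY, mem_finset_inf]
    exact fun v hv => ha v (Finset.mem_filter.1 hv).2
  obtain ⟨u, hu⟩ := Subgroup.relIndex_eq_one.1 hone haY
  exact ⟨u, congrArg Subtype.val hu⟩

end A
end Tower

namespace Tower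

open NumberField IsDedekindDomain

section A
variable {k L F : Type*} [Field k] [Field L] [Algebra k L] [Group F]

/-- Crossed homomorphisms on a subgroup. -/
def IsCross (π : F →* (L ≃ₐ[k] L)) (F' : Subgroup F) (g : F → L) : Prop :=
  (∀ f ∈ F', g f ≠ 0) ∧ ∀ f ∈ F', ∀ f' ∈ F', g (f * f') = g f * π f (g f')

variable {π : F →* (L ≃ₐ[k] L)} {F' : Subgroup F} {g : F → L}

lemma IsCross.map_one (hg : IsCross π F' g) : g 1 = 1 := by
  have := hg.2 1 (one_mem _) 1 (one_mem _)
  rw [mul_one, _root_.map_one, AlgEquiv.one_apply] at this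
  exact (mul_eq_left₀ (hg.1 1 (one_mem _))).1 this.symm

lemma IsCross.extend (hg : IsCross π F' g) (hF : F'.index = 2) {s : F} (hs : s ∉ F') {y : L}
    (hy : y ≠ 0) (h1 : ∀ f ∈ F', π s (g (s⁻¹ * f * s)) * y = g f * π f y)
    (h2 : y * π s y = g (s * s)) :
    ∃ g' : F → L, IsCross π ⊤ g' ∧ ∀ f ∈ F', g' f = g f := by
  classical
  have hn : F'.Normal := Subgroup.normal_of_index_eq_two hF
  have hmul : ∀ {a b : F}, a * b ∈ F' ↔ (a ∈ F' ↔ b ∈ F') := fun {a b} =>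
    Subgroup.mul_mem_iff_of_index_two hF
  have hinv : s⁻¹ ∉ F' := fun h => hs (by simpa using inv_mem h)
  have hss : s * s ∈ F' := hmul.2 Iff.rfl
  refine ⟨fun f => if f ∈ F' then g f else g (f * s⁻¹) * π (f * s⁻¹) y, ⟨?_, ?_⟩,
    fun f hf => if_pos hf⟩
  · intro f _
    by_cases hf : f ∈ F'
    · simpa [hf] using hg.1 f hf
    · have : f * s⁻¹ ∈ F' := hmul.2 ⟨fun h => absurd h hf, fun h => absurd h hinv⟩
      simp [hf, hg.1 _ this, hy]
  · have key : ∀ a ∈ F', ∀ b, b ∉ F' → a * b ∉ F' := fun a ha b hb h => hb ((hmul.1 h).1 ha)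
    have h1' : ∀ f ∈ F', g (s * f * s⁻¹) * π (s * f * s⁻¹) y = y * π s (g f) := fun f hf => by
      rw [← h1 _ (hn.conj_mem f hf s), mul_comm y]
      congr 4
      group
    intro a _ b _
    by_cases ha : a ∈ F'
    · by_cases hb : b ∈ F'
      · simp [ha, hb, mul_mem ha hb, hg.2 a ha b hb]
      · have hb' : b * s⁻¹ ∈ F' := hmul.2 ⟨fun h => absurd h hb, fun h => absurd h hinv⟩
        simp only [key a ha b hb, hb, ha, if_false, if_true, mul_assoc a b]
        rw [hg.2 a ha _ hb', map_mul π a, map_mul (π a), mul_assoc]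
        rfl
    · obtain ⟨c, hc, rfl⟩ : ∃ c ∈ F', a = c * s := ⟨a * s⁻¹, hmul.2 ⟨fun h => absurd h ha,
        fun h => absurd h hinv⟩, by group⟩
      have ec : c * s * s⁻¹ = c := by group
      by_cases hb : b ∈ F'
      · have hu : s * b * s⁻¹ ∈ F' := hn.conj_mem b hb s
        have hab : c * s * b ∉ F' := fun h => ha ((hmul.1 h).2 hb)
        simp only [ha, hab, hb, if_false, if_true, ec]
        rw [show c * s * b * s⁻¹ = c * (s * b * s⁻¹) by group, hg.2 c hc _ hu, map_mul,
          AlgEquiv.mul_apply, mul_assoc, ← map_mul, h1' b hb, map_mul, map_mul,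
          AlgEquiv.mul_apply, mul_assoc]
      · obtain ⟨d, hd, rfl⟩ : ∃ d ∈ F', b = d * s := ⟨b * s⁻¹, hmul.2 ⟨fun h => absurd h hb,
          fun h => absurd h hinv⟩, by group⟩
        have ed : d * s * s⁻¹ = d := by group
        have hu : s * d * s⁻¹ ∈ F' := hn.conj_mem d hd s
        have hab : c * s * (d * s) ∈ F' := hmul.2 ⟨fun h => absurd h ha, fun h => absurd h hb⟩
        simp only [ha, hab, hb, if_false, if_true, ec, ed]
        rw [show c * s * (d * s) = c * ((s * d * s⁻¹) * (s * s)) by group,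
          hg.2 c hc _ (mul_mem hu hss), hg.2 _ hu _ hss, ← h2, mul_assoc (g c), map_mul π c s,
          AlgEquiv.mul_apply, ← map_mul (π c)]
        congr 2
        rw [map_mul (π (s * d * s⁻¹)), ← mul_assoc, h1' d hd, map_mul (π s), ← mul_assoc]
        congr 1
        rw [← AlgEquiv.mul_apply, ← AlgEquiv.mul_apply, ← map_mul, ← map_mul]
        congr 2
        group

/-- Crossed homomorphisms which agree on the kernel differ by a coboundary. -/
lemma IsCross.exists_coboundary {K : Type*} [Field K] [Algebra K L] [FiniteDimensional K L]
    (hg : IsCross π F' g) {h : F → L} (hh : IsCross π F' h)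
    (π' : F' →* (L ≃ₐ[K] L)) (hπ' : ∀ f x, π' f x = π f x) (hsurj : Function.Surjective π')
    (hker : ∀ r ∈ π.ker, g r = h r) :
    ∃ x : L, x ≠ 0 ∧ ∀ f ∈ F', h f * x = g f * π f x := by
  choose l hl using hsurj
  have hsm : ∀ (γ : L ≃ₐ[K] L) (u : Lˣ), ((γ • u : Lˣ) : L) = γ (u : L) := fun _ _ => rfl
  have hind : ∀ f f' : F', π' f = π' f' → h f / g f = h f' / g f' := by
    intro f f' hff
    have hr : ((f : F)⁻¹ * (f' : F)) ∈ π.ker := by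
      rw [MonoidHom.mem_ker, map_mul, map_inv, inv_mul_eq_one]
      ext x
      rw [← hπ', ← hπ', hff]
    have hF : ((f : F)⁻¹ * (f' : F)) ∈ F' := mul_mem (inv_mem f.2) f'.2
    have e1 := hg.2 f f.2 _ hF
    have e2 := hh.2 f f.2 _ hF
    rw [mul_inv_cancel_left] at e1 e2
    have hne : π f (g ((f : F)⁻¹ * (f' : F))) ≠ 0 := by simpa using hg.1 _ hF
    rw [e1, e2, ← hker _ hr, mul_div_mul_right _ _ hne]
  set c : (L ≃ₐ[K] L) → Lˣ := fun γ => Units.mk0 (h (l γ) / g (l γ))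
    (div_ne_zero (hh.1 _ (l γ).2) (hg.1 _ (l γ).2)) with hc
  have hcoc : groupCohomology.IsMulCocycle₁ c := by
    intro γ δ
    ext
    rw [Units.val_mul, hsm]
    simp only [hc, Units.val_mk0]
    rw [hind (l (γ * δ)) (l γ * l δ) (by rw [hl, map_mul, hl, hl]), Subgroup.coe_mul,
      hg.2 _ (l γ).2 _ (l δ).2, hh.2 _ (l γ).2 _ (l δ).2, map_div₀]
    have hγ : ∀ x, γ x = π (l γ) x := fun x => by rw [← hπ', hl]
    rw [hγ, hγ]
    field_simp
  obtain ⟨x, hx⟩ := groupCohomology.isMulCoboundary₁_of_isMulCocycle₁_of_aut_to_units c hcoc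
  refine ⟨x, x.ne_zero, fun f hf => ?_⟩
  have := congrArg Units.val (hx (π' ⟨f, hf⟩))
  rw [Units.val_div_eq_div_val, hsm, hπ'] at this
  simp only [hc, Units.val_mk0] at this
  rw [hind _ ⟨f, hf⟩ (hl _), div_eq_div_iff x.ne_zero (hg.1 f hf)] at this
  rw [← this]
  ring

end A
end Tower

namespace Tower

open NumberField IsDedekindDomain

section A
variable {k L F : Type*} [Field k] [Field L] [Algebra k L] [Group F]
variable {π : F →* (L ≃ₐ[k] L)} {F' : Subgroup F} {g : F → L}

lemma hom_mul_apply (π : F →* (L ≃ₐ[k] L)) (a b : F) (x : L) : π (a * b) x = π a (π b x) := by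
  rw [map_mul]; rfl

lemma IsCross.conj (hg : IsCross π F' g) (hn : F'.Normal) (s : F) :
    IsCross π F' (fun f => π s (g (s⁻¹ * f * s))) := by
  have hc : ∀ f ∈ F', s⁻¹ * f * s ∈ F' := fun f hf => by simpa using hn.conj_mem f hf s⁻¹
  refine ⟨fun f hf => by simpa using hg.1 _ (hc f hf), fun f hf f' hf' => ?_⟩
  beta_reduce
  rw [show s⁻¹ * (f * f') * s = (s⁻¹ * f * s) * (s⁻¹ * f' * s) by group,
    hg.2 _ (hc f hf) _ (hc f' hf'), map_mul, ← hom_mul_apply, ← hom_mul_apply]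
  congr 3
  group

variable (hg : IsCross π F' g) (hn : F'.Normal) {s : F} (hss : s * s ∈ F') {x : L}
  (h1 : ∀ f ∈ F', π s (g (s⁻¹ * f * s)) * x = g f * π f x)

include hg hn hss h1

lemma IsCross.fixed_one (f : F) (hf : f ∈ F') :
    π f (g (s * s)) * (x * π s x) = g (s * s) * π f (x * π s x) := by
  have hc : ∀ f ∈ F', s⁻¹ * f * s ∈ F' := fun f hf => by simpa using hn.conj_mem f hf s⁻¹
  have e1 := hg.2 f hf _ hss
  have e2 := hg.2 _ hss _ (hc _ (hc f hf))
  rw [show s * s * (s⁻¹ * (s⁻¹ * f * s) * s) = f * (s * s) by group, e1, hom_mul_apply] at e2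
  have e3 := congrArg (π s) (h1 _ (hc f hf))
  rw [map_mul, map_mul, ← hom_mul_apply π s _ x, show s * (s⁻¹ * f * s) = f * s by group,
    hom_mul_apply] at e3
  have e4 := h1 f hf
  refine mul_left_cancel₀ (hg.1 f hf) ?_
  rw [map_mul]
  linear_combination (x * π s x) * e2 + (x * g (s * s)) * e3 + g (s * s) * π f (π s x) * e4

lemma IsCross.fixed_two : π s (g (s * s)) * (x * π s x) = g (s * s) * π s (x * π s x) := by
  have e := h1 _ hss
  rw [show s⁻¹ * (s * s) * s = s * s by group, hom_mul_apply] at e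
  rw [map_mul]
  linear_combination π s x * e

lemma IsCross.sq_formula (h : F) (hh : h ∈ F') :
    g ((s * h) * (s * h)) * (x * π s x)
      = g (s * s) * ((x * π s (g h)) * π (s * h) (x * π s (g h))) := by
  have hc : ∀ f ∈ F', s⁻¹ * f * s ∈ F' := fun f hf => by simpa using hn.conj_mem f hf s⁻¹
  have e1 := hg.2 _ hss _ (mul_mem (hc h hh) hh)
  rw [show s * s * (s⁻¹ * h * s * h) = s * h * (s * h) by group, hg.2 _ (hc h hh) _ hh, map_mul,
    ← hom_mul_apply, show s * s * (s⁻¹ * h * s) = s * h * s by group, hom_mul_apply π s s,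
    hom_mul_apply π (s * h) s] at e1
  have e2 := congrArg (π s) (h1 h hh)
  rw [map_mul, map_mul, ← hom_mul_apply π s h x] at e2
  rw [map_mul]
  linear_combination (x * π s x) * e1 + x * g (s * s) * π (s * h) (π s (g h)) * e2

end A

section B
variable {k L F : Type} [Field k] [NumberField k] [Field L] [NumberField L] [Algebra k L] [Group F]
variable {π : F →* (L ≃ₐ[k] L)} {F' : Subgroup F} {g : F → L}

lemma ord_of_gPl_eq {τ : L ≃ₐ[k] L} {w : Pl L} (h : gPl τ w = w) (y : L) : ord w (τ y) = ord w y := by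
  conv_lhs => rw [← h]
  exact ord_gPl τ w y

lemma IsCross.ord_eq_zero (hg : IsCross π F' g) (hker : ∀ r ∈ π.ker, r ∈ F' → g r ^ 2 = 1)
    {ψ : F} (hψ : ψ ∈ F') {w : Pl L} (hw : gPl (π ψ) w = w) : ord w (g ψ) = 0 := by
  have hp : ∀ m : ℕ, ord w (g (ψ ^ m)) = m * ord w (g ψ) := by
    intro m
    induction m with
    | zero => simp [hg.map_one]
    | succ m ih =>
      have hm : g (ψ ^ m) ≠ 0 := hg.1 _ (pow_mem hψ m)
      rw [pow_succ', hg.2 _ hψ _ (pow_mem hψ m), ord_mul _ (hg.1 _ hψ) (by simpa using hm),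
        ord_of_gPl_eq hw, ih]
      push_cast
      ring
  have hfin : 0 < orderOf (π ψ) := orderOf_pos _
  have h1 : ψ ^ orderOf (π ψ) ∈ π.ker := by
    rw [MonoidHom.mem_ker, map_pow, pow_orderOf_eq_one]
  have h2 := congrArg (ord w) (hker _ h1 (pow_mem hψ _))
  rw [ord_pow, ord_one, hp] at h2
  have : (orderOf (π ψ) : ℤ) ≠ 0 := by exact_mod_cast hfin.ne'
  rw [Nat.cast_ofNat, mul_eq_zero, mul_eq_zero] at h2
  tauto

theorem IsCross.extend_field {K : Type} [Field K] [NumberField K] [Algebra k K] [Algebra K L]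
    [IsScalarTower k K L] [IsGalois K L] [IsTotallyReal K] {σ : K ≃ₐ[k] K} (hσ : IsConj σ)
    (hK : ∀ P : Pl K, eR k P = 1) (hL : ∀ P : Pl L, eR k P = 1)
    (hg : IsCross π F' g) (hF : F'.index = 2) {s : F} (hs : s ∉ F')
    (hσs : ∀ x : K, algebraMap K L (σ x) = π s (algebraMap K L x))
    (π' : F' →* (L ≃ₐ[K] L)) (hπ' : ∀ f x, π' f x = π f x) (hsurj : Function.Surjective π')
    (hsq : ∀ r ∈ π.ker, g r ^ 2 = 1)
    (hconj : ∀ r ∈ π.ker, ∀ f : F, g (f * r * f⁻¹) = g r) :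
    ∃ g' : F → L, IsCross π ⊤ g' ∧ ∀ f ∈ F', g' f = g f := by
  have hn : F'.Normal := Subgroup.normal_of_index_eq_two hF
  have hmul : ∀ {a b : F}, a * b ∈ F' ↔ (a ∈ F' ↔ b ∈ F') := fun {a b} =>
    Subgroup.mul_mem_iff_of_index_two hF
  have hss : s * s ∈ F' := hmul.2 Iff.rfl
  have hπK : ∀ f ∈ F', ∀ x : K, π f (algebraMap K L x) = algebraMap K L x := fun f hf x => by
    have := hπ' ⟨f, hf⟩ (algebraMap K L x)
    rw [AlgEquiv.commutes] at this
    exact this.symm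
  have hself : ∀ r ∈ π.ker, π s (g r) = g r := fun r hr => by
    rcases sq_eq_one_iff.1 (hsq r hr) with h | h <;> rw [h] <;> simp
  obtain ⟨x, hx0, h1⟩ := hg.exists_coboundary (hg.conj hn s) π' hπ' hsurj (fun r hr => by
    have hr' : s⁻¹ * r * s ∈ π.ker := by
      simpa using (MonoidHom.normal_ker π).conj_mem r hr s⁻¹
    have := hconj r hr s⁻¹
    rw [inv_inv] at this
    rw [this, hself r hr])
  have hSx0 : π s x ≠ 0 := by simpa using hx0
  have hxx : x * π s x ≠ 0 := mul_ne_zero hx0 hSx0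
  have hgss := hg.1 _ hss
  -- the quotient lies in `K` and is fixed by the conjugation
  obtain ⟨a', ha'⟩ : ∃ a' : K, algebraMap K L a' = g (s * s) / (x * π s x) := by
    have hmem : g (s * s) / (x * π s x) ∈ Set.range (algebraMap K L) := by
      rw [← IntermediateField.mem_bot, IsGalois.mem_bot_iff_fixed]
      intro γ
      obtain ⟨⟨f, hf⟩, rfl⟩ := hsurj γ
      have := hg.fixed_one hn hss h1 f hf
      rw [hπ', map_div₀, div_eq_div_iff (by simpa using hxx) hxx]
      exact this
    exact hmem
  obtain ⟨a, rfl⟩ := hσ.fixed a' ((algebraMap K L).injective (by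
    rw [hσs, ha', map_div₀, div_eq_div_iff (by simpa using hxx) hxx]
    exact hg.fixed_two hn hss h1))
  rw [← IsScalarTower.algebraMap_apply] at ha'
  have ha0 : a ≠ 0 := by
    rintro rfl
    rw [map_zero, eq_comm, div_eq_zero_iff] at ha'
    tauto
  have hpar : ∀ v, Nonsplit σ v → Even (ord v ((Units.mk0 a ha0 : kˣ) : k)) := by
    rintro v ⟨P, rfl, hP⟩
    obtain ⟨w, rfl⟩ := exists_above (K := L) P
    have hbel : below K (gPl (π s)⁻¹ w) = below K w := by
      have hσ2 : σ⁻¹ = σ := AlgEquiv.ext (hσ.symm_apply)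
      have : below K (gPl (π s)⁻¹ w) = gPl σ⁻¹ (below K w) := by
        apply below_eq_of
        intro b hb0 hb
        rw [ord_gPl'] at hb ⊢
        have e : (π s)⁻¹.symm (algebraMap K L (b : K)) = algebraMap K L (σ⁻¹.symm (b : K)) :=
          (hσs b).symm
        rw [e, ord_algebraMap, hb]
        have := eR_pos (k := K) w
        positivity
      rw [this, hσ2, hP]
    obtain ⟨γ, hγ⟩ := gPl_transitive hbel.symm
    obtain ⟨⟨h, hh⟩, rfl⟩ := hsurj γ
    have hγ' : gPl (π h) w = gPl (π s)⁻¹ w := by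
      rw [← hγ]
      exact congrArg (fun e => mapPl e w) (RingEquiv.ext fun y => (hπ' ⟨h, hh⟩ y).symm)
    have hw : gPl (π (s * h)) w = w := by
      rw [map_mul, ← gPl_gPl, hγ', gPl_gPl, mul_inv_cancel]
      exact pl_eq_of_ord fun a _ ha => by
        have := ord_gPl (1 : L ≃ₐ[k] L) w (a : L)
        rw [AlgEquiv.one_apply] at this
        omega
    have hsh : (s * h) * (s * h) ∈ F' := hmul.2 Iff.rfl
    have hz := hg.ord_eq_zero (fun r hr _ => hsq r hr) hsh (w := w) (by
      rw [map_mul, ← gPl_gPl, hw, hw])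
    have hform := hg.sq_formula hn hss h1 h hh
    have hgh : x * π s (g h) ≠ 0 := mul_ne_zero hx0 (by simpa using hg.1 h hh)
    have e := congrArg (ord w) hform
    rw [ord_mul _ (hg.1 _ hsh) hxx, ord_mul _ hgss (mul_ne_zero hgh (by simpa using hgh)),
      ord_mul _ hgh (by simpa using hgh), ord_of_gPl_eq hw, hz] at e
    have e2 := ord_algebraMap w a
    rw [ha', ord_div _ hgss hxx, hL] at e2
    refine ⟨-ord w (x * π s (g h)), ?_⟩
    simp only [Units.val_mk0]
    rw [below_below]
    push_cast at e2
    linarith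
  obtain ⟨κ, hκ⟩ := hσ.hasse hK hpar
  have hκ' := hσ.nrm_spec κ
  rw [hκ, Units.val_mk0] at hκ'
  refine hg.extend hF hs (y := x * algebraMap K L κ) (mul_ne_zero hx0 (by simp)) ?_ ?_
  · intro f hf
    rw [map_mul, hπK f hf]
    have := h1 f hf
    beta_reduce at this
    linear_combination algebraMap K L κ * this
  · rw [map_mul, ← hσs]
    have := congrArg (algebraMap K L) hκ'
    rw [← IsScalarTower.algebraMap_apply, ha', map_mul, div_eq_iff hxx] at this
    rw [this]
    ring

end B

end Tower

namespace Tower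

open NumberField IsDedekindDomain

/-- A sign character of the kernel, invariant under conjugation, extends to a crossed homomorphism
with values in a totally real unramified `2`-extension. -/
theorem exists_cross {L : Type} [Field L] [NumberField L] [IsTotallyReal L] (n : ℕ) :
    ∀ (k : Type) [Field k] [NumberField k] [Algebra k L] [IsGalois k L],
    Module.finrank k L = 2 ^ n → (∀ P : Pl L, eR k P = 1) →
    ∀ (F : Type) [Group F] (π : F →* (L ≃ₐ[k] L)), Function.Surjective π →
    ∀ l : F → ℤ, (∀ r ∈ π.ker, l r ^ 2 = 1) → (∀ r ∈ π.ker, ∀ r' ∈ π.ker, l (r * r') = l r * l r') →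
    (∀ r ∈ π.ker, ∀ f : F, l (f * r * f⁻¹) = l r) →
    ∃ g : F → L, IsCross π ⊤ g ∧ ∀ r ∈ π.ker, g r = l r := by
  induction n with
  | zero =>
    intro k _ _ _ _ hn hur F _ π hπ l h1 h2 h3
    have hc : Nat.card (L ≃ₐ[k] L) = 1 := by
      rw [IsGalois.card_aut_eq_finrank, hn, pow_zero]
    have := (Nat.card_eq_one_iff_unique.1 hc).1
    have hker : ∀ f, f ∈ π.ker := fun f => MonoidHom.mem_ker.2 (Subsingleton.elim _ _)
    refine ⟨fun f => l f, ⟨fun f _ h => ?_, fun f _ f' _ => ?_⟩, fun r _ => rfl⟩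
    · have := h1 f (hker f)
      rw [Int.cast_eq_zero.1 h] at this
      norm_num at this
    · simp [h2 f (hker f) f' (hker f')]
  | succ n ih =>
    intro k _ _ _ _ hn hur F _ π hπ l h1 h2 h3
    have hc : Nat.card (L ≃ₐ[k] L) = 2 ^ (n + 1) := by
      rw [IsGalois.card_aut_eq_finrank, hn]
    obtain ⟨H, hH⟩ := Sylow.exists_subgroup_card_pow_prime (G := L ≃ₐ[k] L) 2 (n := n)
      (by rw [hc]; exact pow_dvd_pow 2 n.le_succ)
    have hHi : H.index = 2 := by
      have := H.card_mul_index
      rw [hH, hc, pow_succ] at this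
      exact Nat.eq_of_mul_eq_mul_left (by positivity) this
    have hHn : H.Normal := Subgroup.normal_of_index_eq_two hHi
    let K := IntermediateField.fixedField H
    have hKT : IsTotallyReal K := IsTotallyReal.of_algebra K L
    have hKL : Module.finrank K L = 2 ^ n := by
      rw [IntermediateField.finrank_fixedField_eq_card, hH]
    have hKG : IsGalois K L := inferInstance
    have hKg : IsGalois k K := IsGalois.of_fixedField_normal_subgroup H
    have htow : ∀ P : Pl L, eR K P = 1 ∧ eR k (below K P) = 1 := fun P => by
      have := hur P
      rw [eR_tower (k := k) (K := K)] at this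
      exact ⟨Nat.eq_one_of_mul_eq_one_right this, Nat.eq_one_of_mul_eq_one_left this⟩
    let F' : Subgroup F := H.comap π
    have hF : F'.index = 2 := by
      rw [← hHi]; exact Subgroup.index_comap_of_surjective H hπ
    let π' : F' →* (L ≃ₐ[K] L) :=
      (IntermediateField.subgroupEquivAlgEquiv H).toMonoidHom.comp (π.subgroupComap H)
    have hπ' : ∀ f x, π' f x = π f x := fun f x => rfl
    have hsurj : Function.Surjective π' := by
      refine (IntermediateField.subgroupEquivAlgEquiv H).surjective.comp ?_
      rintro ⟨h, hh⟩
      obtain ⟨f, rfl⟩ := hπ h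
      exact ⟨⟨f, hh⟩, rfl⟩
    have hker' : ∀ r : F', r ∈ π'.ker ↔ (r : F) ∈ π.ker := by
      intro r
      rw [MonoidHom.mem_ker, MonoidHom.mem_ker]
      constructor
      · intro h
        ext x
        rw [← hπ', h]
        rfl
      · intro h
        ext x
        rw [hπ', h]
        rfl
    have hkerF : π.ker ≤ F' := fun r hr => by
      change π r ∈ H
      rw [MonoidHom.mem_ker.1 hr]
      exact one_mem H
    obtain ⟨g', hg', hgl⟩ := ih K hKL (fun P => (htow P).1) F' π' hsurj (fun f => l f)
      (fun r hr => h1 r ((hker' r).1 hr))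
      (fun r hr r' hr' => h2 r ((hker' r).1 hr) r' ((hker' r').1 hr'))
      (fun r hr f => h3 r ((hker' r).1 hr) f)
    classical
    let g : F → L := fun f => if h : f ∈ F' then g' ⟨f, h⟩ else 1
    have hgg : ∀ (f : F) (h : f ∈ F'), g f = g' ⟨f, h⟩ := fun f h => dif_pos h
    have hg : IsCross π F' g := by
      refine ⟨fun f hf => ?_, fun a ha b hb => ?_⟩
      · rw [hgg f hf]; exact hg'.1 _ trivial
      · rw [hgg a ha, hgg b hb, hgg _ (mul_mem ha hb), ← hπ' ⟨a, ha⟩, ← hg'.2 _ trivial _ trivial]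
        rfl
    have hgker : ∀ r ∈ π.ker, g r = l r := fun r hr => by
      rw [hgg r (hkerF hr), hgl _ ((hker' _).2 hr)]
    obtain ⟨s, hs⟩ : ∃ s, s ∉ F' := by
      by_contra! hall
      rw [(Subgroup.eq_top_iff' F').2 hall, Subgroup.index_top] at hF
      norm_num at hF
    let σ : K ≃ₐ[k] K := (π s).restrictNormal K
    have hσs : ∀ x : K, algebraMap K L (σ x) = π s (algebraMap K L x) :=
      fun x => AlgEquiv.restrictNormal_commutes (π s) K x
    have hπK : ∀ f ∈ F', ∀ x : K, π f (algebraMap K L x) = algebraMap K L x := fun f hf x => by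
      rw [← hπ' ⟨f, hf⟩, AlgEquiv.commutes]
    have hmul : ∀ {a b : F}, a * b ∈ F' ↔ (a ∈ F' ↔ b ∈ F') := fun {a b} =>
      Subgroup.mul_mem_iff_of_index_two hF
    have hσ : IsConj σ := by
      refine ⟨fun x => (algebraMap K L).injective ?_, fun x hx => ?_, ?_⟩
      · rw [hσs, hσs, ← hom_mul_apply, hπK _ (hmul.2 Iff.rfl)]
      · have : algebraMap K L x ∈ Set.range (algebraMap k L) := by
          rw [← IntermediateField.mem_bot, IsGalois.mem_bot_iff_fixed]
          intro γ
          obtain ⟨f, rfl⟩ := hπ γ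
          by_cases hf : f ∈ F'
          · exact hπK f hf x
          · have h4 : s⁻¹ * f ∈ F' := hmul.2 ⟨fun h => absurd (by simpa using inv_mem h) hs,
              fun h => absurd h hf⟩
            rw [show f = s * (s⁻¹ * f) by group, hom_mul_apply, hπK _ h4, ← hσs, hx]
        obtain ⟨y, hy⟩ := this
        refine ⟨y, (algebraMap K L).injective ?_⟩
        rw [← hy, ← IsScalarTower.algebraMap_apply]
      · by_contra! hall
        apply hs
        change π s ∈ H
        rw [← IntermediateField.fixingSubgroup_fixedField H, IntermediateField.mem_fixingSubgroup_iff]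
        intro x hx
        have := hσs ⟨x, hx⟩
        rw [hall] at this
        exact this.symm
    obtain ⟨G, hG, hGg⟩ := hg.extend_field hσ
      (fun P => by
        obtain ⟨Q, rfl⟩ := exists_above (K := L) P
        exact (htow Q).2) hur hF hs hσs π' hπ' hsurj
      (fun r hr => by
        rw [hgker r hr]
        exact_mod_cast congrArg (Int.cast (R := L)) (h1 r hr))
      (fun r hr f => by
        rw [hgker r hr, hgker _ ((MonoidHom.normal_ker π).conj_mem r hr f), h3 r hr f])
    exact ⟨G, hG, fun r hr => by rw [hGg r (hkerF hr), hgker r hr]⟩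

end Tower

namespace Tower

section Translations

variable {G : Type} [Group G]

/-- Left translation on `𝔽₂`-valued functions on a group. -/
def lt (g : G) : (G → ZMod 2) →ₗ[ZMod 2] (G → ZMod 2) where
  toFun f x := f (g * x)
  map_add' _ _ := rfl
  map_smul' _ _ := rfl

/-- Right translation on `𝔽₂`-valued functions on a group. -/
def rt (g : G) : (G → ZMod 2) →ₗ[ZMod 2] (G → ZMod 2) where
  toFun f x := f (x * g)
  map_add' _ _ := rfl
  map_smul' _ _ := rfl

@[simp] lemma lt_apply (g : G) (f : G → ZMod 2) (x : G) : lt g f x = f (g * x) := rfl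
@[simp] lemma rt_apply (g : G) (f : G → ZMod 2) (x : G) : rt g f x = f (x * g) := rfl

lemma rt_rt (g h : G) (f : G → ZMod 2) : rt g (rt h f) = rt (g * h) f := by
  ext x; simp [mul_assoc]

lemma lt_rt (g h : G) (f : G → ZMod 2) : lt g (rt h f) = rt h (lt g f) := by
  ext x; simp [mul_assoc]

lemma rt_one (f : G → ZMod 2) : rt 1 f = f := by ext; simp

/-- The filtration of the function space by iterated left differences. -/
def PL : ℕ → Submodule (ZMod 2) (G → ZMod 2)
  | 0 => ⊥
  | n + 1 => ⨅ g : G, (PL n).comap (lt g - LinearMap.id)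

lemma mem_PL_succ {n : ℕ} {f : G → ZMod 2} :
    f ∈ PL (n + 1) ↔ ∀ g : G, lt g f - f ∈ PL n := by
  simp [PL]

lemma mem_PL_zero {f : G → ZMod 2} : f ∈ PL 0 ↔ f = 0 := by simp [PL]

lemma rt_mem_PL {n : ℕ} : ∀ {f : G → ZMod 2} (h : G), f ∈ PL n → rt h f ∈ PL n := by
  induction n with
  | zero => intro f h hf; rw [mem_PL_zero] at hf ⊢; simp [hf]
  | succ n ih =>
    intro f h hf
    rw [mem_PL_succ] at hf ⊢
    intro g
    rw [lt_rt, ← map_sub]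
    exact ih h (hf g)

lemma lt_sub_mem_of_rt_sub_mem (n : ℕ) : ∀ {f : G → ZMod 2},
    ((∀ g, rt g f - f ∈ PL n) ↔ f ∈ PL (n + 1)) := by
  induction n using Nat.strong_induction_on with
  | _ n ih =>
  intro f
  match n, ih with
  | 0, _ =>
    rw [mem_PL_succ]
    simp only [mem_PL_zero, sub_eq_zero]
    constructor
    · intro h g; ext x
      have h1 := congrFun (h (g * x)) 1
      have h2 := congrFun (h x) 1
      simp at h1 h2 ⊢; rw [h1, h2]
    · intro h g; ext x
      have h1 := congrFun (h (x * g)) 1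
      have h2 := congrFun (h x) 1
      simp at h1 h2 ⊢; rw [h1, h2]
  | n + 1, ih =>
    constructor
    · intro hf
      rw [mem_PL_succ]
      intro h
      rw [← ih n (by omega)]
      intro g
      have := hf g
      rw [mem_PL_succ] at this
      have h1 := this h
      rw [map_sub, lt_rt] at h1
      rw [map_sub]
      convert h1 using 1
      abel
    · intro hf g
      rw [mem_PL_succ]
      intro h
      have h1 := (ih n (by omega)).2 ((mem_PL_succ.1 hf) h) g
      rw [map_sub] at h1
      rw [map_sub, lt_rt]
      convert h1 using 1
      abel

lemma rt_sub_mem_of_closure {S : Set G} (hS : Subgroup.closure S = ⊤) {n : ℕ} {f : G → ZMod 2}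
    (hf : ∀ g ∈ S, rt g f - f ∈ PL n) (g : G) : rt g f - f ∈ PL n := by
  have hg : g ∈ Subgroup.closure S := hS ▸ Subgroup.mem_top g
  induction hg using Subgroup.closure_induction with
  | mem x hx => exact hf x hx
  | one => simp [rt_one]
  | mul x y _ _ hx hy =>
    have h : rt (x * y) f - f = rt x (rt y f - f) + (rt x f - f) := by
      rw [map_sub, rt_rt]; abel
    rw [h]; exact add_mem (rt_mem_PL x hy) hx
  | inv x _ hx =>
    have h : rt x⁻¹ f - f = - rt x⁻¹ (rt x f - f) := by
      rw [map_sub, rt_rt, inv_mul_cancel, rt_one]; abel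
    rw [h]; exact neg_mem (rt_mem_PL _ hx)

lemma mem_PL_one {f : G → ZMod 2} : f ∈ PL 1 ↔ ∀ x, f x = f 1 := by
  rw [show (1 : ℕ) = 0 + 1 from rfl, mem_PL_succ]
  simp only [mem_PL_zero, sub_eq_zero]
  constructor
  · intro h x
    simpa using congrFun (h x) 1
  · intro h g; ext x; simp [h (g * x), h x]

lemma PL_mono (n : ℕ) : PL (G := G) n ≤ PL (n + 1) := by
  induction n with
  | zero => intro f hf; rw [mem_PL_zero] at hf; simp [hf]
  | succ n ih =>
    intro f hf
    rw [mem_PL_succ] at hf ⊢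
    exact fun g => ih (hf g)

end Translations

section Counting

variable {G : Type} [Group G] [Finite G] {d r : ℕ}

/-- The principal vectors `((x_i - 1) f)_i`. -/
def delta (x : Fin d → G) : (G → ZMod 2) →ₗ[ZMod 2] (Fin d → G → ZMod 2) :=
  LinearMap.pi fun i => rt (x i) - LinearMap.id

@[simp] lemma delta_apply (x : Fin d → G) (f : G → ZMod 2) (i : Fin d) :
    delta x f i = rt (x i) f - f := rfl

lemma finrank_PL_step (x : Fin d → G) (hx : Subgroup.closure (Set.range x) = ⊤)
    (hc : ∀ c : Fin d → ZMod 2, ∃ f : G → ZMod 2, ∀ i y, f (y * x i) - f y = c i)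
    (Θ : (Fin d → G → ZMod 2) →ₗ[ZMod 2] (Fin r → G → ZMod 2))
    (hΘ : ∀ v (g : G) j, Θ (fun i => lt g (v i)) j = lt g (Θ v j))
    (hker : ∀ v, Θ v = 0 ↔ v ∈ (delta x).range) (n : ℕ) :
    d * Module.finrank (ZMod 2) (PL (G := G) (n + 1)) + 1 ≤
      Module.finrank (ZMod 2) (PL (G := G) (n + 2)) +
        r * Module.finrank (ZMod 2) (PL (G := G) n) := by
  have hΘmem : ∀ n (v : Fin d → G → ZMod 2), (∀ i, v i ∈ PL (n + 1)) → ∀ j, Θ v j ∈ PL n := by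
    intro n
    induction n with
    | zero =>
      intro v hv j
      obtain ⟨f, hf⟩ := hc fun i => v i 1
      have : Θ v = 0 := by
        rw [hker]
        refine ⟨f, ?_⟩
        ext i y
        have := mem_PL_one.1 (hv i) y
        simp [hf, this]
      rw [this]; exact zero_mem _
    | succ n ih =>
      intro v hv j
      rw [mem_PL_succ]
      intro g
      have h1 := ih (fun i => lt g (v i) - v i) (fun i => mem_PL_succ.1 (hv i) g) j
      have h2 : (fun i => lt g (v i) - v i) = (fun i => lt g (v i)) - v := rfl
      rw [h2, map_sub, Pi.sub_apply, hΘ] at h1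
      exact h1
  let A : Submodule (ZMod 2) (Fin d → G → ZMod 2) := Submodule.pi Set.univ fun _ => PL (n + 1)
  let B : Submodule (ZMod 2) (Fin r → G → ZMod 2) := Submodule.pi Set.univ fun _ => PL n
  have hpi : ∀ (e m : ℕ), Module.finrank (ZMod 2)
      (Submodule.pi Set.univ fun _ : Fin e => PL (G := G) m) =
      e * Module.finrank (ZMod 2) (PL (G := G) m) := by
    intro e m
    let E : (Submodule.pi Set.univ fun _ : Fin e => PL (G := G) m) ≃ₗ[ZMod 2]
        (Fin e → PL (G := G) m) :=
      { toFun := fun v i => ⟨v.1 i, v.2 i (Set.mem_univ i)⟩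
        invFun := fun v => ⟨fun i => (v i).1, fun i _ => (v i).2⟩
        map_add' := fun _ _ => rfl
        map_smul' := fun _ _ => rfl
        left_inv := fun _ => rfl
        right_inv := fun _ => rfl }
    rw [E.finrank_eq, Module.finrank_pi_fintype]
    simp
  have hA : Module.finrank (ZMod 2) A = d * Module.finrank (ZMod 2) (PL (G := G) (n + 1)) := hpi _ _
  have hB : Module.finrank (ZMod 2) B = r * Module.finrank (ZMod 2) (PL (G := G) n) := hpi _ _
  let θ : A →ₗ[ZMod 2] B := Θ.restrict fun v hv j _ => hΘmem n v (fun i => hv i (Set.mem_univ i)) j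
  have hrank := LinearMap.finrank_range_add_finrank_ker θ
  have hr : Module.finrank (ZMod 2) θ.range ≤ Module.finrank (ZMod 2) B := Submodule.finrank_le _
  let δ : PL (G := G) (n + 2) →ₗ[ZMod 2] (Fin d → G → ZMod 2) := (delta x).domRestrict _
  have hδ := LinearMap.finrank_range_add_finrank_ker δ
  have hδker : 1 ≤ Module.finrank (ZMod 2) δ.ker := by
    rw [Nat.one_le_iff_ne_zero, ← Nat.pos_iff_ne_zero, Module.finrank_pos_iff]
    have h1 : (fun _ => 1 : G → ZMod 2) ∈ PL (G := G) (n + 2) := by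
      have : (fun _ => 1 : G → ZMod 2) ∈ PL (G := G) 1 := mem_PL_one.2 fun _ => rfl
      induction n with
      | zero => exact PL_mono _ this
      | succ n _ =>
        have hm : ∀ m, (fun _ => 1 : G → ZMod 2) ∈ PL (G := G) (m + 1) := by
          intro m
          induction m with
          | zero => exact this
          | succ m ih => exact PL_mono _ ih
        exact hm _
    refine ⟨⟨⟨⟨_, h1⟩, ?_⟩, 0, ?_⟩⟩
    · rw [LinearMap.mem_ker]; ext i y; simp [δ]
    · intro h
      have := congrArg (fun z => z.1.1 (1 : G)) h
      simp at this
  have hkerθ : Module.finrank (ZMod 2) θ.ker ≤ Module.finrank (ZMod 2) δ.range := by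
    have he : Module.finrank (ZMod 2) θ.ker = Module.finrank (ZMod 2) (θ.ker.map A.subtype) :=
      (Submodule.equivMapOfInjective A.subtype A.injective_subtype θ.ker).finrank_eq
    rw [he]
    apply Submodule.finrank_mono
    rintro _ ⟨v, hv, rfl⟩
    have hv' : Θ v = 0 := congrArg Subtype.val (LinearMap.mem_ker.1 hv)
    obtain ⟨f, hf⟩ := (hker _).1 hv'
    refine ⟨⟨f, ?_⟩, ?_⟩
    · rw [← lt_sub_mem_of_rt_sub_mem]
      apply rt_sub_mem_of_closure hx
      rintro _ ⟨i, rfl⟩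
      have := v.2 i (Set.mem_univ i)
      rw [← hf] at this
      exact this
    · exact hf
  rw [hA] at hrank
  rw [hB] at hr
  omega

lemma four_mul_gt_sq (hd : 3 ≤ d) (x : Fin d → G) (hx : Subgroup.closure (Set.range x) = ⊤)
    (hc : ∀ c : Fin d → ZMod 2, ∃ f : G → ZMod 2, ∀ i y, f (y * x i) - f y = c i)
    (Θ : (Fin d → G → ZMod 2) →ₗ[ZMod 2] (Fin r → G → ZMod 2))
    (hΘ : ∀ v (g : G) j, Θ (fun i => lt g (v i)) j = lt g (Θ v j))
    (hker : ∀ v, Θ v = 0 ↔ v ∈ (delta x).range) : d ^ 2 < 4 * r := by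
  by_contra! hcon
  set a : ℕ → ℕ := fun n => Module.finrank (ZMod 2) (PL (G := G) n) with ha
  have hstep : ∀ n, d * a (n + 1) + 1 ≤ a (n + 2) + r * a n :=
    fun n => finrank_PL_step x hx hc Θ hΘ hker n
  have ha0 : a 0 = 0 := finrank_bot (ZMod 2) (G → ZMod 2)
  have hgrow : ∀ n, d * a n ≤ 2 * a (n + 1) := by
    intro n
    induction n with
    | zero => simp [ha0]
    | succ n ih =>
      have h1 := hstep n
      have h2 : 2 * (2 * (r * a n)) ≤ 2 * (d * a (n + 1)) := by
        have : 4 * r * a n ≤ d ^ 2 * a n := Nat.mul_le_mul_right _ hcon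
        nlinarith
      change _ ≤ 2 * a (n + 2)
      linarith
  have hlin : ∀ n, n ≤ a (n + 1) := by
    intro n
    induction n with
    | zero => omega
    | succ n ih =>
      rcases Nat.eq_zero_or_pos (a (n + 1)) with h | h
      · have h1 := hstep n
        have h2 : a n = 0 := by
          have := hgrow n
          rw [h] at this
          nlinarith
        rw [h, h2] at h1
        change n + 1 ≤ a (n + 2)
        omega
      · have : d * a (n + 1) ≤ 2 * a (n + 2) := hgrow (n + 1)
        have : 3 * a (n + 1) ≤ d * a (n + 1) := Nat.mul_le_mul_right _ hd
        change n + 1 ≤ a (n + 2)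
        omega
  have hle := Submodule.finrank_le (PL (G := G) (Module.finrank (ZMod 2) (G → ZMod 2) + 2))
  have : Module.finrank (ZMod 2) (G → ZMod 2) + 1 ≤ Module.finrank (ZMod 2)
      (PL (G := G) (Module.finrank (ZMod 2) (G → ZMod 2) + 2)) :=
    hlin (Module.finrank (ZMod 2) (G → ZMod 2) + 1)
  omega

end Counting

end Tower

namespace Tower

section Generators

variable (G : Type) [Group G]

/-- The space of homomorphisms from a group to `𝔽₂`. -/
def Hm : Submodule (ZMod 2) (G → ZMod 2) where
  carrier := {f | ∀ x y, f (x * y) = f x + f y}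
  add_mem' := by
    intro f g hf hg x y
    simp only [Set.mem_ofPred_eq] at hf hg
    simp only [Pi.add_apply, hf x y, hg x y]
    ring
  zero_mem' := by simp
  smul_mem' := by
    intro c f hf x y
    simp only [Set.mem_ofPred_eq] at hf
    simp only [Pi.smul_apply, hf x y, smul_eq_mul]
    ring

variable {G}

lemma mem_Hm {f : G → ZMod 2} : f ∈ Hm G ↔ ∀ x y, f (x * y) = f x + f y := Iff.rfl

lemma Hm_map_one {f : G → ZMod 2} (hf : f ∈ Hm G) : f 1 = 0 := by
  have := hf 1 1
  simpa using this

open Classical in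
/-- The character with kernel a subgroup of index two. -/
noncomputable def chi (K : Subgroup G) : G → ZMod 2 := fun x => if x ∈ K then 0 else 1

lemma chi_mem_Hm {K : Subgroup G} (hK : K.index = 2) : chi K ∈ Hm G := by
  intro x y
  have := Subgroup.mul_mem_iff_of_index_two hK (a := x) (b := y)
  unfold chi
  by_cases hx : x ∈ K <;> by_cases hy : y ∈ K <;> simp [this, hx, hy]
  decide

variable [Finite G]

lemma exists_index_two (hG : IsPGroup 2 G) {M : Subgroup G} (hM : M ≠ ⊤) :
    ∃ K : Subgroup G, K.index = 2 ∧ M ≤ K := by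
  obtain ⟨N, hN⟩ := IsPGroup.iff_card.1 hG
  obtain ⟨n, hn⟩ := IsPGroup.iff_card.1 (hG.to_subgroup M)
  have hlt : n < N := by
    have h1 : Nat.card M < Nat.card G := by
      refine lt_of_le_of_ne (Nat.le_of_dvd Nat.card_pos M.card_subgroup_dvd_card) fun h => hM ?_
      exact Subgroup.eq_top_of_card_eq M h
    rw [hn, hN] at h1
    exact (Nat.pow_lt_pow_iff_right (by norm_num)).1 h1
  have : Fact (Nat.Prime 2) := ⟨Nat.prime_two⟩
  obtain ⟨K, hK, hle⟩ := Sylow.exists_subgroup_card_pow_prime_le (p := 2) (m := N - 1)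
    (by rw [hN]; exact pow_dvd_pow 2 (by omega)) M hn (by omega)
  refine ⟨K, ?_, hle⟩
  have := K.card_mul_index
  rw [hK, hN, show N = (N - 1) + 1 by omega, pow_succ, Nat.add_sub_cancel] at this
  exact Nat.eq_of_mul_eq_mul_left (by positivity) this

theorem exists_generators (hG : IsPGroup 2 G) {d : ℕ} (hd : Module.finrank (ZMod 2) (Hm G) = d) :
    ∃ x : Fin d → G, Subgroup.closure (Set.range x) = ⊤ ∧
      ∀ c : Fin d → ZMod 2, ∃ f ∈ Hm G, ∀ i, f (x i) = c i := by
  let ev : G → Module.Dual (ZMod 2) (Hm G) :=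
    fun g => (LinearMap.proj g).comp (Hm G).subtype
  have hev : ∀ g (f : Hm G), ev g f = f.1 g := fun _ _ => rfl
  obtain ⟨b, hb, hspan, hli⟩ := exists_linearIndependent (ZMod 2) (Set.range ev)
  have htop : Submodule.span (ZMod 2) b = ⊤ := by
    rw [hspan]
    apply Submodule.eq_top_of_finrank_eq
    have h1 := Subspace.finrank_add_finrank_dualCoannihilator_eq
      (Submodule.span (ZMod 2) (Set.range ev))
    have h2 : (Submodule.span (ZMod 2) (Set.range ev)).dualCoannihilator = ⊥ := by
      rw [eq_bot_iff]
      intro f hf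
      rw [Submodule.mem_dualCoannihilator] at hf
      refine (Submodule.mem_bot _).2 (Subtype.ext (funext fun g => ?_))
      exact hf (ev g) (Submodule.subset_span ⟨g, rfl⟩)
    rw [h2, finrank_bot, add_zero] at h1
    rw [h1, Subspace.dual_finrank_eq]
  let B := Module.Basis.mk hli (by rw [Subtype.range_coe, htop])
  have : Fintype b := FiniteDimensional.fintypeBasisIndex B
  have hcard : Fintype.card b = d := by
    rw [← hd, ← Subspace.dual_finrank_eq, Module.finrank_eq_card_basis B]
  let e : Fin d ≃ b := (Fintype.equivFinOfCardEq hcard).symm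
  choose y hy using fun z : b => hb z.2
  let x : Fin d → G := fun i => y (e i)
  have hinj : ∀ f ∈ Hm G, (∀ i, f (x i) = 0) → f = 0 := by
    intro f hf h
    have h1 : ∀ ψ ∈ Submodule.span (ZMod 2) b, ψ ⟨f, hf⟩ = 0 := by
      intro ψ hψ
      induction hψ using Submodule.span_induction with
      | mem z hz =>
        have := h (e.symm ⟨z, hz⟩)
        simp only [x, Equiv.apply_symm_apply] at this
        exact (LinearMap.congr_fun (hy ⟨z, hz⟩) ⟨f, hf⟩).symm.trans this
      | zero => simp
      | add a c _ _ ha hc => simp [ha, hc]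
      | smul a c _ hc => simp [hc]
    ext g
    exact h1 (ev g) (htop ▸ Submodule.mem_top)
  refine ⟨x, ?_, ?_⟩
  · by_contra hne
    obtain ⟨K, hK, hle⟩ := exists_index_two hG hne
    have h0 := hinj _ (chi_mem_Hm hK) fun i => by
      have : x i ∈ K := hle (Subgroup.subset_closure ⟨i, rfl⟩)
      simp [chi, this]
    have : K = ⊤ := by
      rw [eq_top_iff]
      intro g _
      have := congrFun h0 g
      by_contra hg
      simp [chi, hg] at this
    rw [this] at hK
    simp at hK
  · let E : Hm G →ₗ[ZMod 2] (Fin d → ZMod 2) :=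
      LinearMap.pi fun i => ev (x i)
    have hE : Function.Injective E := by
      rw [← LinearMap.ker_eq_bot, eq_bot_iff]
      intro f hf
      exact (Submodule.mem_bot _).2 (Subtype.ext (hinj f.1 f.2 fun i => congrFun hf i))
    have hs := (LinearMap.injective_iff_surjective_of_finrank_eq_finrank (by simp [hd])).1 hE
    intro c
    obtain ⟨f, hf⟩ := hs c
    exact ⟨f.1, f.2, fun i => congrFun hf i⟩

end Generators

section Crossed

variable {G : Type} [Group G] {d : ℕ}

/-- Right translation as an action by automorphisms. -/
def rtAut : G →* MulAut (Multiplicative (G → ZMod 2)) where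
  toFun g :=
    { toFun := fun f => Multiplicative.ofAdd (rt g f.toAdd)
      invFun := fun f => Multiplicative.ofAdd (rt g⁻¹ f.toAdd)
      left_inv := fun f => by simp [rt_rt, rt_one]
      right_inv := fun f => by simp [rt_rt, rt_one]
      map_mul' := fun _ _ => rfl }
  map_one' := by ext f; exact congrFun (rt_one f.toAdd) _
  map_mul' g h := by ext f; exact congrFun (rt_rt g h f.toAdd).symm _

/-- Crossed homomorphisms on a free group with prescribed values on the generators. -/
lemma exists_crossed (x : Fin d → G) (v : Fin d → G → ZMod 2) :
    ∃ D : FreeGroup (Fin d) → G → ZMod 2, (∀ i, D (FreeGroup.of i) = v i) ∧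
      ∀ a b, D (a * b) = D a + rt (FreeGroup.lift x a) (D b) := by
  let φ : FreeGroup (Fin d) →* Multiplicative (G → ZMod 2) ⋊[rtAut] G :=
    FreeGroup.lift fun i => ⟨Multiplicative.ofAdd (v i), x i⟩
  have hr : ∀ a, (φ a).right = FreeGroup.lift x a := by
    intro a
    have : SemidirectProduct.rightHom.comp φ = FreeGroup.lift x := by
      ext i; simp [φ]
    exact DFunLike.congr_fun this a
  refine ⟨fun a => (φ a).left.toAdd, fun i => by simp [φ], fun a b => ?_⟩
  change Multiplicative.toAdd (φ (a * b)).left = _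
  rw [map_mul, SemidirectProduct.mul_left, hr]
  rfl

lemma crossed_one {F : Type} [Group F] {π : F →* G} {D : F → G → ZMod 2}
    (hD : ∀ a b, D (a * b) = D a + rt (π a) (D b)) : D 1 = 0 := by
  have := hD 1 1
  rw [mul_one, map_one, rt_one] at this
  simpa using this

lemma crossed_inv {F : Type} [Group F] {π : F →* G} {D : F → G → ZMod 2}
    (hD : ∀ a b, D (a * b) = D a + rt (π a) (D b)) (a : F) :
    D a⁻¹ = - rt (π a⁻¹) (D a) := by
  have := hD a⁻¹ a
  rw [inv_mul_cancel, crossed_one hD] at this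
  exact eq_neg_of_add_eq_zero_left this.symm

lemma crossed_ext {π : FreeGroup (Fin d) →* G} {D D' : FreeGroup (Fin d) → G → ZMod 2}
    (hD : ∀ a b, D (a * b) = D a + rt (π a) (D b))
    (hD' : ∀ a b, D' (a * b) = D' a + rt (π a) (D' b))
    (h : ∀ i, D (FreeGroup.of i) = D' (FreeGroup.of i)) (a : FreeGroup (Fin d)) : D a = D' a := by
  induction a using FreeGroup.induction_on with
  | C1 => rw [crossed_one hD, crossed_one hD']
  | of i => exact h i
  | inv_of i _ => rw [crossed_inv hD, crossed_inv hD', h]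
  | mul a b ha hb => rw [hD, hD', ha, hb]

lemma crossed_principal {F : Type} [Group F] (π : F →* G) (f : G → ZMod 2) (a b : F) :
    rt (π (a * b)) f - f = (rt (π a) f - f) + rt (π a) (rt (π b) f - f) := by
  rw [map_sub, rt_rt, map_mul]; abel

/-- A crossed homomorphism vanishing on the kernel is principal. -/
lemma crossed_eq_principal {F : Type} [Group F] {π : F →* G} (hπ : Function.Surjective π)
    {D : F → G → ZMod 2} (hD : ∀ a b, D (a * b) = D a + rt (π a) (D b))
    (h0 : ∀ ρ ∈ π.ker, D ρ = 0) : ∃ f, ∀ a, D a = rt (π a) f - f := by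
  choose s hs using hπ
  have hfac : ∀ a b, π a = π b → D a = D b := by
    intro a b hab
    have h1 : a⁻¹ * b ∈ π.ker := by rw [MonoidHom.mem_ker]; simp [hab]
    have h2 := hD a (a⁻¹ * b)
    rw [h0 _ h1, map_zero, add_zero, mul_inv_cancel_left] at h2
    exact h2.symm
  refine ⟨fun g => D (s g) 1, fun a => ?_⟩
  ext g
  have h1 : D (s (g * π a)) = D (s g * a) := hfac _ _ (by simp [hs])
  have h2 := congrFun (hD (s g) a) 1
  simp only [Pi.add_apply, rt_apply, one_mul, hs] at h2
  simp only [Pi.sub_apply, rt_apply, h1, h2]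
  ring

end Crossed

end Tower

namespace Tower

section Golod

variable {G : Type} [Group G] {d : ℕ}

/-- Componentwise left translation. -/
def ltv (g : G) : (Fin d → G → ZMod 2) →ₗ[ZMod 2] (Fin d → G → ZMod 2) :=
  LinearMap.pi fun i => (lt g).comp (LinearMap.proj i)

lemma ltv_delta (x : Fin d → G) (g : G) (f : G → ZMod 2) :
    ltv g (delta x f) = delta x (lt g f) := by
  funext i
  change lt g (rt (x i) f - f) = rt (x i) (lt g f) - lt g f
  rw [map_sub, lt_rt]

/-- Left translation on the quotient by the principal vectors. -/
def ltq (x : Fin d → G) (g : G) : ((Fin d → G → ZMod 2) ⧸ (delta x).range) →ₗ[ZMod 2]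
    ((Fin d → G → ZMod 2) ⧸ (delta x).range) :=
  Submodule.mapQ _ _ (ltv g) (by
    rintro _ ⟨f, rfl⟩
    exact ⟨lt g f, (ltv_delta x g f).symm⟩)

lemma ltq_mk (x : Fin d → G) (g : G) (v : Fin d → G → ZMod 2) :
    ltq x g (Submodule.Quotient.mk v) = Submodule.Quotient.mk (ltv g v) := rfl

lemma ltq_one (x : Fin d → G) (q) : ltq x 1 q = q := by
  induction q using Submodule.Quotient.induction_on with
  | _ v => rw [ltq_mk]; congr 1; ext i y; simp [ltv]

lemma ltq_ltq (x : Fin d → G) (g h : G) (q) : ltq x g (ltq x h q) = ltq x (h * g) q := by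
  induction q using Submodule.Quotient.induction_on with
  | _ v => rw [ltq_mk, ltq_mk, ltq_mk]; congr 1; ext i y; simp [ltv, mul_assoc]

/-- The translation-invariant classes. -/
def Wq (x : Fin d → G) : Submodule (ZMod 2) ((Fin d → G → ZMod 2) ⧸ (delta x).range) :=
  ⨅ g : G, (ltq x g - LinearMap.id).ker

lemma mem_Wq {x : Fin d → G} {q} : q ∈ Wq x ↔ ∀ g, ltq x g q = q := by
  simp [Wq, sub_eq_zero]

variable [Finite G]

lemma invariant_eq_bot (hG : IsPGroup 2 G) (x : Fin d → G)
    (K : Submodule (ZMod 2) ((Fin d → G → ZMod 2) ⧸ (delta x).range))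
    (hK : ∀ g, ∀ q ∈ K, ltq x g q ∈ K) (h0 : ∀ q ∈ K, q ∈ Wq x → q = 0) : K = ⊥ := by
  have : Fact (Nat.Prime 2) := ⟨Nat.prime_two⟩
  let _ : MulAction G K :=
    { smul := fun g q => ⟨ltq x g⁻¹ q.1, hK _ _ q.2⟩
      one_smul := fun q => Subtype.ext (by
        change ltq x 1⁻¹ q.1 = q.1
        rw [inv_one, ltq_one])
      mul_smul := fun g h q => Subtype.ext (by
        change ltq x (g * h)⁻¹ q.1 = ltq x g⁻¹ (ltq x h⁻¹ q.1)
        rw [ltq_ltq, mul_inv_rev]) }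
  have hsm : ∀ (g : G) (q : K), ((g • q : K) : _ ⧸ _) = ltq x g⁻¹ q.1 := fun _ _ => rfl
  have hfin : Finite K := Module.finite_of_finite (ZMod 2)
  have h1 := hG.card_modEq_card_fixedPoints K
  have h2 : MulAction.fixedPoints G K = {0} := by
    ext q
    rw [MulAction.mem_fixedPoints, Set.mem_singleton_iff]
    constructor
    · intro h
      refine Subtype.ext (h0 q.1 q.2 (mem_Wq.2 fun g => ?_))
      have := congrArg Subtype.val (h g⁻¹)
      rwa [hsm, inv_inv] at this
    · rintro rfl g
      refine Subtype.ext ?_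
      rw [hsm]
      simp
  rw [h2] at h1
  have h3 : Nat.card K = 2 ^ Module.finrank (ZMod 2) K := by
    have := Module.natCard_eq_pow_finrank (K := ZMod 2) (V := K)
    rwa [Nat.card_zmod] at this
  rw [h3] at h1
  rw [← Submodule.finrank_eq_zero]
  by_contra hne
  have : 2 ∣ 2 ^ Module.finrank (ZMod 2) K := dvd_pow_self 2 hne
  rw [Nat.card_unique, Nat.ModEq] at h1
  omega

theorem golod_shafarevich (hG : IsPGroup 2 G) (hd3 : 3 ≤ d)
    (hd : Module.finrank (ZMod 2) (Hm G) = d) :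
    ∃ π : FreeGroup (Fin d) →* G, Function.Surjective π ∧
      (∀ ε : FreeGroup (Fin d) → ZMod 2, (∀ a b, ε (a * b) = ε a + ε b) →
        ∀ ρ ∈ π.ker, ε ρ = 0) ∧
      ∃ (r : ℕ) (Λ : Type) (lam : Λ → FreeGroup (Fin d) → ZMod 2),
        Nat.card Λ = 2 ^ r ∧ d ^ 2 < 4 * r ∧
        (∀ q, ∀ ρ ∈ π.ker, ∀ ρ' ∈ π.ker, lam q (ρ * ρ') = lam q ρ + lam q ρ') ∧
        (∀ q, ∀ ρ ∈ π.ker, ∀ a, lam q (a * ρ * a⁻¹) = lam q ρ) ∧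
        ∀ q q', (∀ ρ ∈ π.ker, lam q ρ = lam q' ρ) → q = q' := by
  obtain ⟨x, hx, hc⟩ := exists_generators hG hd
  have hfin : Finite ((Fin d → G → ZMod 2) ⧸ (delta x).range) :=
    Module.finite_of_finite (ZMod 2)
  obtain ⟨ℓ, hℓ⟩ := LinearMap.exists_leftInverse_of_injective (Wq x).subtype
    (Submodule.ker_subtype _)
  have hℓ' : ∀ q (hq : q ∈ Wq x), ℓ q = ⟨q, hq⟩ := fun q hq => LinearMap.congr_fun hℓ ⟨q, hq⟩
  set r := Module.finrank (ZMod 2) (Wq x) with hr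
  let e : Wq x ≃ₗ[ZMod 2] (Fin r → ZMod 2) := LinearEquiv.ofFinrankEq _ _ (by simp [hr])
  let Θ : (Fin d → G → ZMod 2) →ₗ[ZMod 2] (Fin r → G → ZMod 2) :=
    LinearMap.pi fun j => LinearMap.pi fun g =>
      (LinearMap.proj j).comp ((e.toLinearMap.comp ℓ).comp
        ((Submodule.mkQ _).comp (ltv g)))
  have hΘa : ∀ v j g, Θ v j g = e (ℓ (ltq x g (Submodule.Quotient.mk v))) j := fun _ _ _ => rfl
  have h4 : d ^ 2 < 4 * r := by
    refine four_mul_gt_sq hd3 x hx ?_ Θ ?_ ?_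
    · intro c
      obtain ⟨f, hf, hfc⟩ := hc c
      refine ⟨f, fun i y => ?_⟩
      rw [mem_Hm.1 hf, hfc]; ring
    · intro v g j
      ext h
      rw [lt_apply, hΘa, hΘa, ← ltq_ltq, ltq_mk x g]
      rfl
    · intro v
      constructor
      · intro hv
        let K : Submodule (ZMod 2) ((Fin d → G → ZMod 2) ⧸ (delta x).range) :=
          ⨅ g : G, (ℓ.comp (ltq x g)).ker
        have hmem : ∀ q, q ∈ K ↔ ∀ g, ℓ (ltq x g q) = 0 := by simp [K]
        have hK : K = ⊥ := by
          apply invariant_eq_bot hG x K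
          · intro g q hq
            rw [hmem] at hq ⊢
            intro h
            rw [ltq_ltq]; exact hq _
          · intro q hq hqW
            have := (hmem q).1 hq 1
            rw [ltq_one, hℓ' q hqW] at this
            exact congrArg Subtype.val this
        have : (Submodule.Quotient.mk v : _ ⧸ (delta x).range) ∈ K := by
          rw [hmem]
          intro g
          apply e.injective
          rw [map_zero]
          ext j
          rw [← hΘa, hv]; rfl
        rw [hK, Submodule.mem_bot] at this
        exact (Submodule.Quotient.mk_eq_zero _).1 this
      · rintro hv
        ext j g
        rw [hΘa, (Submodule.Quotient.mk_eq_zero _).2 hv]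
        simp
  let π := FreeGroup.lift x
  have hπ : Function.Surjective π := by
    rw [← MonoidHom.range_eq_top, FreeGroup.range_lift_eq_closure, hx]
  choose D hDof hD using fun q : Wq x => exists_crossed x (Quotient.out q.1)
  have hout : ∀ q : Wq x, Submodule.Quotient.mk (Quotient.out q.1) = q.1 :=
    fun q => Quotient.out_eq _
  have hconst : ∀ (q : Wq x), ∀ ρ ∈ π.ker, ∀ g, D q ρ g = D q ρ 1 := by
    intro q ρ hρ g
    have h1 : Submodule.Quotient.mk (ltv g (Quotient.out q.1)) =
        (Submodule.Quotient.mk (Quotient.out q.1) : _ ⧸ (delta x).range) := by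
      rw [← ltq_mk, hout]
      exact mem_Wq.1 q.2 g
    rw [Submodule.Quotient.eq] at h1
    obtain ⟨f, hf⟩ := h1
    have h2 := crossed_ext (π := π) (D := fun a => lt g (D q a))
      (D' := fun a => D q a + (rt (π a) f - f))
      (fun a b => by
        rw [hD, map_add, lt_rt])
      (fun a b => by
        rw [hD, crossed_principal, map_add]
        change _ + rt (π a) _ + _ = _
        abel)
      (fun i => by
        have := congrFun hf i
        rw [delta_apply] at this
        simp only [π, FreeGroup.lift_apply_of, this, hDof]
        simp [ltv]) ρ
    have h3 := congrFun h2 1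
    rw [MonoidHom.mem_ker.1 hρ, rt_one, sub_self] at h3
    simpa using h3
  refine ⟨π, hπ, ?_, r, Wq x, fun q a => D q a 1, ?_, h4, ?_, ?_, ?_⟩
  · intro ε hε ρ hρ
    obtain ⟨f, hf, hfc⟩ := hc fun i => ε (FreeGroup.of i)
    have h1 : ε 1 = 0 := by simpa using hε 1 1
    have key : ∀ a, ε a = f (π a) := by
      intro a
      induction a using FreeGroup.induction_on with
      | C1 => rw [h1, map_one, Hm_map_one hf]
      | of i => simp [π, hfc]
      | inv_of i h =>
        have e1 := hε (FreeGroup.of i) (FreeGroup.of i)⁻¹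
        have e2 := hf (π (FreeGroup.of i)) (π (FreeGroup.of i))⁻¹
        rw [mul_inv_cancel, h1] at e1
        rw [mul_inv_cancel, Hm_map_one hf] at e2
        rw [map_inv]
        rw [h] at e1
        exact add_left_cancel (e1.symm.trans e2)
      | mul a b ha hb => rw [hε, ha, hb, map_mul, hf]
    rw [key, MonoidHom.mem_ker.1 hρ, Hm_map_one hf]
  · have := Module.natCard_eq_pow_finrank (K := ZMod 2) (V := Wq x)
    rwa [Nat.card_zmod] at this
  · intro q ρ hρ ρ' _
    change D q (ρ * ρ') 1 = _
    rw [hD]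
    have : FreeGroup.lift x ρ = 1 := hρ
    rw [this, rt_one]; rfl
  · intro q ρ hρ a
    change D q (a * ρ * a⁻¹) 1 = D q ρ 1
    have h1 : π (a * ρ * a⁻¹) = 1 := by
      rw [map_mul, map_mul, MonoidHom.mem_ker.1 hρ, map_inv]; group
    have h2 := hD q (a * ρ * a⁻¹) a
    rw [inv_mul_cancel_right, hD] at h2
    change _ = _ + rt (π _) _ at h2
    rw [h1, rt_one] at h2
    have h3 := congrFun h2 1
    simp only [Pi.add_apply, rt_apply, hconst q ρ hρ] at h3
    rw [add_comm] at h3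
    exact (add_right_cancel h3).symm
  · intro q q' h
    obtain ⟨f, hf⟩ := crossed_eq_principal hπ (D := fun a => D q a - D q' a)
      (fun a b => by
        rw [hD, hD, map_sub]
        change _ = _ - _ + (rt (FreeGroup.lift x a) _ - rt (FreeGroup.lift x a) _)
        abel)
      (fun ρ hρ => by
        ext g
        have : D q ρ 1 = D q' ρ 1 := h ρ hρ
        simp only [Pi.sub_apply, Pi.zero_apply]
        rw [hconst q ρ hρ, hconst q' ρ hρ, this, sub_self])
    apply Subtype.ext
    rw [← hout q, ← hout q', Submodule.Quotient.eq]
    refine ⟨f, ?_⟩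
    ext i : 1
    have := hf (FreeGroup.of i)
    simp only [hDof] at this
    rw [Pi.sub_apply, this]
    simp [π]

end Golod

end Tower

namespace Tower

open NumberField IsDedekindDomain

section Lift

variable {L M F : Type} [Field L] [NumberField L] [Field M] [NumberField M] [Algebra L M] [Field F]
  {τ : M ≃ₐ[L] M} (hτ : IsConj τ)

include hτ

/-- Extending a homomorphism to a quadratic extension by a choice of square root. -/
lemma IsConj.exists_lift {s : M} (hs0 : s ≠ 0) (hs : τ s = -s) {α : L}
    (hα : s ^ 2 = algebraMap L M α) (f : L →+* F) {t : F} (ht : t ^ 2 = f α) :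
    ∃ φ : M →+* F, φ.comp (algebraMap L M) = f ∧ φ s = t := by
  have hne : τ s ≠ s := by
    rw [hs]
    intro h
    exact hs0 (self_eq_neg.1 h.symm)
  have huniq : ∀ y z y' z' : L, algebraMap L M y + algebraMap L M z * s =
      algebraMap L M y' + algebraMap L M z' * s → y = y' ∧ z = z' := by
    intro y z y' z' h
    have h2 := congrArg τ h
    simp only [map_add, map_mul, AlgEquiv.commutes, hs] at h2
    have h3 : algebraMap L M y = algebraMap L M y' := by
      have : (2 : M) * algebraMap L M y = 2 * algebraMap L M y' := by linear_combination h + h2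
      exact mul_left_cancel₀ two_ne_zero this
    have h4 : algebraMap L M z = algebraMap L M z' := by
      rw [h3] at h
      exact mul_right_cancel₀ hs0 (add_left_cancel h)
    exact ⟨(algebraMap L M).injective h3, (algebraMap L M).injective h4⟩
  choose a b hab using hτ.exists_decomp hne
  have ha : ∀ y z, a (algebraMap L M y + algebraMap L M z * s) = y ∧
      b (algebraMap L M y + algebraMap L M z * s) = z := fun y z =>
    let h := huniq _ _ _ _ (hab (algebraMap L M y + algebraMap L M z * s))
    ⟨h.1.symm, h.2.symm⟩
  have key : ∀ u y z, u = algebraMap L M y + algebraMap L M z * s → a u = y ∧ b u = z := by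
    rintro u y z rfl
    exact ha y z
  have hbase : ∀ y, a (algebraMap L M y) = y ∧ b (algebraMap L M y) = 0 :=
    fun y => key _ y 0 (by simp)
  refine ⟨{ toFun := fun u => f (a u) + f (b u) * t
            map_one' := ?_, map_mul' := ?_, map_zero' := ?_, map_add' := ?_ }, ?_, ?_⟩
  · obtain ⟨h1, h2⟩ := key 1 1 0 (by simp)
    simp [h1, h2]
  · intro u v
    obtain ⟨h1, h2⟩ := key (u * v) (a u * a v + b u * b v * α) (a u * b v + b u * a v) (by
      conv_lhs => rw [hab u, hab v]
      simp only [map_add, map_mul]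
      rw [← hα]; ring)
    rw [h1, h2]
    simp only [map_add, map_mul]
    rw [← ht]; ring
  · obtain ⟨h1, h2⟩ := key 0 0 0 (by simp)
    simp [h1, h2]
  · intro u v
    obtain ⟨h1, h2⟩ := key (u + v) (a u + a v) (b u + b v) (by
      conv_lhs => rw [hab u, hab v]
      simp only [map_add]; ring)
    rw [h1, h2]
    simp only [map_add]; ring
  · ext y
    obtain ⟨h1, h2⟩ := hbase y
    simp [h1, h2]
  · obtain ⟨h1, h2⟩ := key s 0 1 (by simp)
    simp [h1, h2]

end Lift

section Padic

variable {K : Type} [Field K] [NumberField K] {ℓ : ℕ} [Fact ℓ.Prime]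

/-- The place `P` is induced by the `ℓ`-adic embedding `φ`. -/
def Ind (φ : K →+* ℚ_[ℓ]) (P : Pl K) : Prop := ∀ a : 𝓞 K, a ∈ P.asIdeal ↔ ‖φ a‖ < 1

lemma norm_int_le_one (φ : K →+* ℚ_[ℓ]) (a : 𝓞 K) : ‖φ a‖ ≤ 1 := by
  have h1 : IsIntegral ℤ (φ a) := a.2.map φ.toIntAlgHom
  have h2 : IsIntegral ℤ_[ℓ] (φ a) := h1.tower_top
  obtain ⟨y, hy⟩ := IsIntegrallyClosed.isIntegral_iff.1 h2
  rw [← hy]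
  exact y.2

/-- An `ℓ`-adic embedding as a map on integers. -/
noncomputable def intMap (φ : K →+* ℚ_[ℓ]) : 𝓞 K →+* ℤ_[ℓ] :=
  (φ.comp (algebraMap (𝓞 K) K)).codRestrict (PadicInt.subring ℓ) fun a => norm_int_le_one φ a

lemma exists_ind (φ : K →+* ℚ_[ℓ]) : ∃ P : Pl K, Ind φ P ∧ ord P (ℓ : K) = 1 := by
  let I : Ideal (𝓞 K) := (IsLocalRing.maximalIdeal ℤ_[ℓ]).comap (intMap φ)
  have hmem : ∀ a : 𝓞 K, a ∈ I ↔ ‖φ a‖ < 1 := by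
    intro a
    rw [Ideal.mem_comap, IsLocalRing.mem_maximalIdeal, PadicInt.mem_nonunits]
    rfl
  have hI : I.IsPrime := Ideal.IsPrime.comap _
  have hℓ0 : (ℓ : 𝓞 K) ≠ 0 := by exact_mod_cast (Fact.out : ℓ.Prime).ne_zero
  have hℓI : (ℓ : 𝓞 K) ∈ I := by
    rw [hmem]
    simp only [map_natCast]
    exact Padic.norm_p_lt_one
  have hI0 : I ≠ ⊥ := fun h => hℓ0 (by rwa [h, Ideal.mem_bot] at hℓI)
  refine ⟨⟨I, hI, hI0⟩, hmem, ?_⟩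
  set P : Pl K := ⟨I, hI, hI0⟩
  have hℓ0' : (ℓ : K) ≠ 0 := by exact_mod_cast (Fact.out : ℓ.Prime).ne_zero
  have hco : ((ℓ : 𝓞 K) : K) = (ℓ : K) := by simp
  have h1 : 1 ≤ ord P (ℓ : K) := by
    rw [← vge_iff hℓ0', ← hco]
    exact (vge_int_iff P _ 1).2 (by rwa [pow_one])
  have h2 : ¬ 2 ≤ ord P (ℓ : K) := by
    rw [← vge_iff hℓ0', ← hco]
    intro h
    have h3 := (vge_int_iff P _ 2).1 h
    have h4 : I ^ 2 ≤ ((IsLocalRing.maximalIdeal ℤ_[ℓ]) ^ 2).comap (intMap φ) :=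
      Ideal.le_comap_pow _ 2
    have h5 := h4 h3
    rw [Ideal.mem_comap, map_natCast, PadicInt.maximalIdeal_eq_span_p,
      Ideal.span_singleton_pow, Ideal.mem_span_singleton] at h5
    obtain ⟨c, hc⟩ := h5
    have h6 : (ℓ : ℤ_[ℓ]) * c = 1 := by
      have : (ℓ : ℤ_[ℓ]) ≠ 0 := by exact_mod_cast (Fact.out : ℓ.Prime).ne_zero
      apply mul_left_cancel₀ this
      rw [mul_one]
      linear_combination -hc
    have h7 : IsUnit (ℓ : ℤ_[ℓ]) := IsUnit.of_mul_eq_one c h6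
    exact PadicInt.p_nonunit h7
  omega

lemma Ind.eq {φ : K →+* ℚ_[ℓ]} {P Q : Pl K} (hP : Ind φ P) (hQ : Ind φ Q) : P = Q :=
  HeightOneSpectrum.ext (Ideal.ext fun a => (hP a).trans (hQ a).symm)

lemma Ind.below {k : Type} [Field k] [NumberField k] [Algebra k K] {φ : K →+* ℚ_[ℓ]} {P : Pl K}
    (hP : Ind φ P) : Ind (φ.comp (algebraMap k K)) (below k P) := by
  intro a
  have h1 : a ∈ (Tower.below k P).asIdeal ↔ algebraMap (𝓞 k) (𝓞 K) a ∈ P.asIdeal := by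
    rw [(below_liesOver (k := k) P).over, Ideal.under_def, Ideal.mem_comap]
  rw [h1, hP]
  rfl

lemma exists_ind_unramified (k : Type) [Field k] [NumberField k] [Algebra k K]
    (φ : K →+* ℚ_[ℓ]) : ∃ P : Pl K, Ind φ P ∧ eR k P = 1 := by
  obtain ⟨P, hP, h1⟩ := exists_ind φ
  refine ⟨P, hP, ?_⟩
  rw [← map_natCast (algebraMap k K), ord_algebraMap] at h1
  have := Int.eq_one_or_neg_one_of_mul_eq_one h1
  omega

end Padic

end Tower

namespace Tower

open NumberField IsDedekindDomain

/-- Every homomorphism of the base field into `F` extends. -/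
def Extends (k L F : Type) [Field k] [Field L] [Algebra k L] [Field F] : Prop :=
  ∀ ψ : k →+* F, ∃ φ : L →+* F, φ.comp (algebraMap k L) = ψ

/-- Galois extensions of `2`-power degree, unramified, in which all real, dyadic and `p`-adic
places split completely. -/
structure Adm (p : ℕ) [Fact p.Prime] (k L : Type) [Field k] [NumberField k] [Field L]
    [NumberField L] [Algebra k L] : Prop where
  gal : IsGalois k L
  deg : ∃ n, Module.finrank k L = 2 ^ n
  unr : ∀ P : Pl L, eR k P = 1
  real : Extends k L ℝ
  two : Extends k L ℚ_[2]
  padic : Extends k L ℚ_[p]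

/-- Dyadic places of `k` come from embeddings into `ℚ₂`. -/
def Dyadic (k : Type) [Field k] [NumberField k] : Prop :=
  ∀ v : Pl k, ord v 2 ≠ 0 → ∃ ψ : k →+* ℚ_[2], Ind ψ v

section Step

variable {p : ℕ} [Fact p.Prime] {k L : Type} [Field k] [NumberField k] [Field L] [NumberField L]
  [Algebra k L]

lemma Adm.totallyReal (h : Adm p k L) [IsTotallyReal k] : IsTotallyReal L := by
  have := h.gal
  rw [isTotallyReal_iff]
  intro w
  rw [← InfinitePlace.mk_embedding w, InfinitePlace.isReal_mk_iff]
  have hr : ComplexEmbedding.IsReal (w.embedding.comp (algebraMap k L)) :=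
    IsTotallyReal.complexEmbedding_isReal _
  obtain ⟨φ, hφ⟩ := h.real hr.embedding
  let φC : L →+* ℂ := Complex.ofRealHom.comp φ
  have h1 : φC.comp (algebraMap k L) = w.embedding.comp (algebraMap k L) := by
    ext x
    have := congrArg (fun f : k →+* ℝ => ((f x : ℝ) : ℂ)) hφ
    simp only [RingHom.comp_apply] at this
    rw [ComplexEmbedding.IsReal.coe_embedding_apply] at this
    exact this
  obtain ⟨σ, hσ⟩ := ComplexEmbedding.exists_comp_symm_eq_of_comp_eq (k := k) φC w.embedding h1
  rw [← hσ]
  rw [ComplexEmbedding.isReal_iff]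
  ext x
  simp [φC, ComplexEmbedding.conjugate_coe_eq]

lemma Adm.step (h : Adm p k L) (h2 : Dyadic k) {α : L}
    (hσ : ∀ σ : L ≃ₐ[k] L, ∃ y : L, σ α = y ^ 2 * α) (hord : ∀ P : Pl L, Even (ord P α))
    (hreal : ∀ ψ : k →+* ℝ, ∃ φ : L →+* ℝ, φ.comp (algebraMap k L) = ψ ∧ IsSquare (φ α))
    (htwo : ∀ ψ : k →+* ℚ_[2], ∃ φ : L →+* ℚ_[2], φ.comp (algebraMap k L) = ψ ∧ IsSquare (φ α))
    (hp : ∀ ψ : k →+* ℚ_[p], ∃ φ : L →+* ℚ_[p], φ.comp (algebraMap k L) = ψ ∧ IsSquare (φ α))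
    (hns : ¬ IsSquare α) :
    ∃ (M : Type) (_ : Field M) (_ : NumberField M) (_ : Algebra k M),
      Adm p k M ∧ Module.finrank k M = 2 * Module.finrank k L := by
  have := h.gal
  obtain ⟨M, _, _, _, τ, s, hτ, hs2, hs⟩ := exists_quad hns
  have hs0 : s ≠ 0 := by
    rintro rfl
    apply hns
    have : algebraMap L M α = 0 := by rw [← hs2]; simp
    rw [(map_eq_zero _).1 this]
    exact IsSquare.zero
  let _ : Algebra k M := ((algebraMap L M).comp (algebraMap k L)).toAlgebra
  have : IsScalarTower k L M := IsScalarTower.of_algebraMap_eq fun _ => rfl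
  have hfin : Module.finrank k M = 2 * Module.finrank k L := by
    rw [← Module.finrank_mul_finrank k L M, hτ.finrank_eq_two, mul_comm]
  have hlift : ∀ {F : Type} [Field F] (f : L →+* F), IsSquare (f α) →
      ∃ φ : M →+* F, φ.comp (algebraMap L M) = f := by
    intro F _ f hf
    obtain ⟨t, ht⟩ := hf
    obtain ⟨φ, hφ, _⟩ := hτ.exists_lift hs0 hs hs2 f (t := t) (by rw [ht]; ring)
    exact ⟨φ, hφ⟩
  have hext : ∀ {F : Type} [Field F],
      (∀ ψ : k →+* F, ∃ φ : L →+* F, φ.comp (algebraMap k L) = ψ ∧ IsSquare (φ α)) →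
      Extends k M F := by
    intro F _ H ψ
    obtain ⟨φ, hφ, hsq⟩ := H ψ
    obtain ⟨φ', hφ'⟩ := hlift φ hsq
    refine ⟨φ', ?_⟩
    rw [IsScalarTower.algebraMap_eq k L M, ← RingHom.comp_assoc, hφ', hφ]
  have hgal : IsGalois k M := by
    apply IsGalois.of_fixedField_eq_bot
    rw [eq_bot_iff]
    intro x hx
    rw [IntermediateField.mem_fixedField_iff] at hx
    have h1 := hx (τ.restrictScalars k) trivial
    obtain ⟨y, rfl⟩ := hτ.fixed x h1
    have h3 : y ∈ (⊥ : IntermediateField k L) := by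
      rw [IsGalois.mem_bot_iff_fixed]
      intro σ
      obtain ⟨w, hw⟩ := hσ σ
      obtain ⟨φ, hφ⟩ := hlift ((algebraMap L M).comp σ.toRingEquiv.toRingHom) (by
        refine ⟨algebraMap L M w * s, ?_⟩
        have : (algebraMap L M).comp σ.toRingEquiv.toRingHom α = algebraMap L M (σ α) := rfl
        rw [this, hw, map_mul, map_pow, ← hs2]; ring)
      have hφ' : ∀ z, φ (algebraMap L M z) = algebraMap L M (σ z) :=
        fun z => RingHom.congr_fun hφ z
      let Φ : M →ₐ[k] M := ⟨φ, fun c => by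
        change φ (algebraMap k M c) = _
        rw [IsScalarTower.algebraMap_apply k L M, hφ', AlgEquiv.commutes]⟩
      let Ψ : M ≃ₐ[k] M := AlgEquiv.ofBijective Φ Φ.bijective
      have h4 := hx Ψ trivial
      have h5 : Ψ (algebraMap L M y) = algebraMap L M (σ y) := hφ' y
      rw [h5] at h4
      exact (algebraMap L M).injective h4
    obtain ⟨c, hc⟩ := IntermediateField.mem_bot.1 h3
    exact IntermediateField.mem_bot.2 ⟨c, by rw [← hc]; rfl⟩
  refine ⟨M, inferInstance, inferInstance, inferInstance, ⟨hgal, ?_, ?_, hext hreal, hext htwo,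
    hext hp⟩, hfin⟩
  · obtain ⟨n, hn⟩ := h.deg
    exact ⟨n + 1, by rw [hfin, hn, pow_succ, mul_comm]⟩
  · intro P
    by_cases hP2 : ord (below L P) 2 = 0
    · rw [eR_tower (K := L), h.unr, mul_one]
      exact hτ.eR_eq_one_of_sqrt hs0 hs hs2.symm (hord _) hP2
    · have hv : ord (below k P) 2 ≠ 0 := by
        intro h0
        apply hP2
        have := ord_algebraMap (k := k) (below L P) 2
        rw [below_below, h0, mul_zero] at this
        rwa [map_ofNat] at this
      obtain ⟨ψ, hψ⟩ := h2 _ hv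
      obtain ⟨φ, hφ⟩ := hext htwo ψ
      obtain ⟨Q, hQ, hQ1⟩ := exists_ind_unramified k φ
      have h3 : below k Q = below k P := by
        have := hQ.below (k := k)
        rw [hφ] at this
        exact this.eq hψ
      obtain ⟨σ, rfl⟩ := gPl_transitive (k := k) h3
      rw [eR_gPl, hQ1]

end Step

end Tower

namespace Tower

/-- The square classes of `F` are separated by a function with at most sixteen values. -/
def SqB (F : Type) [Field F] : Prop :=
  ∃ c : F → Fin 16, ∀ x y : F, x ≠ 0 → y ≠ 0 → c x = c y → IsSquare (x * y)

lemma sqB_real : SqB ℝ := by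
  refine ⟨fun x => if 0 < x then 0 else 1, fun x y hx hy h => ?_⟩
  rw [Real.isSquare_iff]
  rcases lt_or_gt_of_ne hx with h1 | h1 <;> rcases lt_or_gt_of_ne hy with h2 | h2
  · exact (mul_pos_of_neg_of_neg h1 h2).le
  · simp [h2, h1.not_gt] at h
  · simp [h1, h2.not_gt] at h
  · exact (mul_pos h1 h2).le

variable {ℓ : ℕ} [Fact ℓ.Prime]

lemma isSquare_of_near {x a : ℤ_[ℓ]} (h : ‖a ^ 2 - x‖ < ‖2 * a‖ ^ 2) : IsSquare x := by
  have hn : ‖(Polynomial.X ^ 2 - Polynomial.C x : Polynomial ℤ_[ℓ]).aeval a‖ <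
      ‖(Polynomial.X ^ 2 - Polynomial.C x : Polynomial ℤ_[ℓ]).derivative.aeval a‖ ^ 2 := by
    simpa [one_add_one_eq_two] using h
  obtain ⟨z, hz, _⟩ := hensels_lemma hn
  refine ⟨z, ?_⟩
  simp only [map_sub, map_pow, Polynomial.aeval_X, Polynomial.aeval_C, Algebra.algebraMap_self,
    RingHom.id_apply] at hz
  linear_combination -hz

lemma isSquare_of_one_mod_eight {x : ℤ_[2]} (h : (8 : ℤ_[2]) ∣ x - 1) : IsSquare x := by
  apply isSquare_of_near (a := 1)
  obtain ⟨c, hc⟩ := h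
  have h2 : ‖(2 : ℤ_[2])‖ = 2⁻¹ := by
    have := PadicInt.norm_p (p := 2)
    simpa using this
  have h8 : (8 : ℤ_[2]) = 2 ^ 3 := by norm_num
  have h1 : ‖(1 : ℤ_[2]) ^ 2 - x‖ ≤ 8⁻¹ := by
    rw [one_pow, norm_sub_rev, hc, norm_mul, h8, norm_pow, h2]
    have := PadicInt.norm_le_one c
    norm_num
    linarith
  rw [mul_one, h2]
  refine h1.trans_lt ?_
  norm_num

lemma isSquare_of_mod {x a : ℤ_[ℓ]} (hℓ : ℓ ≠ 2) (ha : ‖a‖ = 1) (h : (ℓ : ℤ_[ℓ]) ∣ a ^ 2 - x) :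
    IsSquare x := by
  apply isSquare_of_near (a := a)
  have h2 : ‖(2 : ℤ_[ℓ])‖ = 1 := by
    rw [← PadicInt.isUnit_iff]
    by_contra hu
    have h1 : (2 : ℤ_[ℓ]) ∈ nonunits ℤ_[ℓ] := hu
    rw [PadicInt.mem_nonunits] at h1
    have h3 : ‖((2 : ℤ) : ℤ_[ℓ])‖ < 1 := by simpa using h1
    rw [PadicInt.norm_intCast_lt_one_iff] at h3
    have h4 : ℓ ∣ 2 := by exact_mod_cast h3
    exact hℓ ((Nat.prime_dvd_prime_iff_eq Fact.out Nat.prime_two).1 h4)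
  rw [norm_mul, h2, ha]
  simp only [mul_one, one_pow]
  obtain ⟨c, hc⟩ := h
  rw [hc, norm_mul]
  have := PadicInt.norm_le_one c
  have h5 : ‖(ℓ : ℤ_[ℓ])‖ < 1 := by
    rw [PadicInt.norm_p]
    exact inv_lt_one_of_one_lt₀ (by exact_mod_cast (Fact.out : ℓ.Prime).one_lt)
  nlinarith [norm_nonneg (ℓ : ℤ_[ℓ])]

lemma exists_unit_class : ∃ c : ℤ_[ℓ] → Fin 8, ∀ x y : ℤ_[ℓ], ‖x‖ = 1 → ‖y‖ = 1 → c x = c y →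
    IsSquare (x * y) := by
  by_cases hℓ : ℓ = 2
  · subst hℓ
    refine ⟨fun x => (PadicInt.toZModPow 3 x : ZMod 8), fun x y hx hy h => ?_⟩
    apply isSquare_of_one_mod_eight
    have h' : PadicInt.toZModPow 3 x = PadicInt.toZModPow 3 y := h
    have h1 : IsUnit (PadicInt.toZModPow 3 x) := (PadicInt.isUnit_iff.2 hx).map _
    have hdec : ∀ z : ZMod (2 ^ 3), IsUnit z → z * z = 1 := by decide
    have h3 : PadicInt.toZModPow 3 (x * y - 1) = 0 := by
      rw [map_sub, map_mul, ← h', hdec _ h1, map_one, sub_self]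
    rw [← RingHom.mem_ker, PadicInt.ker_toZModPow, Ideal.mem_span_singleton] at h3
    norm_num at h3
    exact h3
  · classical
    refine ⟨fun x => if IsSquare (PadicInt.toZMod x) then 0 else 1, fun x y hx hy h => ?_⟩
    have hx0 : PadicInt.toZMod x ≠ 0 := ((PadicInt.isUnit_iff.2 hx).map _).ne_zero
    have hy0 : PadicInt.toZMod y ≠ 0 := ((PadicInt.isUnit_iff.2 hy).map _).ne_zero
    have hsq : IsSquare (PadicInt.toZMod x * PadicInt.toZMod y) := by
      by_cases h1 : IsSquare (PadicInt.toZMod x) <;> by_cases h2 : IsSquare (PadicInt.toZMod y)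
      · exact h1.mul h2
      · simp [h1, h2] at h
      · simp [h1, h2] at h
      · have hc : ringChar (ZMod ℓ) ≠ 2 := by rwa [ZMod.ringChar_zmod_n]
        rw [← quadraticChar_one_iff_isSquare (mul_ne_zero hx0 hy0), map_mul,
          quadraticChar_neg_one_iff_not_isSquare.2 h1, quadraticChar_neg_one_iff_not_isSquare.2 h2]
        norm_num
    obtain ⟨b, hb⟩ := hsq
    obtain ⟨a, rfl⟩ := ZMod.ringHom_surjective (PadicInt.toZMod (p := ℓ)) b
    have hmem : ∀ z : ℤ_[ℓ], PadicInt.toZMod z = 0 ↔ z ∈ IsLocalRing.maximalIdeal ℤ_[ℓ] := by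
      intro z
      rw [← PadicInt.ker_toZMod, RingHom.mem_ker]
    apply isSquare_of_mod hℓ (a := a)
    · rw [← PadicInt.isUnit_iff]
      by_contra hu
      have := (hmem a).2 ((IsLocalRing.mem_maximalIdeal a).2 hu)
      rw [this, mul_zero] at hb
      exact mul_ne_zero hx0 hy0 hb
    · rw [← Ideal.mem_span_singleton, ← PadicInt.maximalIdeal_eq_span_p, ← hmem]
      rw [map_sub, map_pow, map_mul, hb]; ring

lemma sqB_padic : SqB ℚ_[ℓ] := by
  obtain ⟨c, hc⟩ := exists_unit_class (ℓ := ℓ)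
  have hℓ0 : (ℓ : ℚ_[ℓ]) ≠ 0 := by exact_mod_cast (Fact.out : ℓ.Prime).ne_zero
  have hu : ∀ x : ℚ_[ℓ], ∃ u : ℤ_[ℓ], x ≠ 0 → ‖u‖ = 1 ∧ x = ℓ ^ x.valuation * u := by
    intro x
    by_cases hx : x = 0
    · exact ⟨0, fun h => absurd hx h⟩
    · have h1 : ‖x * (ℓ : ℚ_[ℓ]) ^ (-x.valuation)‖ = 1 := by
        rw [norm_mul, Padic.norm_eq_zpow_neg_valuation hx, norm_zpow, Padic.norm_p, inv_zpow,
          ← zpow_neg, neg_neg, ← zpow_add₀ (by exact_mod_cast (Fact.out : ℓ.Prime).ne_zero)]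
        simp
      refine ⟨⟨_, h1.le⟩, fun _ => ⟨h1, ?_⟩⟩
      change x = ℓ ^ x.valuation * (x * (ℓ : ℚ_[ℓ]) ^ (-x.valuation))
      rw [zpow_neg]
      field_simp
  choose u hu using hu
  classical
  let e : Fin 2 × Fin 8 ≃ Fin 16 := finProdFinEquiv
  refine ⟨fun x => e (if Even x.valuation then 0 else 1, c (u x)), fun x y hx hy h => ?_⟩
  have h1 := e.injective h
  simp only [Prod.mk.injEq] at h1
  obtain ⟨h1, h2⟩ := h1
  obtain ⟨hx1, hx2⟩ := hu x hx
  obtain ⟨hy1, hy2⟩ := hu y hy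
  obtain ⟨z, hz⟩ := hc _ _ hx1 hy1 h2
  have hev : Even (x.valuation + y.valuation) := by
    rw [Int.even_add]
    by_cases ha : Even x.valuation <;> by_cases hb : Even y.valuation <;>
      simp [ha, hb] at h1 ⊢
  obtain ⟨m, hm⟩ := hev
  refine ⟨ℓ ^ m * z, ?_⟩
  have hz' : (u x : ℚ_[ℓ]) * u y = z * z := by
    exact_mod_cast congrArg (fun t : ℤ_[ℓ] => (t : ℚ_[ℓ])) hz
  calc x * y = (ℓ ^ x.valuation * ℓ ^ y.valuation) * ((u x : ℚ_[ℓ]) * u y) := by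
        conv_lhs => rw [hx2, hy2]
        ring
    _ = _ := by
        rw [← zpow_add₀ hℓ0, hm, zpow_add₀ hℓ0, hz']; ring

end Tower

namespace Tower

open NumberField IsDedekindDomain

/-- Parities of finitely supported divisors of `k` fall, modulo principal divisors, into at most
`N` classes. -/
def ClB (k : Type) [Field k] [NumberField k] (N : ℕ) : Prop :=
  ∃ κ : (Pl k → ℤ) → Fin N, ∀ m m' : Pl k → ℤ, {v | m v ≠ 0}.Finite → {v | m' v ≠ 0}.Finite →
    κ m = κ m' → ∃ c : k, c ≠ 0 ∧ ∀ v, Even (ord v c + m v + m' v)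

variable {k L : Type} [Field k] [NumberField k] [Field L] [NumberField L] [Algebra k L]

lemma IsCross.mul_eq_one {F : Type*} [Group F] {π : F →* (L ≃ₐ[k] L)} {g g' : F → L}
    (hg : IsCross π ⊤ g) (hg' : IsCross π ⊤ g') {α α' z : L} {c : k}
    (hα : ∀ f, π f α = g f ^ 2 * α) (hα' : ∀ f, π f α' = g' f ^ 2 * α') (hz : z ≠ 0)
    (h : algebraMap k L c * α * α' = z ^ 2)
    (hε : ∀ ε : F → ZMod 2, (∀ a b, ε (a * b) = ε a + ε b) → ∀ ρ ∈ π.ker, ε ρ = 0)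
    {ρ : F} (hρ : ρ ∈ π.ker) : g ρ * g' ρ = 1 := by
  classical
  have hπz : ∀ f, π f z ≠ 0 := fun f => by simpa using hz
  let H : F → L := fun f => g f * g' f * z / π f z
  have hH : ∀ f, H f * π f z = g f * g' f * z := fun f => by
    simp only [H]; field_simp [hπz f]
  have hsq : ∀ f, H f = 1 ∨ H f = -1 := by
    intro f
    rw [← sq_eq_one_iff]
    have h1 : (π f z) ^ 2 = (g f * g' f * z) ^ 2 := by
      rw [← map_pow, ← h, map_mul, map_mul, AlgEquiv.commutes, hα, hα', mul_pow _ z, ← h]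
      ring
    have h2 : (H f) ^ 2 * (π f z) ^ 2 = (π f z) ^ 2 := by rw [← mul_pow, hH, h1]
    exact mul_right_cancel₀ (pow_ne_zero 2 (hπz f)) (by rw [h2, one_mul])
  have hfix : ∀ f f', π f (H f') = H f' := by
    intro f f'
    rcases hsq f' with h | h <;> simp [h]
  have hmul : ∀ a b, H (a * b) = H a * H b := by
    intro a b
    apply mul_right_cancel₀ (hπz (a * b))
    rw [hH, hg.2 _ trivial _ trivial, hg'.2 _ trivial _ trivial, map_mul, AlgEquiv.mul_apply]
    have h1 := congrArg (π a) (hH b)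
    rw [map_mul, hfix, map_mul, map_mul] at h1
    calc _ = (g a * g' a * z) * (π a (g b) * π a (g' b)) := by ring
      _ = H a * (π a (g b) * π a (g' b) * π a z) := by rw [← hH]; ring
      _ = _ := by rw [← h1]; ring
  have h2 : (2 : L) ≠ 0 := two_ne_zero
  have hne : (-1 : L) ≠ 1 := fun h => h2 (by linear_combination -h)
  have hadd : ∀ a b, (if H (a * b) = 1 then (0 : ZMod 2) else 1) =
      (if H a = 1 then 0 else 1) + (if H b = 1 then 0 else 1) := by
    intro a b
    rw [hmul]
    rcases hsq a with ha | ha <;> rcases hsq b with hb | hb <;> simp [ha, hb, hne]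
    decide
  have h3 := hε (fun f => if H f = 1 then 0 else 1) hadd ρ hρ
  have h4 : H ρ = 1 := by
    by_contra h
    simp [h] at h3
  have h5 := hH ρ
  rw [h4, MonoidHom.mem_ker.1 hρ, one_mul, AlgEquiv.one_apply] at h5
  exact mul_right_cancel₀ hz (by rw [one_mul, ← h5])

lemma even_of_even_class (hgal : IsGalois k L) {α : L} (hα0 : α ≠ 0)
    (hα : ∀ σ : L ≃ₐ[k] L, ∃ y : L, σ α = y ^ 2 * α) :
    ∃ m : Pl k → ℤ, {v | m v ≠ 0}.Finite ∧ ∀ P : Pl L, Even (ord P α + m (below k P)) := by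
  choose A hA using exists_above (k := k) (K := L)
  refine ⟨fun v => ord (A v) α, ?_, fun P => ?_⟩
  · refine ((finite_ord_ne_zero α).image (below k)).subset ?_
    intro v hv
    exact ⟨A v, hv, hA v⟩
  · obtain ⟨σ, hσ⟩ := gPl_transitive (k := k) (P := P) (Q := A (below k P)) (hA _).symm
    obtain ⟨y, hy⟩ := hα σ.symm
    have hy0 : y ≠ 0 := by
      rintro rfl
      simp [hα0] at hy
    change Even (ord P α + ord (A (below k P)) α)
    rw [← hσ, ord_gPl', hy, ord_mul _ (pow_ne_zero 2 hy0) hα0, ord_pow]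
    exact ⟨ord P y + ord P α, by push_cast; ring⟩

lemma card_hom_le (hk : Module.finrank ℚ k = 2) (F : Type) [Field F] [CharZero F] :
    Finite (k →+* F) ∧ Nat.card ((k →+* F) → Fin 16) ≤ 16 ^ 2 := by
  have h1 : Nat.card (k →+* F) ≤ 2 := by
    rw [← hk, ← NumberField.Embeddings.card k (AlgebraicClosure F), ← Nat.card_eq_fintype_card]
    refine Nat.card_le_card_of_injective (fun f => (algebraMap F (AlgebraicClosure F)).comp f) ?_
    intro f f' h
    ext x
    exact (algebraMap F (AlgebraicClosure F)).injective (congrFun (congrArg DFunLike.coe h) x)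
  refine ⟨inferInstance, ?_⟩
  rw [Nat.card_fun, Nat.card_fin]
  exact Nat.pow_le_pow_right (by norm_num) h1

variable {p : ℕ} [Fact p.Prime]

theorem exists_rank_bound [IsTotallyReal k] (h : Adm p k L) (h2 : Dyadic k)
    (hk : Module.finrank ℚ k = 2) {N : ℕ} (hN : ClB k N)
    (hmax : ∀ (M : Type) [Field M] [NumberField M] [Algebra k M], Adm p k M →
      Module.finrank k M ≠ 2 * Module.finrank k L) {d : ℕ} (hd3 : 3 ≤ d)
    (hd : Module.finrank (ZMod 2) (Hm (L ≃ₐ[k] L)) = d) :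
    ∃ r, d ^ 2 < 4 * r ∧ 2 ^ r ≤ N * 16 ^ 6 := by
  classical
  have hgal := h.gal
  have hreal := h.totallyReal
  obtain ⟨n, hn⟩ := h.deg
  have hG : IsPGroup 2 (L ≃ₐ[k] L) := IsPGroup.of_card (n := n) (by
    rw [IsGalois.card_aut_eq_finrank, hn])
  obtain ⟨π, hπ, hε, r, Λ, lam, hcard, hr, hadd, hconj, hinj⟩ := golod_shafarevich hG hd3 hd
  refine ⟨r, hr, ?_⟩
  let l : Λ → FreeGroup (Fin d) → ℤ := fun q f => if lam q f = 0 then 1 else -1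
  have hz2 : ∀ a : ZMod 2, a = 0 ∨ a = 1 := by decide
  have hcr : ∀ q, ∃ g : FreeGroup (Fin d) → L, IsCross π ⊤ g ∧ ∀ r ∈ π.ker, g r = l q r := by
    intro q
    refine exists_cross n k hn h.unr _ π hπ (l q) ?_ ?_ ?_
    · intro r _
      simp only [l]
      split_ifs <;> norm_num
    · intro r hr r' hr'
      simp only [l]
      rw [hadd q r hr r' hr']
      rcases hz2 (lam q r) with h1 | h1 <;> rcases hz2 (lam q r') with h2 | h2 <;> simp [h1, h2]
      decide
    · intro r hr f
      simp only [l]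
      rw [hconj q r hr f]
  choose g hg hgl using hcr
  have hα : ∀ q, ∃ α : L, α ≠ 0 ∧ ∀ f, π f α = g q f ^ 2 * α := by
    intro q
    have hc1 : IsCross π ⊤ (fun _ => (1 : L)) := ⟨fun _ _ => one_ne_zero, fun _ _ _ _ => by simp⟩
    have hc2 : IsCross π ⊤ (fun f => g q f ^ 2) :=
      ⟨fun f hf => pow_ne_zero 2 ((hg q).1 f hf), fun a ha b hb => by
        simp only [(hg q).2 a ha b hb]
        rw [map_pow]; ring⟩
    obtain ⟨x, hx0, hx⟩ := hc1.exists_coboundary hc2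
      (π.comp (⊤ : Subgroup (FreeGroup (Fin d))).subtype) (fun _ _ => rfl)
      (fun σ => by obtain ⟨f, hf⟩ := hπ σ; exact ⟨⟨f, trivial⟩, hf⟩) (fun ρ hρ => by
        simp only [hgl q ρ hρ, l]
        split_ifs <;> norm_num)
    exact ⟨x, hx0, fun f => by rw [hx f trivial, one_mul]⟩
  choose α hα0 hα using hα
  have hασ : ∀ q, ∀ σ : L ≃ₐ[k] L, ∃ y : L, σ (α q) = y ^ 2 * α q := by
    intro q σ
    obtain ⟨f, rfl⟩ := hπ σ
    exact ⟨_, hα q f⟩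
  choose m hm hmα using fun q => even_of_even_class hgal (hα0 q) (hασ q)
  obtain ⟨κ, hκ⟩ := hN
  have hrep : ∃ ref : Fin N → Pl k → ℤ, ∀ q, ∃ c : k, c ≠ 0 ∧
      ∀ v, Even (ord v c + m q v + ref (κ (m q)) v) := by
    refine ⟨fun j => if hj : ∃ q, κ (m q) = j then m hj.choose else 0, fun q => ?_⟩
    have hj : ∃ q', κ (m q') = κ (m q) := ⟨q, rfl⟩
    simp only [dif_pos hj]
    exact hκ _ _ (hm q) (hm _) hj.choose_spec.symm
  obtain ⟨ref, href⟩ := hrep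
  choose c hc0 hc using href
  let β : Λ → L := fun q => algebraMap k L (c q) * α q
  have hβ0 : ∀ q, β q ≠ 0 := fun q => mul_ne_zero (by simpa using hc0 q) (hα0 q)
  choose φR hφR using h.real
  choose φ2 hφ2 using h.two
  choose φp hφp using h.padic
  obtain ⟨cR, hcR⟩ := sqB_real
  obtain ⟨c2, hc2⟩ := sqB_padic (ℓ := 2)
  obtain ⟨cp, hcp⟩ := sqB_padic (ℓ := p)
  obtain ⟨hfR, hbR⟩ := card_hom_le hk ℝ
  obtain ⟨hf2, hb2⟩ := card_hom_le hk ℚ_[2]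
  obtain ⟨hfp, hbp⟩ := card_hom_le hk ℚ_[p]
  let B : Λ → Fin N × ((k →+* ℝ) → Fin 16) × ((k →+* ℚ_[2]) → Fin 16) × ((k →+* ℚ_[p]) → Fin 16) :=
    fun q => (κ (m q), fun ψ => cR (φR ψ (β q)), fun ψ => c2 (φ2 ψ (β q)),
      fun ψ => cp (φp ψ (β q)))
  have hB : Function.Injective B := by
    intro q q' hqq
    simp only [B, Prod.mk.injEq] at hqq
    obtain ⟨h1, hR', h2', hp'⟩ := hqq
    have hsq : IsSquare (β q * β q') := by
      by_contra hns
      have hstep := h.step h2 (α := β q * β q') ?_ ?_ ?_ ?_ ?_ hns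
      · obtain ⟨M, _, _, _, hM, hM'⟩ := hstep
        exact hmax M hM hM'
      · intro σ
        obtain ⟨y, hy⟩ := hασ q σ
        obtain ⟨y', hy'⟩ := hασ q' σ
        refine ⟨y * y', ?_⟩
        simp only [β, map_mul, AlgEquiv.commutes, hy, hy']
        ring
      · intro P
        have hP : ∀ q, Even (ord P (β q) + ref (κ (m q)) (below k P)) := by
          intro q
          have e1 := hc q (below k P)
          have e2 := hmα q P
          simp only [β]
          rw [ord_mul _ (by simpa using hc0 q) (hα0 q), ord_algebraMap, h.unr P, Nat.cast_one,
            one_mul]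
          have := e1.add e2
          obtain ⟨t, ht⟩ := this
          exact ⟨t - m q (below k P), by linarith⟩
        have e1 := hP q
        have e2 := hP q'
        rw [← h1] at e2
        rw [ord_mul _ (hβ0 q) (hβ0 q')]
        obtain ⟨t, ht⟩ := e1.add e2
        exact ⟨t - ref (κ (m q)) (below k P), by linarith⟩
      · intro ψ
        refine ⟨φR ψ, hφR ψ, ?_⟩
        rw [map_mul]
        exact hcR _ _ (by simpa using hβ0 q) (by simpa using hβ0 q') (congrFun hR' ψ)
      · intro ψ
        refine ⟨φ2 ψ, hφ2 ψ, ?_⟩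
        rw [map_mul]
        exact hc2 _ _ (by simpa using hβ0 q) (by simpa using hβ0 q') (congrFun h2' ψ)
      · intro ψ
        refine ⟨φp ψ, hφp ψ, ?_⟩
        rw [map_mul]
        exact hcp _ _ (by simpa using hβ0 q) (by simpa using hβ0 q') (congrFun hp' ψ)
    obtain ⟨z, hz⟩ := hsq
    have hz0 : z ≠ 0 := by
      rintro rfl
      exact mul_ne_zero (hβ0 q) (hβ0 q') (by simpa using hz)
    apply hinj
    intro ρ hρ
    have h3 := (hg q).mul_eq_one (hg q') (hα q) (hα q') hz0 (c := c q * c q') (by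
      rw [map_mul, sq, ← hz]; ring) hε hρ
    rw [hgl q ρ hρ, hgl q' ρ hρ] at h3
    have h4 : l q ρ * l q' ρ = 1 := by exact_mod_cast h3
    simp only [l] at h4
    rcases hz2 (lam q ρ) with h5 | h5 <;> rcases hz2 (lam q' ρ) with h6 | h6 <;>
      simp [h5, h6] at h4 ⊢
  have h3 := Nat.card_le_card_of_injective B hB
  rw [hcard, Nat.card_prod, Nat.card_prod, Nat.card_prod, Nat.card_fin] at h3
  refine h3.trans (Nat.mul_le_mul_left _ ?_)
  calc _ ≤ 16 ^ 2 * (16 ^ 2 * 16 ^ 2) := Nat.mul_le_mul hbR (Nat.mul_le_mul hb2 hbp)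
    _ = 16 ^ 6 := by norm_num

end Tower

namespace Tower

open NumberField IsDedekindDomain

section

variable {k : Type} [Field k] [NumberField k]

lemma mk_eq_of_ord {I J : (FractionalIdeal (nonZeroDivisors (𝓞 k)) k)ˣ} {c : k} (hc0 : c ≠ 0)
    (hc : ∀ v : Pl k, ord v c = FractionalIdeal.count k v (I : FractionalIdeal _ k)
        - FractionalIdeal.count k v (J : FractionalIdeal _ k)) :
    ClassGroup.mk (K := k) I = ClassGroup.mk (K := k) J := by
  have hs0 : FractionalIdeal.spanSingleton (nonZeroDivisors (𝓞 k)) c ≠ 0 := by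
    simpa [FractionalIdeal.spanSingleton_ne_zero_iff] using hc0
  have h1 : (I : FractionalIdeal (nonZeroDivisors (𝓞 k)) k)
      = FractionalIdeal.spanSingleton (nonZeroDivisors (𝓞 k)) c * J := by
    rw [← FractionalIdeal.finprod_heightOneSpectrum_factorization' k (I.ne_zero),
      ← FractionalIdeal.finprod_heightOneSpectrum_factorization' k (mul_ne_zero hs0 J.ne_zero)]
    apply finprod_congr
    intro v
    rw [FractionalIdeal.count_mul _ _ hs0 (Units.ne_zero _), ord_count hc0, hc, sub_add_cancel]
  have h2 : ClassGroup.mk (K := k) (I / J) = 1 := by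
    rw [ClassGroup.mk_eq_one_iff, FractionalIdeal.isPrincipal_iff]
    refine ⟨c, ?_⟩
    rw [Units.val_div_eq_div_val, h1, mul_div_assoc, div_self (Units.ne_zero _), mul_one]
  rwa [map_div, div_eq_one] at h2

lemma exists_mk_eq (c : ClassGroup (𝓞 k)) : ∃ I : (FractionalIdeal (nonZeroDivisors (𝓞 k)) k)ˣ,
    ClassGroup.mk (K := k) I = c := by
  obtain ⟨I, hI⟩ := ClassGroup.mk0_surjective c
  exact ⟨FractionalIdeal.mk0 k I, by rw [ClassGroup.mk_mk0, hI]⟩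

lemma clB_of_card {N : ℕ} (h : Nat.card {c : ClassGroup (𝓞 k) // c ^ 2 = 1} ≤ N) : ClB k N := by
  classical
  rw [← sqs_index_finite] at h
  let e : ClassGroup (𝓞 k) ⧸ sqs (ClassGroup (𝓞 k)) ≃ Fin (sqs (ClassGroup (𝓞 k))).index :=
    Finite.equivFin _
  refine ⟨fun m => if hm : {v | m v ≠ 0}.Finite then
    Fin.castLE h (e (ClassGroup.mk (K := k) (exists_fracIdeal m hm).choose)) else
    Fin.castLE h (e 1), ?_⟩
  intro m m' hm hm' hmm
  simp only [dif_pos hm, dif_pos hm'] at hmm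
  have h1 := (exists_fracIdeal m hm).choose_spec
  have h2 := (exists_fracIdeal m' hm').choose_spec
  set I := (exists_fracIdeal m hm).choose
  set J := (exists_fracIdeal m' hm').choose
  have h3 := e.injective (Fin.castLE_injective h hmm)
  rw [QuotientGroup.eq, mem_sqs] at h3
  obtain ⟨c, hc⟩ := h3
  obtain ⟨A, rfl⟩ := exists_mk_eq c
  have h4 : ClassGroup.mk (K := k) J = ClassGroup.mk (K := k) (I * A ^ 2) := by
    rw [map_mul, map_pow, hc, mul_inv_cancel_left]
  obtain ⟨x, hx0, hx⟩ := exists_of_mk_eq h4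
  refine ⟨x, hx0, fun v => ?_⟩
  rw [hx, h2, Units.val_mul, Units.val_pow_eq_pow_val,
    FractionalIdeal.count_mul _ _ (Units.ne_zero _) (pow_ne_zero 2 (Units.ne_zero _)),
    FractionalIdeal.count_pow, h1]
  exact ⟨m' v - FractionalIdeal.count k v (A : FractionalIdeal (nonZeroDivisors (𝓞 k)) k), by
    push_cast; ring⟩

end

lemma isSquare_rat {x : ℚ} (hx : 0 < x) (h : ∀ v : Pl ℚ, Even (ord v x)) : IsSquare x := by
  have hPID : IsPrincipalIdealRing (𝓞 ℚ) :=
    IsPrincipalIdealRing.of_surjective (Rat.ringOfIntegersEquiv.symm : ℤ →+* 𝓞 ℚ)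
      Rat.ringOfIntegersEquiv.symm.surjective
  choose m hm using h
  obtain ⟨I, hI⟩ := exists_fracIdeal m ((finite_ord_ne_zero x).subset fun v hv => by
    simp only [Set.mem_ofPred_eq] at hv ⊢
    rw [hm]; omega)
  obtain ⟨c, hc0, hc⟩ := exists_of_mk_eq (I := I) (J := 1) (Subsingleton.elim _ _)
  have hc' : ∀ v, ord v c = m v := fun v => by
    rw [hc, hI, Units.val_one, FractionalIdeal.count_one, sub_zero]
  obtain ⟨u, hu⟩ := exists_unit_of_ord (x := x / c ^ 2) (div_ne_zero hx.ne' (pow_ne_zero 2 hc0))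
    (fun v => by
      rw [ord_div v hx.ne' (pow_ne_zero 2 hc0), ord_pow, hc', hm]
      push_cast; ring)
  have hpos : 0 < algebraMap (𝓞 ℚ) ℚ u := by
    have : 0 < x / c ^ 2 := by positivity
    rw [← hu] at this
    exact this
  replace hu : algebraMap (𝓞 ℚ) ℚ u = x / c ^ 2 := hu
  have h1 : (u : 𝓞 ℚ) = 1 := by
    rcases Int.units_eq_one_or (Units.map (Rat.ringOfIntegersEquiv : 𝓞 ℚ →* ℤ) u) with h | h
    · have := congrArg (fun t : ℤˣ => (t : ℤ)) h
      simpa using this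
    · have := congrArg (fun t : ℤˣ => (t : ℤ)) h
      have h2 : Rat.ringOfIntegersEquiv (u : 𝓞 ℚ) = -1 := by simpa using this
      have h3 := Rat.ringOfIntegersEquiv_apply_coe (u : 𝓞 ℚ)
      rw [← h3, h2] at hpos
      norm_num at hpos
  rw [h1, map_one] at hu
  refine ⟨c, ?_⟩
  field_simp at hu
  rw [← sq]; exact hu.symm

variable {k : Type} [Field k] [NumberField k]

lemma IsConj.exists_rat {σ : k ≃ₐ[ℚ] k} (hσ : IsConj σ) {α : k} (hα : α ≠ 0)
    (hev : ∀ P : Pl k, Even (ord P α)) {n : ℚ} (hn : 0 < n) (hnα : algebraMap ℚ k n = α * σ α) :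
    ∃ (q : ℚ) (z : k), q ≠ 0 ∧ z ≠ 0 ∧ α = algebraMap ℚ k q * z ^ 2 := by
  have hn2 : IsSquare n := by
    refine isSquare_rat hn fun v => ?_
    obtain ⟨P, rfl⟩ := exists_above (k := ℚ) (K := k) v
    have h1 : (eR ℚ P : ℤ) * ord (below ℚ P) n = ord P α + ord P (σ α) := by
      rw [← ord_algebraMap, hnα, ord_mul _ hα (by simpa using hα)]
    by_cases he : eR ℚ P = 1
    · rw [he, Nat.cast_one, one_mul] at h1
      rw [h1]
      refine (hev P).add ?_
      have : ord P (σ α) = ord (gPl σ P) α := by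
        rw [ord_gPl', hσ.symm_apply]
      rw [this]
      exact hev _
    · obtain ⟨h2, hg⟩ := hσ.eR_eq_two he
      rw [h2, hσ.ord_conj hg] at h1
      have : ord (below ℚ P) n = ord P α := by push_cast at h1; omega
      rw [this]
      exact hev P
  obtain ⟨r, rfl⟩ := hn2
  have hr0 : r ≠ 0 := by rintro rfl; simp at hn
  have hr0' : algebraMap ℚ k r ≠ 0 := by simpa using hr0
  have hu : (α / algebraMap ℚ k r) * σ (α / algebraMap ℚ k r) = 1 := by
    rw [map_div₀, AlgEquiv.commutes, div_mul_div_comm, ← hnα, map_mul]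
    exact div_self (mul_ne_zero hr0' hr0')
  obtain ⟨θ, hθ0, hθ⟩ := hσ.hilbert90 hu
  have hσθ : σ θ ≠ 0 := by simpa using hθ0
  obtain ⟨t, ht⟩ := hσ.norm_mem θ
  have ht0 : t ≠ 0 := by
    rintro rfl
    rw [map_zero] at ht
    exact mul_ne_zero hθ0 hσθ ht.symm
  refine ⟨r / t, θ, div_ne_zero hr0 ht0, hθ0, ?_⟩
  rw [map_div₀, ht]
  field_simp at hθ ⊢
  linear_combination hθ

/-- Ambient bound for the two-torsion of the class group of a quadratic field. -/
lemma IsConj.card_two_torsion {σ : k ≃ₐ[ℚ] k} (hσ : IsConj σ) (R : Finset (Pl ℚ))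
    (hR : ∀ P : Pl k, below ℚ P ∉ R → eR ℚ P = 1) :
    Nat.card {c : ClassGroup (𝓞 k) // c ^ 2 = 1} ≤ 2 ^ (R.card + 2) := by
  classical
  have hα : ∀ c : {c : ClassGroup (𝓞 k) // c ^ 2 = 1},
      ∃ (I : (FractionalIdeal (nonZeroDivisors (𝓞 k)) k)ˣ) (α : k), ClassGroup.mk (K := k) I = c ∧
      α ≠ 0 ∧ ∀ v : Pl k, ord v α = 2 * FractionalIdeal.count k v (I : FractionalIdeal _ k) := by
    rintro ⟨c, hc⟩
    obtain ⟨I, rfl⟩ := exists_mk_eq c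
    rw [← map_pow] at hc
    obtain ⟨α, h0, hα⟩ := exists_of_mk_eq (I := I ^ 2) (J := 1) (by rw [hc, map_one])
    refine ⟨I, α, rfl, h0, fun v => ?_⟩
    rw [hα, Units.val_one, FractionalIdeal.count_one, sub_zero, Units.val_pow_eq_pow_val,
      FractionalIdeal.count_pow, Nat.cast_ofNat]
  choose I α hI hα0 hα using hα
  choose n hn using fun c => hσ.norm_mem (α c)
  have hn0 : ∀ c, n c ≠ 0 := fun c h => by
    have := hn c
    rw [h, map_zero] at this
    exact mul_ne_zero (hα0 c) (by simpa using hα0 c) this.symm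
  have hγ : ∃ γ : k, γ ≠ 0 ∧ (∀ P : Pl k, Even (ord P γ)) ∧ ∀ c, n c < 0 →
      ∃ n' : ℚ, 0 < n' ∧ algebraMap ℚ k n' = (α c * γ) * σ (α c * γ) := by
    by_cases h : ∃ c, n c < 0
    · obtain ⟨c0, hc0⟩ := h
      refine ⟨α c0, hα0 c0, fun P => by rw [hα]; exact even_two_mul _, fun c hc => ?_⟩
      refine ⟨n c * n c0, mul_pos_of_neg_of_neg hc hc0, ?_⟩
      rw [map_mul, map_mul, hn, hn]; ring
    · exact ⟨1, one_ne_zero, fun P => by simp, fun c hc => absurd ⟨c, hc⟩ h⟩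
  obtain ⟨γ, hγ0, hγe, hγ⟩ := hγ
  let δ : {c : ClassGroup (𝓞 k) // c ^ 2 = 1} → k := fun c => if n c < 0 then γ else 1
  have hδ0 : ∀ c, δ c ≠ 0 := fun c => by simp only [δ]; split_ifs <;> simp [hγ0]
  have hδe : ∀ c (P : Pl k), Even (ord P (δ c)) := fun c P => by
    simp only [δ]; split_ifs
    · exact hγe P
    · simp
  have hev : ∀ c (P : Pl k), Even (ord P (α c * δ c)) := fun c P => by
    rw [ord_mul _ (hα0 c) (hδ0 c), hα]
    exact (even_two_mul _).add (hδe c P)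
  have hq : ∀ c, ∃ (q : ℚ) (z : k), q ≠ 0 ∧ z ≠ 0 ∧ α c * δ c = algebraMap ℚ k q * z ^ 2 := by
    intro c
    by_cases h : n c < 0
    · obtain ⟨n', h1, h2⟩ := hγ c h
      refine hσ.exists_rat (mul_ne_zero (hα0 c) (hδ0 c)) (hev c) h1 ?_
      simp only [δ, if_pos h, h2]
    · refine hσ.exists_rat (mul_ne_zero (hα0 c) (hδ0 c)) (hev c)
        (lt_of_le_of_ne (not_lt.1 h) (hn0 c).symm) ?_
      simp only [δ, if_neg h, hn, mul_one]
  choose q z hq0 hz0 hqz using hq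
  let B : {c : ClassGroup (𝓞 k) // c ^ 2 = 1} → Bool × Bool × (R → Bool) := fun c =>
    (decide (n c < 0), decide (q c < 0), fun v => decide (Even (ord (v : Pl ℚ) (q c))))
  have hB : Function.Injective B := by
    intro c c' h
    simp only [B, Prod.mk.injEq, decide_eq_decide] at h
    obtain ⟨h1, h2, h3⟩ := h
    have h3 : ∀ v ∈ R, (Even (ord v (q c)) ↔ Even (ord v (q c'))) := fun v hv => by
      simpa using congrFun h3 ⟨v, hv⟩
    have hpar : ∀ c (P : Pl k), below ℚ P ∉ R → Even (ord (below ℚ P) (q c)) := by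
      intro c P hP
      have h4 := hev c P
      rw [hqz, ord_mul _ (by simpa using hq0 c) (pow_ne_zero 2 (hz0 c)), ord_pow, ord_algebraMap,
        hR P hP, Nat.cast_one, one_mul, Nat.cast_ofNat] at h4
      obtain ⟨t, ht⟩ := h4
      exact ⟨t - ord P (z c), by linarith⟩
    have hsq : IsSquare (q c * q c') := by
      apply isSquare_rat
      · rcases lt_or_gt_of_ne (hq0 c) with h4 | h4
        · exact mul_pos_of_neg_of_neg h4 (h2.1 h4)
        · exact mul_pos h4 (lt_of_le_of_ne (not_lt.1 fun h => h4.not_gt (h2.2 h)) (hq0 c').symm)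
      · intro v
        rw [ord_mul _ (hq0 c) (hq0 c')]
        by_cases hv : v ∈ R
        · rw [Int.even_add]; exact h3 v hv
        · obtain ⟨P, rfl⟩ := exists_above (k := ℚ) (K := k) v
          exact (hpar c P hv).add (hpar c' P hv)
    obtain ⟨t, ht⟩ := hsq
    have ht0 : t ≠ 0 := by
      rintro rfl
      exact mul_ne_zero (hq0 c) (hq0 c') (by simpa using ht)
    have hδ : δ c = δ c' := by simp only [δ, h1]
    let w : k := algebraMap ℚ k t * z c * z c' / δ c
    have hw0 : w ≠ 0 := div_ne_zero (mul_ne_zero (mul_ne_zero (by simpa using ht0) (hz0 c))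
      (hz0 c')) (hδ0 c)
    have hw : w ^ 2 = α c * α c' := by
      simp only [w]
      rw [div_pow, div_eq_iff (pow_ne_zero 2 (hδ0 c))]
      have e1 := hqz c
      have e2 := hqz c'
      rw [← hδ] at e2
      have e3 : algebraMap ℚ k (q c) * algebraMap ℚ k (q c') = algebraMap ℚ k t ^ 2 := by
        rw [← map_mul, ht, map_mul, sq]
      calc _ = (algebraMap ℚ k t ^ 2) * z c ^ 2 * z c' ^ 2 := by ring
        _ = (algebraMap ℚ k (q c) * z c ^ 2) * (algebraMap ℚ k (q c') * z c' ^ 2) := by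
          rw [← e3]; ring
        _ = _ := by rw [← e1, ← e2]; ring
    have h5 : ClassGroup.mk (K := k) (I c) = ClassGroup.mk (K := k) (I c')⁻¹ := by
      apply mk_eq_of_ord hw0
      intro v
      have h6 := congrArg (ord v) hw
      rw [ord_pow, ord_mul _ (hα0 c) (hα0 c'), hα, hα] at h6
      rw [Units.val_inv_eq_inv_val, FractionalIdeal.count_inv]
      push_cast at h6
      linarith
    rw [map_inv, hI, hI, eq_comm, inv_eq_iff_mul_eq_one] at h5
    apply Subtype.ext
    have h6 := c'.2
    rw [sq] at h6
    exact (mul_left_cancel (h6.trans h5.symm)).symm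
  have := Nat.card_le_card_of_injective B hB
  refine this.trans (le_of_eq ?_)
  simp
  ring

end Tower

namespace Tower

open NumberField IsDedekindDomain

section

variable {k L : Type} [Field k] [NumberField k] [Field L] [NumberField L] [Algebra k L]

open scoped nonZeroDivisors in
attribute [local instance] FractionRing.liftAlgebra in
lemma natAbs_discr_of_unramified (h : ∀ P : Pl L, eR k P = 1) :
    (discr L).natAbs = (discr k).natAbs ^ Module.finrank k L := by
  have hd : differentIdeal (𝓞 k) (𝓞 L) = ⊤ := by
    by_contra hne
    obtain ⟨P, hP, hle⟩ := Ideal.exists_le_maximal _ hne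
    have hP0 : P ≠ ⊥ := by
      rintro rfl
      exact differentIdeal_ne_bot (A := 𝓞 k) (B := 𝓞 L) (le_bot_iff.1 hle)
    have := hP.isPrime
    have h1 := h ⟨P, hP.isPrime, hP0⟩
    have : P.LiesOver (below k (⟨P, hP.isPrime, hP0⟩ : Pl L)).asIdeal := ⟨rfl⟩
    have h3 : (below k (⟨P, hP.isPrime, hP0⟩ : Pl L)).asIdeal.ramificationIdx' P =
        P.ramificationIdx (𝓞 k) :=
      Ideal.ramificationIdx'_eq_ramificationIdx _ _ (below k _).ne_bot
    have h2 : Algebra.IsUnramifiedAt (𝓞 k) P := Ideal.ramificationIdx_eq_one_iff.1 (h3 ▸ h1)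
    exact not_dvd_differentIdeal_iff.2 h2 (Ideal.dvd_iff_le.2 hle)
  rw [natAbs_discr_eq_absNorm_differentIdeal_mul_natAbs_discr_pow k (𝓞 k) L (𝓞 L), hd]
  simp

lemma exists_embeddings {F : Type} [Field F] (hgal : IsGalois k L) {n : ℕ}
    (hn : Module.finrank k L = n) (h : Extends k L F) {ψ : Fin 2 → (k →+* F)}
    (hψ : Function.Injective ψ) :
    ∃ e : Fin (2 * n) → (L →+* F), Function.Injective e := by
  choose φ hφ using h
  have hcard : Nat.card (L ≃ₐ[k] L) = n := by rw [IsGalois.card_aut_eq_finrank, hn]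
  let E : Fin (2 * n) ≃ Fin 2 × (L ≃ₐ[k] L) :=
    finProdFinEquiv.symm.trans (Equiv.prodCongr (Equiv.refl _) (Finite.equivFinOfCardEq hcard).symm)
  let e : Fin 2 × (L ≃ₐ[k] L) → (L →+* F) := fun x => (φ (ψ x.1)).comp (x.2 : L →+* L)
  refine ⟨e ∘ E, Function.Injective.comp ?_ E.injective⟩
  rintro ⟨i, σ⟩ ⟨j, τ⟩ hij
  simp only [e] at hij
  have h1 : ψ i = ψ j := by
    rw [← hφ (ψ i), ← hφ (ψ j)]
    ext x
    have := congrFun (congrArg DFunLike.coe hij) (algebraMap k L x)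
    simpa using this
  have h2 := hψ h1
  subst h2
  simp only [Prod.mk.injEq, true_and]
  ext x
  have := congrFun (congrArg DFunLike.coe hij) x
  exact (φ (ψ i)).injective this

lemma adm_self (p : ℕ) [Fact p.Prime] : Adm p k k where
  gal := inferInstance
  deg := ⟨0, by simp⟩
  unr := fun P => by
    obtain ⟨x, hx0, hx⟩ := exists_uniformizer P
    have h := ord_algebraMap (k := k) P x
    rw [Algebra.algebraMap_self, RingHom.id_apply, hx] at h
    have := Int.eq_one_or_neg_one_of_mul_eq_one h.symm
    omega
  real := fun ψ => ⟨ψ, rfl⟩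
  two := fun ψ => ⟨ψ, rfl⟩
  padic := fun ψ => ⟨ψ, rfl⟩

lemma ord_coprime (v : Pl k) {a b : ℕ} (h : a.Coprime b) : ord v (a : k) = 0 ∨ ord v (b : k) = 0 := by
  by_contra! hne
  have key : ∀ a : ℕ, ord v (a : k) ≠ 0 → Vge v 1 (a : k) := by
    intro a ha
    have h0 : (a : k) ≠ 0 := by rintro h; simp [h] at ha
    have h1 := (vge_iff h0).1 (vge_natCast v a)
    exact (vge_iff h0).2 (by omega)
  have h1 : (1 : k) = a * ((a.gcdA b : ℤ) : k) + b * ((a.gcdB b : ℤ) : k) := by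
    have := Nat.gcd_eq_gcd_ab a b
    rw [h] at this
    exact_mod_cast congrArg (fun t : ℤ => (t : k)) this
  have h2 : Vge v 1 (1 : k) := by
    rw [h1]
    exact ((key a hne.1).mul (vge_intCast v _)).add ((key b hne.2).mul (vge_intCast v _))
  rw [vge_iff one_ne_zero] at h2
  simp at h2

lemma even_ord_of_sq (v : Pl k) {a b : ℕ} (ha : a ≠ 0) (hb : b ≠ 0) (h : a.Coprime b) {s : k}
    (hs : s ^ 2 = ((a * b : ℕ) : k)) : Even (ord v (a : k)) := by
  have ha' : (a : k) ≠ 0 := by exact_mod_cast ha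
  have hb' : (b : k) ≠ 0 := by exact_mod_cast hb
  rcases ord_coprime v h with h1 | h1
  · simp [h1]
  · have h2 := congrArg (ord v) hs
    rw [ord_pow, Nat.cast_mul, ord_mul _ ha' hb', h1, add_zero] at h2
    rw [← h2]
    push_cast
    exact even_two_mul _

end

/-- The place of `ℚ` at a prime number. -/
lemma exists_place (q : ℕ) [Fact q.Prime] :
    ∃ V : Pl ℚ, ord V (q : ℚ) = 1 ∧ ∀ v : Pl ℚ, ord v (q : ℚ) ≠ 0 → v = V := by
  obtain ⟨V, -, hV⟩ := exists_ind (Rat.castHom ℚ_[q])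
  refine ⟨V, hV, fun v hv => ?_⟩
  have key : ∀ w w' : Pl ℚ, ord w (q : ℚ) ≠ 0 → ord w' (q : ℚ) ≠ 0 →
      ∀ a : 𝓞 ℚ, a ∈ w.asIdeal → a ∈ w'.asIdeal := by
    intro w w' hw hw' a ha
    have hq0 : (q : ℚ) ≠ 0 := by exact_mod_cast (Fact.out : q.Prime).ne_zero
    obtain ⟨n, rfl⟩ := Rat.ringOfIntegersEquiv.symm.surjective a
    rw [eq_intCast] at ha ⊢
    have hmem : ∀ (w : Pl ℚ) (n : ℤ), (n : 𝓞 ℚ) ∈ w.asIdeal ↔ Vge w 1 (n : ℚ) := by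
      intro w n
      have := vge_int_iff w (n : 𝓞 ℚ) 1
      rw [pow_one] at this
      rw [← this]
      simp
    rw [hmem] at ha ⊢
    by_cases hn : n = 0
    · subst hn; simp
    have hn' : (n : ℚ) ≠ 0 := by exact_mod_cast hn
    have habs : ∀ w : Pl ℚ, ord w (n.natAbs : ℚ) = ord w (n : ℚ) := by
      intro w
      rcases Int.natAbs_eq n with h | h
      · conv_rhs => rw [h]
        simp
      · conv_rhs => rw [h]
        simp
    have h1 : ord w (n.natAbs : ℚ) ≠ 0 := by
      rw [habs]
      have := (vge_iff hn').1 ha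
      omega
    have hdvd : q ∣ n.natAbs := by
      by_contra hnd
      rcases ord_coprime w (((Fact.out : q.Prime).coprime_iff_not_dvd).2 hnd) with h | h
      · exact hw h
      · exact h1 h
    obtain ⟨c, hc⟩ := hdvd
    have hc0 : (c : ℚ) ≠ 0 := by
      rintro h
      rw [hc, Nat.cast_mul, h] at h1
      simp at h1
    rw [vge_iff hn', ← habs, hc, Nat.cast_mul, ord_mul _ hq0 hc0]
    have h2 := (vge_iff hc0).1 (vge_natCast w' c)
    have h3 := (vge_iff hq0).1 (vge_natCast w' q)
    omega
  have hV' : ord V (q : ℚ) ≠ 0 := by rw [hV]; norm_num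
  exact HeightOneSpectrum.ext (Ideal.ext fun a => ⟨key v V hv hV' a, key V v hV' hv a⟩)

variable {k : Type} [Field k] [NumberField k]

namespace IsConj

variable {σ : k ≃ₐ[ℚ] k} (hσ : IsConj σ) {s : k} {D : ℕ} (hs0 : s ≠ 0) (hs : σ s = -s)
  (hD : s ^ 2 = (D : k))
include hσ hs0 hs hD

lemma totallyReal_of_natCast : IsTotallyReal k := by
  have hD0 : (D : ℚ) ≠ 0 := by
    intro h
    have h' : D = 0 := by exact_mod_cast h
    rw [h', Nat.cast_zero] at hD
    exact hs0 (pow_eq_zero_iff two_ne_zero |>.1 hD)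
  refine hσ.isTotallyReal (z := Units.mk0 (D : ℚ) hD0) hs0 (by simpa using hD) hs fun φ => ?_
  refine mem_Pos.2 ⟨D, ?_, by simp⟩
  have : 0 < D := Nat.pos_of_ne_zero (by exact_mod_cast hD0)
  exact_mod_cast this

lemma exists_hom (F : Type) [Field F] [CharZero F] (h : IsSquare (D : F)) :
    ∃ ψ : Fin 2 → (k →+* F), Function.Injective ψ := by
  have : Algebra ℚ F := DivisionRing.toRatAlgebra
  obtain ⟨t, ht⟩ := h
  obtain ⟨ψ, -, hψ⟩ := hσ.exists_lift hs0 hs (α := (D : ℚ)) (by simpa using hD)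
    (Rat.castHom F) (t := t) (by simp [ht, sq])
  refine ⟨![ψ, ψ.comp (σ : k →+* k)], ?_⟩
  have hne : ψ ≠ ψ.comp (σ : k →+* k) := by
    intro h
    have h1 := congrFun (congrArg DFunLike.coe h) s
    simp only [RingHom.coe_comp, Function.comp_apply, RingHom.coe_coe, hs, map_neg] at h1
    exact hs0 (by simpa using self_eq_neg.1 h1)
  intro i j hij
  fin_cases i <;> fin_cases j <;> simp_all

lemma exists_ind_of_dyadic (h2 : IsSquare (D : ℚ_[2])) (v : Pl k) (hv : ord v 2 ≠ 0) :
    (∃ ψ : k →+* ℚ_[2], Ind ψ v) ∧ eR ℚ v = 1 := by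
  have : Algebra.IsQuadraticExtension ℚ k :=
    ⟨hσ.finrank_eq_two⟩
  obtain ⟨ψ, -⟩ := hσ.exists_hom hs0 hs hD ℚ_[2] h2
  obtain ⟨P, hP, hP1⟩ := exists_ind (ψ 0)
  obtain ⟨V, hV, hV'⟩ := exists_place 2
  have hdy : ∀ w : Pl k, ord w 2 ≠ 0 → below ℚ w = V := by
    intro w hw
    apply hV'
    intro h
    apply hw
    have := ord_algebraMap w (2 : ℚ)
    rw [map_ofNat] at this
    rw [this]
    rw [Nat.cast_ofNat] at h
    rw [h, mul_zero]
  have hP2 : ord P 2 = 1 := by simpa using hP1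
  obtain ⟨τ, hτ⟩ := gPl_transitive (k := ℚ) (P := P) (Q := v)
    ((hdy P (by rw [hP2]; norm_num)).trans (hdy v hv).symm)
  have he : eR ℚ P = 1 := by
    have := ord_algebraMap P (2 : ℚ)
    rw [map_ofNat, hP2] at this
    have := Int.eq_one_or_neg_one_of_mul_eq_one this.symm
    omega
  refine ⟨?_, by rw [← hτ, eR_gPl, he]⟩
  refine ⟨(ψ 0).comp (τ.symm : k →+* k), fun a => ?_⟩
  subst hτ
  by_cases ha : (a : k) = 0
  · have : a = 0 := by exact_mod_cast ha
    subst this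
    simp
  have h1 := vge_int_iff (gPl τ P) a 1
  rw [pow_one] at h1
  rw [← h1]
  obtain ⟨b, hb⟩ := mem_integers_of_vge (x := τ.symm a) (fun w => by
    have := vge_gPl τ w (τ.symm a) 0
    rw [AlgEquiv.apply_symm_apply] at this
    exact this.1 (vge_int _ a))
  have h2 := vge_gPl τ P (τ.symm a) 1
  rw [AlgEquiv.apply_symm_apply] at h2
  have h3 := vge_int_iff P b 1
  rw [pow_one, hb] at h3
  rw [Nat.cast_one, h2]
  refine Iff.trans ?_ ((h3.trans (hP b)).trans ?_)
  · simp
  · rw [hb]; rfl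

lemma dyadic (h2 : IsSquare (D : ℚ_[2])) : Dyadic k := fun v hv =>
  (hσ.exists_ind_of_dyadic hs0 hs hD h2 v hv).1

lemma clB (h2 : IsSquare (D : ℚ_[2])) (Q : Finset ℕ) (hQ : ∀ q ∈ Q, q.Prime)
    (hDQ : D = ∏ q ∈ Q, q) : ClB k (2 ^ (Q.card + 2)) := by
  classical
  have hV : ∀ q : Q, ∃ V : Pl ℚ, ord V (q : ℚ) = 1 ∧ ∀ v : Pl ℚ, ord v (q : ℚ) ≠ 0 → v = V := by
    rintro ⟨q, hq⟩
    have : Fact q.Prime := ⟨hQ q hq⟩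
    exact exists_place q
  choose V hV1 hV using hV
  let R : Finset (Pl ℚ) := Finset.univ.image V
  have hRc : R.card ≤ Q.card := Finset.card_image_le.trans (by simp)
  apply clB_of_card
  refine (hσ.card_two_torsion R ?_).trans (Nat.pow_le_pow_right (by norm_num) (by omega))
  intro P hP
  by_cases h : ord (below ℚ P) 2 = 0
  · refine hσ.eR_eq_one_of_sqrt hs0 hs (x := (D : ℚ)) (by simpa using hD.symm) ?_ h
    have h0 : ∀ q ∈ Q, ord (below ℚ P) (q : ℚ) = 0 := by
      intro q hq
      by_contra hne
      exact hP (Finset.mem_image.2 ⟨⟨q, hq⟩, Finset.mem_univ _, (hV ⟨q, hq⟩ _ hne).symm⟩)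
    have : ∀ S ⊆ Q, ord (below ℚ P) ((∏ q ∈ S, q : ℕ) : ℚ) = 0 := by
      intro S
      induction S using Finset.induction_on with
      | empty => simp
      | insert q S hq ih =>
        intro hS
        have hqQ := hS (Finset.mem_insert_self q S)
        have hSQ : S ⊆ Q := fun x hx => hS (Finset.mem_insert_of_mem hx)
        rw [Finset.prod_insert hq, Nat.cast_mul, ord_mul, h0 q hqQ, ih hSQ, add_zero]
        · exact_mod_cast (hQ q hqQ).ne_zero
        · exact_mod_cast Finset.prod_ne_zero_iff.2 fun x hx => (hQ x (hSQ hx)).ne_zero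
    rw [hDQ, this Q subset_rfl]
    exact Even.zero
  · refine (hσ.exists_ind_of_dyadic hs0 hs hD h2 P ?_).2
    have h1 := ord_algebraMap P (2 : ℚ)
    rw [map_ofNat] at h1
    rw [h1]
    exact mul_ne_zero (by have := eR_pos (k := ℚ) P; omega) h

end IsConj

end Tower

namespace Tower

open NumberField IsDedekindDomain

section

variable {p : ℕ} [Fact p.Prime] {k L : Type} [Field k] [NumberField k] [Field L] [NumberField L]
  [Algebra k L]

lemma Adm.isSquare_natCast (h : Adm p k L) (h2 : Dyadic k)
    (hmax : ∀ (M : Type) [Field M] [NumberField M] [Algebra k M], Adm p k M →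
      Module.finrank k M ≠ 2 * Module.finrank k L) {d : ℕ}
    (htwo : IsSquare (d : ℚ_[2])) (hp : IsSquare (d : ℚ_[p]))
    (hev : ∀ v : Pl k, Even (ord v (d : k))) : IsSquare (d : L) := by
  by_contra hns
  obtain ⟨M, _, _, _, hM, hM2⟩ := h.step h2 (α := (d : L)) (fun σ => ⟨1, by simp⟩) (fun P => by
      have := ord_algebraMap (k := k) P (d : k)
      rw [map_natCast] at this
      rw [this]
      exact (hev _).mul_left _)
    (fun ψ => by
      obtain ⟨φ, hφ⟩ := h.real ψ
      refine ⟨φ, hφ, ?_⟩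
      rw [map_natCast]
      exact ⟨√d, (Real.mul_self_sqrt (Nat.cast_nonneg d)).symm⟩)
    (fun ψ => by
      obtain ⟨φ, hφ⟩ := h.two ψ
      exact ⟨φ, hφ, by rwa [map_natCast]⟩)
    (fun ψ => by
      obtain ⟨φ, hφ⟩ := h.padic ψ
      exact ⟨φ, hφ, by rwa [map_natCast]⟩) hns
  exact hmax M hM hM2

/-- Kummer characters attached to square roots that are independent modulo `k`. -/
lemma le_finrank_Hm (hgal : IsGalois k L) {n : ℕ} {r : Fin n → L} {d : Fin n → k}
    (hr : ∀ i, r i ^ 2 = algebraMap k L (d i))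
    (hind : ∀ S : Finset (Fin n), S.Nonempty → ∀ x : k, algebraMap k L x ≠ ∏ i ∈ S, r i) :
    n ≤ Module.finrank (ZMod 2) (Hm (L ≃ₐ[k] L)) := by
  classical
  have hr0 : ∀ i, r i ≠ 0 := by
    intro i h
    exact hind {i} (Finset.singleton_nonempty i) 0 (by simp [h])
  have hpm : ∀ (σ : L ≃ₐ[k] L) i, σ (r i) = r i ∨ σ (r i) = -r i := by
    intro σ i
    rw [← sq_eq_sq_iff_eq_or_eq_neg, ← map_pow, hr, AlgEquiv.commutes]
  have hne : ∀ i, -r i ≠ r i := fun i h => hr0 i (self_eq_neg.1 h.symm)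
  let χ : Fin n → (L ≃ₐ[k] L) → ZMod 2 := fun i σ => if σ (r i) = r i then 0 else 1
  have hχ : ∀ i, χ i ∈ Hm (L ≃ₐ[k] L) := by
    intro i
    rw [mem_Hm]
    intro σ τ
    simp only [χ, AlgEquiv.mul_apply]
    rcases hpm σ i with h1 | h1 <;> rcases hpm τ i with h2 | h2 <;>
      simp [h1, h2, hne]
    decide
  have hχs : ∀ i σ, σ (r i) = (-1) ^ (χ i σ).val * r i := by
    intro i σ
    rcases hpm σ i with h1 | h1
    · simp [χ, h1]
    · simp [χ, h1, hne, ZMod.val_one]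
  have hlin : LinearIndependent (ZMod 2) (fun i => (⟨χ i, hχ i⟩ : Hm (L ≃ₐ[k] L))) := by
    rw [Fintype.linearIndependent_iff]
    intro c hc
    by_contra! hne
    obtain ⟨i₀, hi₀⟩ := hne
    let S : Finset (Fin n) := Finset.univ.filter fun i => c i ≠ 0
    have hfix : ∀ σ : L ≃ₐ[k] L, σ (∏ i ∈ S, r i) = ∏ i ∈ S, r i := by
      intro σ
      have h1 : ∑ i ∈ S, χ i σ = 0 := by
        have h2 := congrFun (congrArg Subtype.val hc) σ
        simp only [AddSubmonoidClass.coe_finsetSum, SetLike.val_smul, Finset.sum_apply,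
          Pi.smul_apply, smul_eq_mul, ZeroMemClass.coe_zero, Pi.zero_apply] at h2
        rw [← h2, Finset.sum_filter]
        refine Finset.sum_congr rfl fun i _ => ?_
        have : ∀ z : ZMod 2, ∀ y : ZMod 2, (if z ≠ 0 then y else 0) = z * y := by decide
        exact this _ _
      have h3 : Even (∑ i ∈ S, (χ i σ).val) := by
        rw [← ZMod.natCast_eq_zero_iff_even]
        push_cast
        simpa using h1
      rw [map_prod, Finset.prod_congr rfl fun i _ => hχs i σ, Finset.prod_mul_distrib,
        Finset.prod_pow_eq_pow_sum, h3.neg_one_pow, one_mul]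
    have hmem : ∏ i ∈ S, r i ∈ (⊥ : IntermediateField k L) :=
      (IsGalois.mem_bot_iff_fixed _).2 hfix
    obtain ⟨x, hx⟩ := IntermediateField.mem_bot.1 hmem
    exact hind S ⟨i₀, by simp [S, hi₀]⟩ x hx
  simpa using hlin.fintype_card_le_finrank

lemma not_isSquare_prod {ι : Type} {q : ι → ℕ} (hq : Function.Injective q)
    (hp : ∀ i, (q i).Prime) {T : Finset ι} (hT : T.Nonempty) : ¬ IsSquare (∏ i ∈ T, q i) := by
  intro h
  have hsf : Squarefree (∏ i ∈ T, q i) := by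
    apply Finset.squarefree_prod_of_pairwise_isCoprime
    · intro i _ j _ hij
      rw [Function.onFun, ← Nat.coprime_iff_isRelPrime]
      exact (Nat.coprime_primes (hp i) (hp j)).2 fun h => hij (hq h)
    · exact fun i _ => (hp i).squarefree
  obtain ⟨t, ht⟩ := h
  have h1 := hsf t ⟨1, by rw [ht, mul_one]⟩
  rw [Nat.isUnit_iff] at h1
  obtain ⟨i, hi⟩ := hT
  have h2 := Finset.dvd_prod_of_mem q hi
  rw [ht, h1] at h2
  exact (hp i).one_lt.ne' (Nat.dvd_one.1 (by simpa using h2))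

end

lemma IsConj.isSquare_rat_or {k : Type} [Field k] [NumberField k] {σ : k ≃ₐ[ℚ] k} (hσ : IsConj σ)
    {s : k} {D : ℕ} (hs : σ s = -s) (hD : s ^ 2 = (D : k)) {x : k} {m : ℕ}
    (hx : x ^ 2 = (m : k)) : IsSquare (m : ℚ) ∨ IsSquare ((m : ℚ) * D) := by
  have h : σ x = x ∨ σ x = -x := by
    rw [← sq_eq_sq_iff_eq_or_eq_neg, ← map_pow, hx, map_natCast]
  rcases h with h | h
  · obtain ⟨a, ha⟩ := hσ.fixed x h
    refine Or.inl ⟨a, (algebraMap ℚ k).injective ?_⟩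
    rw [map_natCast, map_mul, ha, ← hx, sq]
  · obtain ⟨a, ha⟩ := hσ.fixed (x * s) (by rw [map_mul, h, hs, neg_mul_neg])
    refine Or.inr ⟨a, (algebraMap ℚ k).injective ?_⟩
    rw [map_mul, map_mul, map_natCast, map_natCast, ha, ← hx, ← hD]
    ring

section

variable {p : ℕ} [Fact p.Prime] {q : Fin 17 × Fin 2 → ℕ} (hq : Function.Injective q)
  (hqp : ∀ i, (q i).Prime)
  (hp : ∀ j, IsSquare ((q (j, 0) * q (j, 1) : ℕ) : ℚ_[p]))
  (h2 : ∀ j, IsSquare ((q (j, 0) * q (j, 1) : ℕ) : ℚ_[2]))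
include hq hqp hp h2

lemma exists_adm {k : Type} [Field k] [NumberField k] {σ : k ≃ₐ[ℚ] k} (hσ : IsConj σ) {s : k}
    (hs0 : s ≠ 0) (hs : σ s = -s) (hD : s ^ 2 = ((∏ i, q i : ℕ) : k)) (n : ℕ) :
    ∃ (L : Type) (_ : Field L) (_ : NumberField L) (_ : Algebra k L),
      Adm p k L ∧ Module.finrank k L = 2 ^ n := by
  classical
  have hDd : ∏ i, q i = ∏ j : Fin 17, (q (j, 0) * q (j, 1)) := by
    rw [Fintype.prod_prod_type]
    exact Finset.prod_congr rfl fun j _ => Fin.prod_univ_two _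
  have hD2 : IsSquare ((∏ i, q i : ℕ) : ℚ_[2]) := by
    rw [hDd, Nat.cast_prod]
    exact Finset.isSquare_prod _ fun j _ => h2 j
  have hreal := hσ.totallyReal_of_natCast hs0 hs hD
  have hdy := hσ.dyadic hs0 hs hD hD2
  have hcl : ClB k (2 ^ 36) := by
    have := hσ.clB hs0 hs hD hD2 (Finset.univ.map ⟨q, hq⟩) (fun x hx => by
        obtain ⟨i, -, rfl⟩ := Finset.mem_map.1 hx
        exact hqp i)
      (by rw [Finset.prod_map]; rfl)
    simpa using this
  have hd0 : ∀ j, q (j, 0) * q (j, 1) ≠ 0 := fun j =>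
    mul_ne_zero (hqp _).ne_zero (hqp _).ne_zero
  induction n with
  | zero => exact ⟨k, _, _, Algebra.id k, adm_self p, by simp⟩
  | succ n ih =>
    obtain ⟨L, _, _, _, hL, hn⟩ := ih
    by_contra hno
    have hmax : ∀ (M : Type) [Field M] [NumberField M] [Algebra k M], Adm p k M →
        Module.finrank k M ≠ 2 * Module.finrank k L := fun M _ _ _ hM h =>
      hno ⟨M, _, _, _, hM, by rw [h, hn, pow_succ']⟩
    have hsq : ∀ j, IsSquare ((q (j, 0) * q (j, 1) : ℕ) : L) := by
      intro j
      refine hL.isSquare_natCast hdy hmax (h2 j) (hp j) fun v => ?_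
      refine even_ord_of_sq v (b := ∏ i ∈ Finset.univ.erase j, (q (i, 0) * q (i, 1))) (hd0 j)
        (Finset.prod_ne_zero_iff.2 fun i _ => hd0 i) ?_ (s := s) ?_
      · refine Nat.Coprime.prod_right fun i hi => ?_
        have hij : i ≠ j := (Finset.mem_erase.1 hi).1
        have hc : ∀ a b, (q (j, a)).Coprime (q (i, b)) := fun a b =>
          (Nat.coprime_primes (hqp _) (hqp _)).2 fun h => hij (congrArg Prod.fst (hq h)).symm
        exact Nat.Coprime.mul_left ((hc _ _).mul_right (hc _ _)) ((hc _ _).mul_right (hc _ _))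
      · rw [hD, hDd, Finset.mul_prod_erase _ (fun j => q (j, 0) * q (j, 1)) (Finset.mem_univ j)]
    choose r hr using hsq
    have h16 : 16 ≤ Module.finrank (ZMod 2) (Hm (L ≃ₐ[k] L)) := by
      refine le_finrank_Hm hL.gal (r := fun i : Fin 16 => r i.castSucc)
        (d := fun i => ((q (i.castSucc, 0) * q (i.castSucc, 1) : ℕ) : k)) (fun i => ?_) ?_
      · rw [map_natCast, sq, hr]
      intro S hS x hx
      let T : Finset (Fin 17 × Fin 2) := (S.map Fin.castSuccEmb) ×ˢ Finset.univ
      have hT : ∏ i ∈ T, q i = ∏ i ∈ S, (q (i.castSucc, 0) * q (i.castSucc, 1)) := by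
        rw [Finset.prod_product, Finset.prod_map]
        exact Finset.prod_congr rfl fun j _ => Fin.prod_univ_two _
      have hT0 : ((∏ i ∈ T, q i : ℕ) : ℚ) ≠ 0 := by
        exact_mod_cast Finset.prod_ne_zero_iff.2 fun i _ => (hqp i).ne_zero
      have hx2 : x ^ 2 = ((∏ i ∈ T, q i : ℕ) : k) := by
        apply (algebraMap k L).injective
        rw [map_pow, hx, map_natCast, hT, sq, ← Finset.prod_mul_distrib, Nat.cast_prod]
        exact Finset.prod_congr rfl fun i _ => (hr _).symm
      rcases hσ.isSquare_rat_or hs hD hx2 with h | h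
      · rw [Rat.isSquare_natCast_iff] at h
        obtain ⟨i, hi⟩ := hS
        exact not_isSquare_prod hq hqp ⟨(i.castSucc, 0), by simp [T, hi]⟩ h
      · obtain ⟨t, ht⟩ := h
        rw [← Finset.prod_mul_prod_compl T q, Nat.cast_mul] at ht
        have h : IsSquare ((∏ i ∈ Tᶜ, q i : ℕ) : ℚ) := by
          refine ⟨t / ((∏ i ∈ T, q i : ℕ) : ℚ), ?_⟩
          rw [div_mul_div_comm, ← ht]
          field_simp
        rw [Rat.isSquare_natCast_iff] at h
        refine not_isSquare_prod hq hqp ⟨(Fin.last 16, 0), ?_⟩ h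
        simp only [T, Finset.mem_compl, Finset.mem_product, Finset.mem_map, not_and]
        rintro ⟨x, -, hx⟩
        exact absurd hx (Fin.castSucc_ne_last x)
    obtain ⟨e, he, he'⟩ := exists_rank_bound hL hdy hσ.finrank_eq_two hcl hmax (by omega) rfl
    have h60 : e ≤ 60 := by
      rw [show (16 : ℕ) ^ 6 = 2 ^ 24 by norm_num, ← pow_add] at he'
      exact (Nat.pow_le_pow_iff_right (by norm_num)).1 he'
    nlinarith

end

lemma exists_primes : ∃ ℓ : Fin 17 × Fin 17 → ℕ, Function.Injective ℓ ∧ (∀ i, (ℓ i).Prime) ∧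
    ∀ i, ℓ i ≡ 1 [MOD 8] := by
  let f := (Nat.infinite_setOfPred_prime_modEq_one (k := 8) (by norm_num)).natEmbedding
  refine ⟨fun i => f (finProdFinEquiv i : Fin (17 * 17)), fun i j h => ?_, fun i => ?_, fun i => ?_⟩
  · exact finProdFinEquiv.injective (Fin.ext (f.injective (Subtype.ext h)))
  · exact (f _).2.1
  · exact (f _).2.2

lemma isSquare_two_of_modEq {d : ℕ} (h : d ≡ 1 [MOD 8]) : IsSquare (d : ℚ_[2]) := by
  have h1 : IsSquare (d : ℤ_[2]) := by
    apply isSquare_of_one_mod_eight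
    have h2 : (8 : ℤ) ∣ d - 1 := by
      have := (Nat.modEq_iff_dvd.1 h.symm)
      exact_mod_cast this
    obtain ⟨c, hc⟩ := h2
    exact ⟨c, by exact_mod_cast congrArg (fun t : ℤ => (t : ℤ_[2])) hc⟩
  obtain ⟨y, hy⟩ := h1
  exact ⟨y, by exact_mod_cast congrArg (fun t : ℤ_[2] => (t : ℚ_[2])) hy⟩

lemma exists_quadratic (D : ℕ) : ∃ δ : ℕ, ¬ IsSquare D →
    ∃ (k : Type) (_ : Field k) (_ : NumberField k) (σ : k ≃ₐ[ℚ] k) (s : k),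
      IsConj σ ∧ s ≠ 0 ∧ σ s = -s ∧ s ^ 2 = (D : k) ∧ (discr k).natAbs = δ := by
  by_cases h : IsSquare D
  · exact ⟨0, fun h' => absurd h h'⟩
  · have h' : ¬ IsSquare (D : ℚ) := by rwa [Rat.isSquare_natCast_iff]
    obtain ⟨k, _, _, A, σ, s, hσ, hs, hσs⟩ := exists_quad h'
    obtain rfl : A = DivisionRing.toRatAlgebra := Subsingleton.elim _ _
    rw [map_natCast] at hs
    refine ⟨(discr k).natAbs, fun _ => ⟨k, _, _, σ, s, hσ, ?_, hσs, hs, rfl⟩⟩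
    rintro rfl
    apply h
    have : D = 0 := by simpa using hs.symm
    exact this ▸ IsSquare.zero

/-- A tower of totally real fields of bounded root discriminant over a quadratic field. -/
theorem exists_tower : ∃ C : ℕ, 1 ≤ C ∧ ∀ (p : ℕ) [Fact p.Prime], ∀ n : ℕ,
    ∃ (L : Type) (_ : Field L) (_ : NumberField L), IsTotallyReal L ∧
      Module.finrank ℚ L = 2 * 2 ^ n ∧
      (∃ e : Fin (2 * 2 ^ n) → (L →+* ℚ_[p]), Function.Injective e) ∧
      (discr L).natAbs ≤ C ^ 2 ^ n := by
  classical
  obtain ⟨ℓ, hℓ, hℓp, hℓ8⟩ := exists_primes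
  choose δ hδ using exists_quadratic
  let N : ℕ := ∏ i, ℓ i
  refine ⟨1 + ∑ D ∈ N.divisors, δ D, by omega, fun p _ n => ?_⟩
  obtain ⟨c, hc⟩ := sqB_padic (ℓ := p)
  have hpair : ∀ j : Fin 17, ∃ a b : Fin 17, a ≠ b ∧ c (ℓ (j, a)) = c (ℓ (j, b)) := fun j =>
    Fintype.exists_ne_map_eq_of_card_lt (fun a => c (ℓ (j, a) : ℚ_[p])) (by simp)
  choose a b hab hcab using hpair
  let g : Fin 17 × Fin 2 → Fin 17 × Fin 17 := fun i => (i.1, if i.2 = 0 then a i.1 else b i.1)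
  have hg : Function.Injective g := by
    rintro ⟨i, u⟩ ⟨j, v⟩ h
    simp only [g, Prod.mk.injEq] at h
    obtain ⟨rfl, h⟩ := h
    have := hab i
    have := this.symm
    fin_cases u <;> fin_cases v <;> simp_all
  let q : Fin 17 × Fin 2 → ℕ := fun i => ℓ (g i)
  have hq : Function.Injective q := hℓ.comp hg
  have hqp : ∀ i, (q i).Prime := fun i => hℓp _
  have hp : ∀ j, IsSquare ((q (j, 0) * q (j, 1) : ℕ) : ℚ_[p]) := by
    intro j
    rw [Nat.cast_mul]
    refine hc _ _ ?_ ?_ ?_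
    · exact_mod_cast (hqp _).ne_zero
    · exact_mod_cast (hqp _).ne_zero
    · exact hcab j
  have h2 : ∀ j, IsSquare ((q (j, 0) * q (j, 1) : ℕ) : ℚ_[2]) := fun j =>
    isSquare_two_of_modEq ((hℓ8 _).mul (hℓ8 _))
  have hns : ¬ IsSquare (∏ i, q i) := not_isSquare_prod hq hqp Finset.univ_nonempty
  obtain ⟨k, _, _, σ, s, hσ, hs0, hs, hD, hdisc⟩ := hδ _ hns
  obtain ⟨L, _, _, _, hL, hn⟩ := exists_adm hq hqp hp h2 hσ hs0 hs hD n
  have hreal := hσ.totallyReal_of_natCast hs0 hs hD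
  refine ⟨L, inferInstance, inferInstance, hL.totallyReal, ?_, ?_, ?_⟩
  · rw [← Module.finrank_mul_finrank ℚ k L, hσ.finrank_eq_two, hn]
  · obtain ⟨ψ, hψ⟩ := hσ.exists_hom hs0 hs hD ℚ_[p] (by
      rw [Fintype.prod_prod_type, Nat.cast_prod]
      refine Finset.isSquare_prod _ fun j _ => ?_
      rw [Fin.prod_univ_two]
      exact hp j)
    exact exists_embeddings hL.gal hn hL.padic hψ
  · rw [natAbs_discr_of_unramified hL.unr, hn, hdisc]
    refine Nat.pow_le_pow_left ?_ _
    have hmem : ∏ i, q i ∈ N.divisors := by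
      rw [Nat.mem_divisors]
      refine ⟨?_, Finset.prod_ne_zero_iff.2 fun i _ => (hℓp i).ne_zero⟩
      have := Finset.prod_dvd_prod_of_subset (Finset.univ.map ⟨g, hg⟩) Finset.univ ℓ
        (Finset.subset_univ _)
      rwa [Finset.prod_map] at this
    have := Finset.single_le_sum (f := δ) (fun _ _ => Nat.zero_le _) hmem
    omega

end Tower

/-- There exists an absolute constant `C > 0` such that for every prime `p` and every
`d` a power of `2` there exists a totally real number field `K` of degree `d` in which
`p` splits completely (equivalently, `K` admits `d` distinct embeddings into `ℚ_p`) and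
whose discriminant satisfies `Δ_K ≤ C^d`. -/
theorem statement17 :
    ∃ C : ℝ, 0 < C ∧
      ∀ (p : ℕ) [Fact p.Prime], ∀ m : ℕ,
        ∃ (K : Type) (_ : Field K) (_ : NumberField K),
          TotallyReal K ∧ Module.finrank ℚ K = 2 ^ m ∧
          (∃ e : Fin (2 ^ m) → (K →+* ℚ_[p]), Function.Injective e) ∧
          ((NumberField.discr K).natAbs : ℝ) ≤ C ^ (2 ^ m) := by
  obtain ⟨C, hC, h⟩ := Tower.exists_tower
  have hC' : (1 : ℝ) ≤ C := by exact_mod_cast hC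
  refine ⟨C, by linarith, fun p _ m => ?_⟩
  rcases m with _ | n
  · refine ⟨ℚ, inferInstance, inferInstance, fun φ x => ?_, by simp,
      ⟨fun _ => Rat.castHom _, fun i j _ => Subsingleton.elim (α := Fin 1) i j⟩, ?_⟩
    · rw [eq_ratCast, Complex.ratCast_im]
    · rw [Rat.numberField_discr]
      simpa using hC'
  · obtain ⟨L, _, _, hreal, hn, he, hd⟩ := h p n
    refine ⟨L, inferInstance, inferInstance, ?_, by rw [hn, pow_succ'], by rwa [pow_succ'], ?_⟩
    · intro φ x
      exact Complex.conj_eq_iff_im.1 (RingHom.congr_fun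
        (ComplexEmbedding.isReal_iff.1 (IsTotallyReal.complexEmbedding_isReal φ)) x)
    · refine (?_ : ((discr L).natAbs : ℝ) ≤ (C : ℝ) ^ 2 ^ n).trans
        (pow_le_pow_right₀ hC' (Nat.pow_le_pow_right (by norm_num) (by omega)))
      exact_mod_cast hd
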